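/- arXiv:2301.08075 — 6 statements merged into one kernel-verified Lean document; each statement's English description precedes it below -/
import Mathlib

section
/- Let D > 0, L > 0, A ∈ (0, 2/3) and B₁, C₁ ∈ ℝ. Then there exist ε₀ > 0 and K > 0 such that for every ε ∈ (0, ε₀), with B = εB₁ and C = εC₁, the stationary system admits a 2L-periodic twice continuously differentiable solution (u, v, w) with one fast transition; more precisely, there exist 2L-periodic u, v, w : ℝ → ℝ solving the system such that sup_{x∈ℝ} |v(x) − √(1−A)| ≤ Kε, sup_{x∈ℝ} |w(x) − √(1−A)| ≤ Kε, and sup_{|ξ| ≤ L/ε} |u(εξ) − u_h(ξ)| ≤ Kε, where u_h : ℝ → ℝ is an even nonconstant solution of u_h'' + u_h − u_h³ − A√(1−A) = 0 with lim_{ξ→±∞} u_h(ξ) = √(1−A) and lim_{ξ→±∞} u_h'(ξ) = 0 (the orbit homoclinic to √(1−A)). The analogous statement holds with √(1−A) and u_h replaced by their negatives. -/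
open Real Filter Set

/-- The stationary one-dimensional three-component reaction-diffusion system:
`ε²u″ + u − u³ − (Av + Bw + C) = 0`, `v″ + u − v = 0`, `D²w″ + u − w = 0`,
for twice continuously differentiable `u, v, w : ℝ → ℝ`. -/
def IsStatSol (ε A B C D : ℝ) (u v w : ℝ → ℝ) : Prop :=
  ContDiff ℝ 2 u ∧ ContDiff ℝ 2 v ∧ ContDiff ℝ 2 w ∧
  (∀ x, ε ^ 2 * deriv (deriv u) x + u x - (u x) ^ 3 - (A * v x + B * w x + C) = 0) ∧
  (∀ x, deriv (deriv v) x + u x - v x = 0) ∧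
  (∀ x, D ^ 2 * deriv (deriv w) x + u x - w x = 0)

/-- A function with vanishing derivative is constant. -/
lemma eq_at_zero_of_hasDerivAt_zero {f : ℝ → ℝ} (h : ∀ x, HasDerivAt f 0 x) (x : ℝ) :
    f x = f 0 :=
  is_const_of_deriv_eq_zero (fun y => (h y).differentiableAt) (fun y => (h y).deriv) x 0

lemma eq_zero_of_hasDerivAt_le {η η' : ℝ → ℝ} {C x₀ : ℝ} (h : ∀ x, HasDerivAt η (η' x) x)
    (hC : ∀ x, |η' x| ≤ C * |η x|) (h0 : η x₀ = 0) (x : ℝ) : η x = 0 := by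
  have hb : ∀ x, |η x * η' x| ≤ C * η x ^ 2 := fun x => by
    rw [abs_mul, ← sq_abs (η x)]
    nlinarith [hC x, abs_nonneg (η x)]
  have hexp : ∀ (k x : ℝ), HasDerivAt (fun x => exp (k * x)) (exp (k * x) * k) x := fun k x => by
    simpa using ((hasDerivAt_id x).const_mul k).exp
  rcases le_total x₀ x with hx | hx
  · have hanti : Antitone (fun x => η x ^ 2 * exp (-(2 * C) * x)) := by
      refine antitone_of_hasDerivAt_nonpos (fun x => ((h x).pow 2).mul (hexp _ x)) (fun x => ?_)
      have := (abs_le.1 (hb x)).2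
      have := exp_pos (-(2 * C) * x)
      simp only [Pi.pow_apply, Pi.zero_apply]
      push_cast
      nlinarith
    have := hanti hx
    simp only [h0] at this
    have h2 := exp_pos (-(2 * C) * x)
    have : η x ^ 2 ≤ 0 := by
      by_contra hh
      push Not at hh
      have := mul_pos hh h2
      norm_num at *
      linarith
    exact pow_eq_zero_iff two_ne_zero |>.1 (le_antisymm this (sq_nonneg _))
  · have hmono : Monotone (fun x => η x ^ 2 * exp ((2 * C) * x)) := by
      refine monotone_of_hasDerivAt_nonneg (fun x => ((h x).pow 2).mul (hexp _ x)) (fun x => ?_)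
      have := (abs_le.1 (hb x)).1
      have := exp_pos ((2 * C) * x)
      simp only [Pi.pow_apply, Pi.zero_apply]
      push_cast
      nlinarith
    have := hmono hx
    simp only [h0] at this
    have h2 := exp_pos ((2 * C) * x)
    have : η x ^ 2 ≤ 0 := by
      by_contra hh
      push Not at hh
      have := mul_pos hh h2
      norm_num at *
      linarith
    exact pow_eq_zero_iff two_ne_zero |>.1 (le_antisymm this (sq_nonneg _))

/-- Uniqueness for `d″ = κ² d` with zero Cauchy data. -/
lemma eq_zero_of_linear_ode {d d' : ℝ → ℝ} {κ : ℝ} (h : ∀ x, HasDerivAt d (d' x) x)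
    (h' : ∀ x, HasDerivAt d' (κ ^ 2 * d x) x) (h0 : d 0 = 0) (h0' : d' 0 = 0) (x : ℝ) :
    d x = 0 := by
  have hexp : ∀ (k x : ℝ), HasDerivAt (fun x => exp (k * x)) (exp (k * x) * k) x := fun k x => by
    simpa using ((hasDerivAt_id x).const_mul k).exp
  have h1 : ∀ x, d' x = κ * d x := fun x => by
    have := eq_at_zero_of_hasDerivAt_zero (f := fun x => (d' x - κ * d x) * exp (κ * x))
      (fun x => (((h' x).sub ((h x).const_mul κ)).mul (hexp κ x)).congr_deriv (by simp; ring)) x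
    simp only [h0, h0', mul_zero, sub_zero, zero_mul, mul_eq_zero, exp_ne_zero, or_false] at this
    linarith
  have := eq_at_zero_of_hasDerivAt_zero (f := fun x => d x * exp (-κ * x))
      (fun x => ((h x).mul (hexp (-κ) x)).congr_deriv (by rw [h1]; ring)) x
  simpa [h0, exp_ne_zero] using this

lemma hasDerivAt_cosh_mul (κ x : ℝ) :
    HasDerivAt (fun x => cosh (κ * x)) (κ * sinh (κ * x)) x := by
  simpa [mul_comm] using ((hasDerivAt_id x).const_mul κ).cosh

lemma hasDerivAt_sinh_mul (κ x : ℝ) :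
    HasDerivAt (fun x => sinh (κ * x)) (κ * cosh (κ * x)) x := by
  simpa [mul_comm] using ((hasDerivAt_id x).const_mul κ).sinh

lemma homoclinic_eq {a β κ : ℝ} (hβ : 0 < β) (hβa : β < a) (hκ : 0 < κ)
    (hm : κ ^ 2 = 2 * (a ^ 2 - β ^ 2)) {η η' : ℝ → ℝ} (h : ∀ x, HasDerivAt η (η' x) x)
    (h' : ∀ x, HasDerivAt η' (κ ^ 2 * η x + 3 * a * η x ^ 2 + η x ^ 3) x) (h0 : η' 0 = 0)
    (hne : ∃ x, η x ≠ 0) (htop : Tendsto η atTop (nhds 0)) (hbot : Tendsto η atBot (nhds 0))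
    (htop' : Tendsto η' atTop (nhds 0)) (x : ℝ) :
    η x = -κ ^ 2 / (a + β * cosh (κ * x)) := by
  have hκ2 : 0 < κ ^ 2 := by positivity
  have henergy : ∀ x, η' x ^ 2 = κ ^ 2 * η x ^ 2 + 2 * a * η x ^ 3 + η x ^ 4 / 2 := by
    set E : ℝ → ℝ := fun x => η' x ^ 2 - (κ ^ 2 * η x ^ 2 + 2 * a * η x ^ 3 + η x ^ 4 / 2) with hE
    have hconst : ∀ x, E x = E 0 := eq_at_zero_of_hasDerivAt_zero fun x =>
      (((h' x).pow 2).sub (((((h x).pow 2).const_mul (κ ^ 2)).add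
        (((h x).pow 3).const_mul (2 * a))).add (((h x).pow 4).div_const 2))).congr_deriv
        (by simp; ring)
    have hlim : Tendsto E atTop (nhds 0) := by
      have := (htop'.pow 2).sub ((((htop.pow 2).const_mul (κ ^ 2)).add
        ((htop.pow 3).const_mul (2 * a))).add ((htop.pow 4).div_const 2))
      simpa using this
    have h0 : E 0 = 0 := tendsto_nhds_unique
      ((tendsto_congr hconst).2 tendsto_const_nhds) hlim
    intro x
    have := hconst x
    rw [h0] at this
    simp only [hE] at this
    linarith
  have hcont : Continuous η := continuous_iff_continuousAt.2 fun x => (h x).continuousAt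
  obtain ⟨M, hM⟩ : ∃ M, ∀ x, |η x| ≤ M := by
    let z : ZeroAtInftyContinuousMap ℝ ℝ := ⟨⟨η, hcont⟩, by
      rw [cocompact_eq_atBot_atTop]
      exact hbot.sup htop⟩
    refine ⟨‖z.toBCF‖, fun x => z.toBCF.norm_coe_le_norm x⟩
  have hM0 : 0 ≤ M := (abs_nonneg _).trans (hM 0)
  have ha : 0 < a := hβ.trans hβa
  have hne' : ∀ x, η x ≠ 0 := by
    intro x₀ hx₀
    obtain ⟨x₁, hx₁⟩ := hne
    refine hx₁ (eq_zero_of_hasDerivAt_le (C := √(κ ^ 2 + 2 * a * M + M ^ 2)) h (fun x => ?_) hx₀ x₁)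
    rw [← sqrt_sq (abs_nonneg (η x)), ← sqrt_mul (by positivity)]
    apply abs_le_sqrt
    rw [henergy x]
    have h1 := hM x
    have h2 : η x ≤ M := (le_abs_self _).trans h1
    have h3 : η x ^ 2 ≤ M ^ 2 := by
      rw [← sq_abs]; gcongr
    rw [sq_abs]
    have : κ ^ 2 + 2 * a * η x + η x ^ 2 / 2 ≤ κ ^ 2 + 2 * a * M + M ^ 2 := by
      nlinarith [sq_nonneg (η x)]
    nlinarith [mul_le_mul_of_nonneg_right this (sq_nonneg (η x))]
  have hs : ∀ x, HasDerivAt (fun x => (η x)⁻¹) (-η' x / η x ^ 2) x := fun x => (h x).inv (hne' x)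
  have hs' : ∀ x, HasDerivAt (fun x => -η' x / η x ^ 2) (κ ^ 2 * (η x)⁻¹ + a) x := fun x => by
    refine ((h' x).neg.div ((h x).pow 2) (pow_ne_zero 2 (hne' x))).congr_deriv ?_
    have := hne' x
    simp only [Pi.pow_apply, Pi.neg_apply]
    field_simp
    push_cast
    linear_combination (2 * η x) * henergy x
  have key : ∀ x, (η x)⁻¹ = -a / κ ^ 2 + ((η 0)⁻¹ + a / κ ^ 2) * cosh (κ * x) := by
    intro x
    have := eq_zero_of_linear_ode (κ := κ)
      (d := fun x => (η x)⁻¹ - (-a / κ ^ 2 + ((η 0)⁻¹ + a / κ ^ 2) * cosh (κ * x)))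
      (d' := fun x => -η' x / η x ^ 2 - ((η 0)⁻¹ + a / κ ^ 2) * (κ * sinh (κ * x)))
      (fun x => ((hs x).sub (((hasDerivAt_cosh_mul κ x).const_mul _).const_add _)))
      (fun x => ((hs' x).sub (((hasDerivAt_sinh_mul κ x).const_mul κ).const_mul _)).congr_deriv
        (by field_simp; ring))
      (by simp; ring) (by simp [h0]) x
    linarith
  have hquad : (κ ^ 2 * (η 0)⁻¹ + a) ^ 2 = β ^ 2 := by
    have h1 := henergy 0
    have h2 := hne' 0
    rw [h0] at h1
    have h3 : κ ^ 2 + 2 * a * η 0 + η 0 ^ 2 / 2 = 0 := by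
      have : η 0 ^ 2 * (κ ^ 2 + 2 * a * η 0 + η 0 ^ 2 / 2) = 0 := by linear_combination -h1
      simpa [h2] using this
    field_simp
    linear_combination κ ^ 2 * h3 - (η 0 ^ 2 / 2) * hm
  rcases sq_eq_sq_iff_eq_or_eq_neg.1 hquad with hc | hc
  · exfalso
    have h1 : cosh (κ * (arcosh (a / β) / κ)) = a / β := by
      rw [mul_div_cancel₀ _ hκ.ne', cosh_arcosh]
      rw [le_div_iff₀ hβ]; linarith
    have h2 := key (arcosh (a / β) / κ)
    rw [h1, eq_sub_of_add_eq hc |> fun e => (eq_div_of_mul_eq hκ2.ne' (by linarith) :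
      (η 0)⁻¹ = (β - a) / κ ^ 2)] at h2
    have : (η (arcosh (a / β) / κ))⁻¹ = 0 := by
      rw [h2]; field_simp; ring
    exact hne' _ (inv_eq_zero.1 this)
  · have h2 := key x
    have h3 : (η 0)⁻¹ = (-β - a) / κ ^ 2 := eq_div_of_mul_eq hκ2.ne' (by linarith)
    rw [h3] at h2
    have hD : 0 < a + β * cosh (κ * x) := by have := cosh_pos (κ * x); positivity
    have h4 : (η x)⁻¹ = -(a + β * cosh (κ * x)) / κ ^ 2 := by rw [h2]; field_simp; ring
    rw [← inv_inv (η x), h4, inv_div, neg_div, div_neg]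

/-- Variation of constants for the Neumann problem `g″ = q g + f` on `[0, ℓ]`. -/
lemma exists_green {ℓ M κ ω : ℝ} (hℓ : 0 < ℓ) {y₁ y₁' y₂ y₂' q : ℝ → ℝ}
    (h₁ : ∀ x, HasDerivAt y₁ (y₁' x) x) (h₁' : ∀ x, HasDerivAt y₁' (q x * y₁ x) x)
    (h₂ : ∀ x, HasDerivAt y₂ (y₂' x) x) (h₂' : ∀ x, HasDerivAt y₂' (q x * y₂ x) x)
    (hω : ω ≠ 0) (hw : ∀ x, y₁' x * y₂ x - y₁ x * y₂' x = ω) (hN₁ : y₁' 0 = 0) (hN₂ : y₂' ℓ = 0)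
    (hb : ∀ t x, 0 ≤ t → t ≤ x → x ≤ ℓ → |y₁ t * y₂ x| ≤ M * exp (-κ * (x - t)) * |ω|) :
    ∃ G : C(Icc 0 ℓ, ℝ) →ₗ[ℝ] C(Icc 0 ℓ, ℝ),
      (∀ f, ∃ g g' : ℝ → ℝ, (∀ x : Icc 0 ℓ, G f x = g x) ∧ (∀ x, HasDerivAt g (g' x) x) ∧
        (∀ x, HasDerivAt g' (q x * g x + f.IccExtend hℓ.le x) x) ∧ g' 0 = 0 ∧ g' ℓ = 0) ∧
      ∀ (f : C(Icc 0 ℓ, ℝ)) (x : Icc 0 ℓ), |G f x| ≤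
        M * ((∫ t in (0 : ℝ)..x, exp (-κ * (x - t)) * |f.IccExtend hℓ.le t|) +
          ∫ t in (x : ℝ)..ℓ, exp (-κ * (t - x)) * |f.IccExtend hℓ.le t|) := by
  have hc₁ : Continuous y₁ := continuous_iff_continuousAt.2 fun x => (h₁ x).continuousAt
  have hc₂ : Continuous y₂ := continuous_iff_continuousAt.2 fun x => (h₂ x).continuousAt
  have hcf : ∀ f : C(Icc 0 ℓ, ℝ), Continuous (f.IccExtend hℓ.le) := fun f => f.IccExtend hℓ.le |>.continuous
  let g : C(Icc 0 ℓ, ℝ) → ℝ → ℝ := fun f x => -(1 / ω) *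
    (y₂ x * (∫ t in (0 : ℝ)..x, y₁ t * f.IccExtend hℓ.le t) +
      y₁ x * (∫ t in x..ℓ, y₂ t * f.IccExtend hℓ.le t))
  let g' : C(Icc 0 ℓ, ℝ) → ℝ → ℝ := fun f x => -(1 / ω) *
    (y₂' x * (∫ t in (0 : ℝ)..x, y₁ t * f.IccExtend hℓ.le t) +
      y₁' x * (∫ t in x..ℓ, y₂ t * f.IccExtend hℓ.le t))
  have hI₁ : ∀ (f : C(Icc 0 ℓ, ℝ)) x, HasDerivAt
      (fun x => ∫ t in (0 : ℝ)..x, y₁ t * f.IccExtend hℓ.le t) (y₁ x * f.IccExtend hℓ.le x) x :=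
    fun f x => ((hc₁.mul (hcf f)).integral_hasStrictDerivAt 0 x).hasDerivAt
  have hI₂ : ∀ (f : C(Icc 0 ℓ, ℝ)) x, HasDerivAt
      (fun x => ∫ t in x..ℓ, y₂ t * f.IccExtend hℓ.le t) (-(y₂ x * f.IccExtend hℓ.le x)) x := by
    intro f x
    have := ((hc₂.mul (hcf f)).integral_hasStrictDerivAt ℓ x).hasDerivAt.neg
    refine this.congr_of_eventuallyEq (Eventually.of_forall fun x => ?_)
    exact intervalIntegral.integral_symm _ _
  have hg : ∀ f x, HasDerivAt (g f) (g' f x) x := fun f x =>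
    ((((h₂ x).mul (hI₁ f x)).add ((h₁ x).mul (hI₂ f x))).const_mul _).congr_deriv
      (by simp only [g']; ring)
  have hg' : ∀ f x, HasDerivAt (g' f) (q x * g f x + f.IccExtend hℓ.le x) x := fun f x =>
    ((((h₂' x).mul (hI₁ f x)).add ((h₁' x).mul (hI₂ f x))).const_mul _).congr_deriv (by
      simp only [g]
      field_simp
      linear_combination (f.IccExtend hℓ.le x) * hw x)
  let G : C(Icc 0 ℓ, ℝ) →ₗ[ℝ] C(Icc 0 ℓ, ℝ) :=
    { toFun := fun f => ⟨fun x => g f x,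
        (continuous_iff_continuousAt.2 fun x => (hg f x).continuousAt).comp continuous_subtype_val⟩
      map_add' := fun f₁ f₂ => by
        ext x
        have e : ∀ t, (f₁ + f₂).IccExtend hℓ.le t = f₁.IccExtend hℓ.le t + f₂.IccExtend hℓ.le t :=
          fun t => rfl
        have e₁ : ∀ (y : ℝ → ℝ) (_ : Continuous y) (a b : ℝ),
            ∫ t in a..b, y t * (f₁ + f₂).IccExtend hℓ.le t =
              (∫ t in a..b, y t * f₁.IccExtend hℓ.le t) + ∫ t in a..b, y t * f₂.IccExtend hℓ.le t := by
          intro y hy a b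
          simp only [e, mul_add]
          exact intervalIntegral.integral_add ((hy.mul (hcf f₁)).intervalIntegrable _ _)
            ((hy.mul (hcf f₂)).intervalIntegrable _ _)
        simp only [g, ContinuousMap.coe_mk, ContinuousMap.add_apply, e₁ _ hc₁, e₁ _ hc₂]
        ring
      map_smul' := fun c f => by
        ext x
        have e : ∀ t, (c • f).IccExtend hℓ.le t = c * f.IccExtend hℓ.le t := fun t => rfl
        simp only [g, ContinuousMap.coe_mk, ContinuousMap.smul_apply, e, smul_eq_mul,
          RingHom.id_apply, mul_left_comm _ c, intervalIntegral.integral_const_mul]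
        ring }
  refine ⟨G, fun f => ⟨g f, g' f, fun x => rfl, hg f, hg' f, ?_, ?_⟩, fun f x => ?_⟩
  · simp [g', hN₁]
  · simp [g', hN₂]
  have hω' : 0 < |ω| := abs_pos.2 hω
  have hA : |y₂ x * ∫ t in (0 : ℝ)..x, y₁ t * f.IccExtend hℓ.le t| ≤
      |ω| * (M * ∫ t in (0 : ℝ)..x, exp (-κ * (x - t)) * |f.IccExtend hℓ.le t|) := by
    rw [← intervalIntegral.integral_const_mul, ← intervalIntegral.integral_const_mul,
      ← intervalIntegral.integral_const_mul]
    refine (intervalIntegral.abs_integral_le_integral_abs x.2.1).trans ?_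
    refine intervalIntegral.integral_mono_on x.2.1 ?_ ?_ fun t ht => ?_
    · exact (continuous_const.mul (hc₁.mul (hcf f))).abs.intervalIntegrable _ _
    · have := (hcf f).abs
      exact Continuous.intervalIntegrable (by fun_prop) _ _
    · have := mul_le_mul_of_nonneg_right (hb t x ht.1 ht.2 x.2.2) (abs_nonneg (f.IccExtend hℓ.le t))
      calc _ = |y₁ t * y₂ x| * |f.IccExtend hℓ.le t| := by rw [← abs_mul]; congr 1; ring
        _ ≤ _ := this
        _ = _ := by ring
  have hB : |y₁ x * ∫ t in (x : ℝ)..ℓ, y₂ t * f.IccExtend hℓ.le t| ≤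
      |ω| * (M * ∫ t in (x : ℝ)..ℓ, exp (-κ * (t - x)) * |f.IccExtend hℓ.le t|) := by
    rw [← intervalIntegral.integral_const_mul, ← intervalIntegral.integral_const_mul,
      ← intervalIntegral.integral_const_mul]
    refine (intervalIntegral.abs_integral_le_integral_abs x.2.2).trans ?_
    refine intervalIntegral.integral_mono_on x.2.2 ?_ ?_ fun t ht => ?_
    · exact (continuous_const.mul (hc₂.mul (hcf f))).abs.intervalIntegrable _ _
    · have := (hcf f).abs
      exact Continuous.intervalIntegrable (by fun_prop) _ _
    · have := mul_le_mul_of_nonneg_right (hb x t x.2.1 ht.1 ht.2) (abs_nonneg (f.IccExtend hℓ.le t))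
      calc _ = |y₁ x * y₂ t| * |f.IccExtend hℓ.le t| := by rw [← abs_mul]; congr 1; ring
        _ ≤ _ := this
        _ = _ := by ring
  change |-(1 / ω) * _| ≤ _
  rw [abs_mul, abs_neg, abs_div, abs_one, one_div, inv_mul_le_iff₀ hω', mul_add, mul_add]
  exact (abs_add_le _ _).trans (add_le_add hA hB)

/-- Exponential-kernel bound on exponentially decaying data. -/
lemma kernel_integral_le {κ μ ℓ x F : ℝ} (hμ : 0 ≤ μ) (hμκ : μ < κ) (hx : 0 ≤ x) (hxℓ : x ≤ ℓ)
    {f : ℝ → ℝ} (hf : Continuous f) (hF : ∀ t, 0 ≤ t → t ≤ ℓ → |f t| ≤ F * exp (-μ * t)) :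
    (∫ t in (0 : ℝ)..x, exp (-κ * (x - t)) * |f t|) + (∫ t in x..ℓ, exp (-κ * (t - x)) * |f t|) ≤
      2 / (κ - μ) * F * exp (-μ * x) := by
  have hF0 : 0 ≤ F := by
    have := (abs_nonneg _).trans (hF 0 le_rfl (hx.trans hxℓ))
    simpa using this
  have hk : 0 < κ - μ := sub_pos.2 hμκ
  have hd : ∀ k c t : ℝ, HasDerivAt (fun t => exp (k * (t + c))) (exp (k * (t + c)) * k) t :=
    fun k c t => by simpa using (((hasDerivAt_id t).add_const c).const_mul k).exp
  have hexpint : ∀ k c a b : ℝ, ∫ t in a..b, exp (k * (t + c)) * k = exp (k * (b + c)) - exp (k * (a + c)) :=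
    fun k c a b => intervalIntegral.integral_eq_sub_of_hasDerivAt (fun t _ => hd k c t)
      (Continuous.intervalIntegrable (by fun_prop) _ _)
  have h1 : (∫ t in (0 : ℝ)..x, exp (-κ * (x - t)) * |f t|) ≤ 1 / (κ - μ) * F * exp (-μ * x) := by
    calc _ ≤ ∫ t in (0 : ℝ)..x, (F * exp (-μ * x) / (κ - μ)) *
          (exp ((κ - μ) * (t + -x)) * (κ - μ)) := by
          refine intervalIntegral.integral_mono_on hx ?_ ?_ fun t ht => ?_
          · exact Continuous.intervalIntegrable (by fun_prop) _ _
          · exact Continuous.intervalIntegrable (by fun_prop) _ _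
          · calc _ ≤ exp (-κ * (x - t)) * (F * exp (-μ * t)) := by
                  gcongr; exact hF t ht.1 (ht.2.trans hxℓ)
              _ = F * (exp (-μ * x) * exp ((κ - μ) * (t + -x))) := by
                  rw [mul_left_comm, ← exp_add, ← exp_add]; ring_nf
              _ = _ := by field_simp
      _ = (F * exp (-μ * x) / (κ - μ)) * (1 - exp ((κ - μ) * (0 + -x))) := by
          rw [intervalIntegral.integral_const_mul, hexpint]; simp
      _ ≤ (F * exp (-μ * x) / (κ - μ)) * 1 := by
          gcongr; linarith [exp_pos ((κ - μ) * (0 + -x))]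
      _ = _ := by ring
  have h2 : (∫ t in x..ℓ, exp (-κ * (t - x)) * |f t|) ≤ 1 / (κ - μ) * F * exp (-μ * x) := by
    calc _ ≤ ∫ t in x..ℓ, -(F * exp (-μ * x) / (κ - μ)) *
          (exp (-(κ - μ) * (t + -x)) * -(κ - μ)) := by
          refine intervalIntegral.integral_mono_on hxℓ ?_ ?_ fun t ht => ?_
          · exact Continuous.intervalIntegrable (by fun_prop) _ _
          · exact Continuous.intervalIntegrable (by fun_prop) _ _
          · calc _ ≤ exp (-κ * (t - x)) * (F * exp (-μ * t)) := by
                  gcongr; exact hF t (hx.trans ht.1) ht.2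
              _ ≤ exp (-(κ - μ) * (t + -x)) * (F * exp (-μ * x)) := by
                  have := ht.1
                  refine mul_le_mul (exp_le_exp.2 ?_) (mul_le_mul_of_nonneg_left (exp_le_exp.2 ?_) hF0)
                    (by positivity) (by positivity)
                  · nlinarith
                  · nlinarith
              _ = _ := by field_simp
      _ = (F * exp (-μ * x) / (κ - μ)) * (1 - exp (-(κ - μ) * (ℓ + -x))) := by
          rw [intervalIntegral.integral_const_mul, hexpint]; simp; ring
      _ ≤ (F * exp (-μ * x) / (κ - μ)) * 1 := by
          gcongr; linarith [exp_pos (-(κ - μ) * (ℓ + -x))]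
      _ = _ := by ring
  calc _ ≤ _ := add_le_add h1 h2
    _ = _ := by ring

lemma hasDerivAt_comp_abs {f f' : ℝ → ℝ} (h : ∀ x, HasDerivAt f (f' x) x) (h0 : f' 0 = 0)
    (x : ℝ) : HasDerivAt (fun x => f |x|) (SignType.sign x * f' |x|) x := by
  rcases lt_trichotomy x 0 with hx | rfl | hx
  · have := (h |x|).comp x (hasDerivAt_abs_neg hx)
    exact this.congr_deriv (by simp [sign_neg hx])
  · have h1 := h 0
    rw [h0, hasDerivAt_iff_isLittleO] at h1
    rw [hasDerivAt_iff_isLittleO]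
    have h3 := h1.comp_tendsto (k := fun x : ℝ => |x|) (l' := nhds 0)
      (by simpa using (continuous_abs (G := ℝ)).tendsto 0)
    simp only [sub_zero, smul_eq_mul, mul_zero, Function.comp_def] at h3
    simpa using Asymptotics.isLittleO_abs_right.1 h3
  · have := (h |x|).comp x (hasDerivAt_abs_pos hx)
    exact this.congr_deriv (by simp [sign_pos hx])

lemma hasDerivAt_sign_mul_comp_abs {f f' : ℝ → ℝ} (h : ∀ x, HasDerivAt f (f' x) x) (h0 : f 0 = 0)
    (x : ℝ) : HasDerivAt (fun x => SignType.sign x * f |x|) (f' |x|) x := by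
  rcases lt_trichotomy x 0 with hx | rfl | hx
  · have := ((h |x|).comp x (hasDerivAt_abs_neg hx)).neg
    refine (this.congr_of_eventuallyEq ?_).congr_deriv (by simp)
    filter_upwards [eventually_lt_nhds hx] with y hy
    simp [sign_neg hy]
  · have h1 := h 0
    rw [hasDerivAt_iff_isLittleO] at h1 ⊢
    have h3 := h1.comp_tendsto (k := fun x : ℝ => |x|) (l' := nhds 0)
      (by simpa using (continuous_abs (G := ℝ)).tendsto 0)
    simp only [sub_zero, smul_eq_mul, abs_zero, Function.comp_def, h0, mul_zero] at h3 ⊢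
    refine (Asymptotics.IsBigO.of_bound' (Eventually.of_forall fun y => ?_)).trans_isLittleO
      (Asymptotics.isLittleO_abs_right.1 h3)
    rcases lt_trichotomy y 0 with hy | rfl | hy
    · simp only [sign_neg hy, abs_of_neg hy, norm_eq_abs, SignType.coe_neg_one]
      rw [← abs_neg]
      exact le_of_eq (by ring_nf)
    · simp [h0]
    · simp [sign_pos hy, abs_of_pos hy]
  · have := (h |x|).comp x (hasDerivAt_abs_pos hx)
    refine (this.congr_of_eventuallyEq ?_).congr_deriv (by simp)
    filter_upwards [eventually_gt_nhds hx] with y hy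
    simp [sign_pos hy]

/-- Distance to the lattice `2ℓℤ`: the folding of `ℝ` onto `[0, ℓ]`. -/
noncomputable def fold (ℓ x : ℝ) : ℝ := |x - 2 * ℓ * round (x / (2 * ℓ))|

lemma fold_mem {ℓ : ℝ} (hℓ : 0 < ℓ) (x : ℝ) : fold ℓ x ∈ Icc 0 ℓ := by
  refine ⟨abs_nonneg _, ?_⟩
  have h := abs_sub_round (x / (2 * ℓ))
  have : x - 2 * ℓ * round (x / (2 * ℓ)) = 2 * ℓ * (x / (2 * ℓ) - round (x / (2 * ℓ))) := by
    field_simp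
  rw [fold, this, abs_mul, abs_of_pos (by positivity : 0 < 2 * ℓ)]
  nlinarith

lemma fold_periodic {ℓ : ℝ} (hℓ : 0 < ℓ) : Function.Periodic (fold ℓ) (2 * ℓ) := by
  intro x
  have : (x + 2 * ℓ) / (2 * ℓ) = x / (2 * ℓ) + 1 := by field_simp
  rw [fold, fold, this, round_add_one]
  push_cast
  ring_nf

lemma fold_eq_abs {ℓ x : ℝ} (hℓ : 0 < ℓ) {n : ℤ} (h : |x - 2 * ℓ * n| < ℓ) :
    fold ℓ x = |x - 2 * ℓ * n| := by
  have : round (x / (2 * ℓ)) = n := by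
    rw [round_eq_iff]
    obtain ⟨h1, h2⟩ := abs_lt.1 h
    constructor
    · rw [le_div_iff₀ (by positivity)]; nlinarith
    · rw [div_lt_iff₀ (by positivity)]; nlinarith
  rw [fold, this]

lemma fold_eq_sub_abs {ℓ x : ℝ} (hℓ : 0 < ℓ) {n : ℤ} (h : |x - (2 * ℓ * n + ℓ)| < ℓ) :
    fold ℓ x = ℓ - |x - (2 * ℓ * n + ℓ)| := by
  obtain ⟨h1, h2⟩ := abs_lt.1 h
  rcases lt_or_ge x (2 * ℓ * n + ℓ) with hx | hx
  · rw [fold_eq_abs hℓ (n := n) (by rw [abs_lt]; constructor <;> linarith), abs_of_nonneg (by linarith),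
      abs_of_neg (by linarith)]
    ring
  · have : round (x / (2 * ℓ)) = n + 1 := by
      rw [round_eq_iff]
      push_cast
      constructor
      · rw [le_div_iff₀ (by positivity)]; nlinarith
      · rw [div_lt_iff₀ (by positivity)]; nlinarith
    rw [fold, this, abs_of_nonneg (a := x - (2 * ℓ * n + ℓ)) (by linarith), abs_of_neg]
    · push_cast; ring
    · push_cast; linarith

lemma fold_of_abs_le {ℓ x : ℝ} (hℓ : 0 < ℓ) (h : |x| ≤ ℓ) : fold ℓ x = |x| := by
  rcases h.lt_or_eq with h | h
  · simpa using fold_eq_abs hℓ (n := 0) (x := x) (by simpa using h)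
  · rcases eq_or_eq_neg_of_abs_eq h with rfl | rfl
    · have := fold_eq_sub_abs hℓ (n := 0) (x := x) (by simpa using hℓ)
      simp at this
      rw [this, h]
    · have := fold_eq_sub_abs hℓ (n := -1) (x := -ℓ) (by ring_nf; simpa using hℓ)
      ring_nf at this
      rw [h]; simpa using this

/-- Near every point, folding is a reflection. -/
lemma fold_locally {ℓ : ℝ} (hℓ : 0 < ℓ) (x : ℝ) :
    (∃ c, ∀ᶠ y in nhds x, fold ℓ y = |y - c|) ∨ ∃ c, ∀ᶠ y in nhds x, fold ℓ y = ℓ - |y - c| := by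
  obtain ⟨h0, h1⟩ := fold_mem hℓ x
  have hcont : ∀ c : ℝ, Continuous fun y : ℝ => |y - c| := fun c => by fun_prop
  rcases h1.lt_or_eq with h | h
  · left
    refine ⟨2 * ℓ * round (x / (2 * ℓ)), ?_⟩
    filter_upwards [(hcont _).continuousAt.eventually_lt continuousAt_const h] with y hy
    exact fold_eq_abs hℓ hy
  · right
    have : ∃ n : ℤ, x = 2 * ℓ * n + ℓ := by
      rcases eq_or_eq_neg_of_abs_eq h with h | h
      · exact ⟨round (x / (2 * ℓ)), by linarith⟩
      · exact ⟨round (x / (2 * ℓ)) - 1, by push_cast; linarith⟩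
    obtain ⟨n, hn⟩ := this
    refine ⟨2 * ℓ * n + ℓ, ?_⟩
    filter_upwards [(hcont _).continuousAt.eventually_lt continuousAt_const
      (by rw [hn]; simpa using hℓ : |x - (2 * ℓ * n + ℓ)| < ℓ)] with y hy
    exact fold_eq_sub_abs hℓ hy

lemma continuous_fold {ℓ : ℝ} (hℓ : 0 < ℓ) : Continuous (fold ℓ) := by
  refine continuous_iff_continuousAt.2 fun x => ?_
  rcases fold_locally hℓ x with ⟨c, h⟩ | ⟨c, h⟩
  · exact (by fun_prop : ContinuousAt (fun y => |y - c|) x).congr (h.mono fun y hy => hy.symm)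
  · exact (by fun_prop : ContinuousAt (fun y => ℓ - |y - c|) x).congr (h.mono fun y hy => hy.symm)

/-- A function with Neumann data on `[0, ℓ]` folds to a `C²` function. -/
lemma comp_fold_contDiff {ℓ : ℝ} (hℓ : 0 < ℓ) {f f' f'' : ℝ → ℝ} (h : ∀ x, HasDerivAt f (f' x) x)
    (h' : ∀ x, HasDerivAt f' (f'' x) x) (hc : Continuous f'') (h0 : f' 0 = 0) (h1 : f' ℓ = 0) :
    ContDiff ℝ 2 (fun x => f (fold ℓ x)) ∧
      ∀ x, deriv (deriv fun x => f (fold ℓ x)) x = f'' (fold ℓ x) := by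
  have local_deriv : ∀ x (g g' : ℝ → ℝ) (g'' : ℝ), (∀ x, HasDerivAt g (g' x) x) →
      HasDerivAt g' g'' x → (fun x => f (fold ℓ x)) =ᶠ[nhds x] g →
      DifferentiableAt ℝ (fun x => f (fold ℓ x)) x ∧
        HasDerivAt (deriv fun x => f (fold ℓ x)) g'' x := by
    intro x g g' g'' hg hg' he
    refine ⟨((hg x).congr_of_eventuallyEq he).differentiableAt, hg'.congr_of_eventuallyEq ?_⟩
    exact he.deriv.trans (Eventually.of_forall fun y => (hg y).deriv)
  have key : ∀ x, DifferentiableAt ℝ (fun x => f (fold ℓ x)) x ∧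
      HasDerivAt (deriv fun x => f (fold ℓ x)) (f'' (fold ℓ x)) x := by
    intro x
    rcases fold_locally hℓ x with ⟨c, hloc⟩ | ⟨c, hloc⟩
    · rw [hloc.self_of_nhds]
      refine local_deriv x (fun y => f |y - c|) _ _
        (fun y => (hasDerivAt_comp_abs h h0 (y - c)).comp_sub_const y c)
        ((hasDerivAt_sign_mul_comp_abs h' h0 (x - c)).comp_sub_const x c) ?_
      filter_upwards [hloc] with y hy
      rw [hy]
    · rw [hloc.self_of_nhds]
      have hr : ∀ x, HasDerivAt (fun t => f (ℓ - t)) (-f' (ℓ - x)) x := fun x => by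
        simpa using (h (ℓ - x)).comp_const_sub ℓ x
      have hr' : ∀ x, HasDerivAt (fun t => -f' (ℓ - t)) (f'' (ℓ - x)) x := fun x => by
        simpa using! ((h' (ℓ - x)).comp_const_sub ℓ x).neg
      refine local_deriv x (fun y => f (ℓ - |y - c|)) _ _
        (fun y => (hasDerivAt_comp_abs hr (by simp [h1]) (y - c)).comp_sub_const y c)
        ((hasDerivAt_sign_mul_comp_abs hr' (by simp [h1]) (x - c)).comp_sub_const x c) ?_
      filter_upwards [hloc] with y hy
      rw [hy]
  have hdd : deriv (deriv fun x => f (fold ℓ x)) = fun x => f'' (fold ℓ x) :=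
    funext fun x => (key x).2.deriv
  refine ⟨?_, fun x => congrFun hdd x⟩
  rw [show (2 : WithTop ℕ∞) = 1 + 1 by norm_num, contDiff_succ_iff_deriv]
  refine ⟨fun x => (key x).1, by simp, ?_⟩
  rw [contDiff_one_iff_deriv]
  exact ⟨fun x => (key x).2.differentiableAt, hdd ▸ hc.comp (continuous_fold hℓ)⟩

/-- Denominator of the homoclinic profile. -/
noncomputable def den (a β y : ℝ) : ℝ := a + β * cosh y

/-- Normalised potential of the linearisation about the homoclinic profile. -/
noncomputable def pot (a β y : ℝ) : ℝ :=
  1 - 6 * a / den a β y + 6 * (a ^ 2 - β ^ 2) / den a β y ^ 2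

/-- Odd decaying element of the kernel of the linearisation. -/
noncomputable def oddSol (a β y : ℝ) : ℝ := sinh y / den a β y ^ 2

noncomputable def oddSol' (a β y : ℝ) : ℝ :=
  (cosh y * den a β y - 2 * β * sinh y ^ 2) / den a β y ^ 3

noncomputable def evenNum (a β y : ℝ) : ℝ :=
  -(a ^ 4 + 6 * a ^ 2 * β ^ 2 + β ^ 4) * cosh y - (4 * a ^ 3 * β + 4 * a * β ^ 3) +
    4 * a * β ^ 3 * sinh y ^ 2 + (6 * a ^ 2 * β ^ 2 + 3 / 2 * β ^ 4) * (y * sinh y) +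
    β ^ 4 / 2 * (sinh y ^ 2 * cosh y)

noncomputable def evenNum' (a β y : ℝ) : ℝ :=
  -(a ^ 4 + 6 * a ^ 2 * β ^ 2 + β ^ 4) * sinh y +
    8 * a * β ^ 3 * (sinh y * cosh y) +
    (6 * a ^ 2 * β ^ 2 + 3 / 2 * β ^ 4) * (sinh y + y * cosh y) +
    β ^ 4 / 2 * (2 * sinh y * cosh y ^ 2 + sinh y ^ 3)

/-- Even growing element of the kernel of the linearisation. -/
noncomputable def evenSol (a β y : ℝ) : ℝ := evenNum a β y / den a β y ^ 2

noncomputable def evenSol' (a β y : ℝ) : ℝ :=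
  (evenNum' a β y * den a β y - 2 * β * sinh y * evenNum a β y) / den a β y ^ 3

section
variable {a β : ℝ}

lemma den_pos (ha : 0 < a) (hβ : 0 < β) (y : ℝ) : 0 < den a β y := by
  have := cosh_pos y
  unfold den
  positivity

lemma hasDerivAt_den (y : ℝ) : HasDerivAt (den a β) (β * sinh y) y :=
  ((hasDerivAt_cosh y).const_mul β).const_add a

lemma hasDerivAt_oddSol (ha : 0 < a) (hβ : 0 < β) (y : ℝ) :
    HasDerivAt (oddSol a β) (oddSol' a β y) y := by
  have hD := (den_pos ha hβ y).ne'
  refine ((hasDerivAt_sinh y).div ((hasDerivAt_den y).pow 2) (pow_ne_zero 2 hD)).congr_deriv ?_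
  simp only [Pi.pow_apply, oddSol']
  field_simp
  push_cast
  ring

lemma hasDerivAt_oddSol' (ha : 0 < a) (hβ : 0 < β) (y : ℝ) :
    HasDerivAt (oddSol' a β) (pot a β y * oddSol a β y) y := by
  have hD := (den_pos ha hβ y).ne'
  refine ((((hasDerivAt_cosh y).mul (hasDerivAt_den y)).sub
    (((hasDerivAt_sinh y).pow 2).const_mul (2 * β))).div ((hasDerivAt_den y).pow 3)
      (pow_ne_zero 3 hD)).congr_deriv ?_
  simp only [Pi.pow_apply, pot, oddSol]
  have h := cosh_sq y
  field_simp
  simp only [den, Pi.mul_apply, Pi.sub_apply]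
  push_cast
  generalize cosh y = c at *
  generalize sinh y = s at *
  grind

lemma hasDerivAt_evenNum (y : ℝ) : HasDerivAt (evenNum a β) (evenNum' a β y) y := by
  refine (((((hasDerivAt_cosh y).const_mul (-(a ^ 4 + 6 * a ^ 2 * β ^ 2 + β ^ 4))).sub_const
    (4 * a ^ 3 * β + 4 * a * β ^ 3)).add (((hasDerivAt_sinh y).pow 2).const_mul (4 * a * β ^ 3))
    |>.add (((hasDerivAt_id y).mul (hasDerivAt_sinh y)).const_mul
      (6 * a ^ 2 * β ^ 2 + 3 / 2 * β ^ 4))) |>.add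
      ((((hasDerivAt_sinh y).pow 2).mul (hasDerivAt_cosh y)).const_mul (β ^ 4 / 2))).congr_deriv ?_
  simp only [evenNum', Pi.pow_apply, id]
  push_cast
  ring

lemma hasDerivAt_evenSol (ha : 0 < a) (hβ : 0 < β) (y : ℝ) :
    HasDerivAt (evenSol a β) (evenSol' a β y) y := by
  have hD := (den_pos ha hβ y).ne'
  refine ((hasDerivAt_evenNum y).div ((hasDerivAt_den y).pow 2) (pow_ne_zero 2 hD)).congr_deriv ?_
  simp only [Pi.pow_apply, evenSol']
  field_simp
  push_cast
  ring

lemma hasDerivAt_evenNum' (y : ℝ) : HasDerivAt (evenNum' a β)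
    (-(a ^ 4 + 6 * a ^ 2 * β ^ 2 + β ^ 4) * cosh y +
    8 * a * β ^ 3 * (cosh y ^ 2 + sinh y ^ 2) +
    (6 * a ^ 2 * β ^ 2 + 3 / 2 * β ^ 4) * (2 * cosh y + y * sinh y) +
    β ^ 4 / 2 * (2 * cosh y ^ 3 + 7 * sinh y ^ 2 * cosh y)) y := by
  refine (((((hasDerivAt_sinh y).const_mul (-(a ^ 4 + 6 * a ^ 2 * β ^ 2 + β ^ 4))).add
    (((hasDerivAt_sinh y).mul (hasDerivAt_cosh y)).const_mul (8 * a * β ^ 3)))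
    |>.add (((hasDerivAt_sinh y).add ((hasDerivAt_id y).mul (hasDerivAt_cosh y))).const_mul
      (6 * a ^ 2 * β ^ 2 + 3 / 2 * β ^ 4))) |>.add
      (((((hasDerivAt_sinh y).const_mul 2).mul ((hasDerivAt_cosh y).pow 2)).add
        ((hasDerivAt_sinh y).pow 3)).const_mul (β ^ 4 / 2))).congr_deriv ?_
  simp only [Pi.pow_apply, id]
  push_cast
  ring

lemma hasDerivAt_evenSol' (ha : 0 < a) (hβ : 0 < β) (y : ℝ) :
    HasDerivAt (evenSol' a β) (pot a β y * evenSol a β y) y := by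
  have hD := (den_pos ha hβ y).ne'
  refine ((((hasDerivAt_evenNum' y).mul (hasDerivAt_den y)).sub
    (((hasDerivAt_sinh y).const_mul (2 * β)).mul (hasDerivAt_evenNum y))).div
      ((hasDerivAt_den y).pow 3) (pow_ne_zero 3 hD)).congr_deriv ?_
  simp only [Pi.pow_apply, pot, evenSol]
  have h := cosh_sq y
  field_simp
  simp only [den, evenNum, evenNum', Pi.mul_apply, Pi.sub_apply]
  push_cast
  generalize cosh y = c at *
  generalize sinh y = s at *
  grind

lemma wronskian (ha : 0 < a) (hβ : 0 < β) (y : ℝ) :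
    evenSol' a β y * oddSol a β y - evenSol a β y * oddSol' a β y = 1 := by
  have hD := (den_pos ha hβ y).ne'
  simp only [evenSol', oddSol, evenSol, oddSol']
  have h := cosh_sq y
  field_simp
  simp only [den, evenNum, evenNum']
  generalize cosh y = c at *
  generalize sinh y = s at *
  grind

lemma evenSol'_zero : evenSol' a β 0 = 0 := by simp [evenSol', evenNum']

end

lemma cosh_le_exp {y : ℝ} (hy : 0 ≤ y) : cosh y ≤ exp y := by
  rw [cosh_eq]
  have : exp (-y) ≤ exp y := exp_le_exp.2 (by linarith)
  linarith

lemma inv_cosh_le_exp (y : ℝ) : (cosh y)⁻¹ ≤ 2 * exp (-y) := by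
  rw [inv_le_comm₀ (cosh_pos y) (by positivity), cosh_eq, exp_neg, mul_inv, inv_inv]
  have := inv_pos.2 (exp_pos y)
  linarith

lemma div_cosh_le_exp {K : ℝ} (hK : 0 ≤ K) (y : ℝ) : K / cosh y ≤ 2 * K * exp (-y) := by
  rw [div_eq_mul_inv]
  nlinarith [inv_cosh_le_exp y]

lemma mul_cosh_le_den {a β : ℝ} (ha : 0 < a) (y : ℝ) : β * cosh y ≤ den a β y := by
  unfold den; linarith

lemma den_le_mul_cosh {a β : ℝ} (ha : 0 < a) (y : ℝ) : den a β y ≤ (a + β) * cosh y := by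
  have := one_le_cosh y
  unfold den; nlinarith

lemma abs_oddSol_le {a β : ℝ} (ha : 0 < a) (hβ : 0 < β) {y : ℝ} (hy : 0 ≤ y) :
    |oddSol a β y| ≤ 2 * (1 / β ^ 2) * exp (-y) := by
  have hs := sinh_nonneg_iff.2 hy
  have hc := cosh_pos y
  refine le_trans ?_ (div_cosh_le_exp (by positivity) y)
  rw [oddSol, abs_div, abs_of_nonneg hs, abs_of_nonneg (sq_nonneg _)]
  calc sinh y / den a β y ^ 2 ≤ cosh y / (β * cosh y) ^ 2 := by
        have := mul_cosh_le_den (β := β) ha y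
        have := (sinh_lt_cosh y).le
        gcongr
    _ = _ := by field_simp

lemma abs_oddSol'_le {a β : ℝ} (ha : 0 < a) (hβ : 0 < β) {y : ℝ} (hy : 0 ≤ y) :
    |oddSol' a β y| ≤ 2 * ((a + 3 * β) / β ^ 3) * exp (-y) := by
  have hs := sinh_nonneg_iff.2 hy
  have hc := cosh_pos y
  have hD := den_pos ha hβ y
  refine le_trans ?_ (div_cosh_le_exp (by positivity) y)
  have hsc := (sinh_lt_cosh y).le
  rw [oddSol', abs_div, abs_of_pos (pow_pos hD 3)]
  calc _ ≤ (a + 3 * β) * cosh y ^ 2 / (β * cosh y) ^ 3 := by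
        have h1 := mul_cosh_le_den (β := β) ha y
        have h2 := den_le_mul_cosh (β := β) ha y
        have h3 : sinh y ^ 2 ≤ cosh y ^ 2 := by gcongr
        gcongr
        rw [abs_le]
        constructor <;> nlinarith [mul_le_mul_of_nonneg_left h2 hc.le, mul_pos hc hD, sq_nonneg (sinh y),
          mul_le_mul_of_nonneg_left h3 hβ.le, mul_pos ha (pow_pos hc 2), mul_pos hβ (pow_pos hc 2),
          mul_nonneg hβ.le (sq_nonneg (sinh y))]
    _ = _ := by field_simp

lemma abs_evenSol_le {a β : ℝ} (ha : 0 < a) (hβ : 0 < β) :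
    ∃ K > 0, ∀ y, 0 ≤ y → |evenSol a β y| ≤ K * exp y := by
  obtain ⟨K, hK⟩ : ∃ K, K = (a ^ 4 + 6 * a ^ 2 * β ^ 2 + β ^ 4) + (4 * a ^ 3 * β + 4 * a * β ^ 3) + 4 * a * β ^ 3 +
    (6 * a ^ 2 * β ^ 2 + 3 / 2 * β ^ 4) + β ^ 4 / 2 := ⟨_, rfl⟩
  have hK0 : 0 < K := by rw [hK]; positivity
  refine ⟨K / β ^ 2, by positivity, fun y hy => ?_⟩
  have hs := sinh_nonneg_iff.2 hy
  have hc := cosh_pos y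
  have hc1 := one_le_cosh y
  have hD := den_pos ha hβ y
  have hsc := (sinh_lt_cosh y).le
  have hys := self_le_sinh_iff.2 hy
  have hN : |evenNum a β y| ≤ K * cosh y ^ 3 := by
    have e1 : cosh y ≤ cosh y ^ 3 := le_self_pow₀ hc1 (by norm_num)
    have e2 : 1 ≤ cosh y ^ 3 := one_le_pow₀ hc1
    have e3 : cosh y ^ 2 ≤ cosh y ^ 3 := pow_le_pow_right₀ hc1 (by norm_num)
    have e4 : sinh y ^ 2 ≤ cosh y ^ 2 := by gcongr
    have e5 : y * sinh y ≤ cosh y ^ 2 := by nlinarith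
    have e6 : sinh y ^ 2 * cosh y ≤ cosh y ^ 3 := by nlinarith
    rw [evenNum]
    have h1 : |-(a ^ 4 + 6 * a ^ 2 * β ^ 2 + β ^ 4) * cosh y| ≤
        (a ^ 4 + 6 * a ^ 2 * β ^ 2 + β ^ 4) * cosh y ^ 3 := by
      rw [neg_mul, abs_neg, abs_of_pos (by positivity)]; gcongr
    have h2 : |4 * a ^ 3 * β + 4 * a * β ^ 3| ≤ (4 * a ^ 3 * β + 4 * a * β ^ 3) * cosh y ^ 3 := by
      rw [abs_of_pos (by positivity)]; exact le_mul_of_one_le_right (by positivity) e2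
    have h3 : |4 * a * β ^ 3 * sinh y ^ 2| ≤ 4 * a * β ^ 3 * cosh y ^ 3 := by
      rw [abs_of_nonneg (by positivity)]; gcongr; exact e4.trans e3
    have h4 : |(6 * a ^ 2 * β ^ 2 + 3 / 2 * β ^ 4) * (y * sinh y)| ≤
        (6 * a ^ 2 * β ^ 2 + 3 / 2 * β ^ 4) * cosh y ^ 3 := by
      rw [abs_of_nonneg (by positivity)]; gcongr; exact e5.trans e3
    have h5 : |β ^ 4 / 2 * (sinh y ^ 2 * cosh y)| ≤ β ^ 4 / 2 * cosh y ^ 3 := by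
      rw [abs_of_nonneg (by positivity)]; gcongr
    refine (abs_add_le _ _).trans ?_
    refine (add_le_add_left (abs_add_le _ _) _).trans ?_
    refine (add_le_add_left (add_le_add_left (abs_add_le _ _) _) _).trans ?_
    refine (add_le_add_left (add_le_add_left (add_le_add_left (abs_sub _ _) _) _) _).trans ?_
    rw [hK]
    linarith
  rw [evenSol, abs_div, abs_of_pos (pow_pos hD 2)]
  calc _ ≤ (K * cosh y ^ 3) / (β * cosh y) ^ 2 := by
        have h1 := mul_cosh_le_den (β := β) ha y
        gcongr
    _ = K / β ^ 2 * cosh y := by field_simp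
    _ ≤ _ := by
        gcongr
        exact cosh_le_exp hy

lemma le_evenSol' {a β : ℝ} (ha : 0 < a) (hβ : 0 < β) :
    ∃ c > 0, ∃ Y, ∀ y, Y ≤ y → c * exp y ≤ evenSol' a β y := by
  obtain ⟨k, hk⟩ : ∃ k, k = β ^ 4 / 2 * β := ⟨_, rfl⟩
  obtain ⟨α, hα⟩ : ∃ α, α = a ^ 4 + 6 * a ^ 2 * β ^ 2 + β ^ 4 := ⟨_, rfl⟩
  obtain ⟨γ, hγ⟩ : ∃ γ, γ = 4 * a ^ 3 * β + 4 * a * β ^ 3 := ⟨_, rfl⟩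
  obtain ⟨δ, hδ⟩ : ∃ δ, δ = 4 * a * β ^ 3 := ⟨_, rfl⟩
  obtain ⟨θ, hθ⟩ : ∃ θ, θ = 6 * a ^ 2 * β ^ 2 + 3 / 2 * β ^ 4 := ⟨_, rfl⟩
  obtain ⟨lam, hlam⟩ : ∃ lam, lam = β ^ 4 / 2 := ⟨_, rfl⟩
  obtain ⟨K, hK⟩ : ∃ K, K = α * (a + β) + 2 * β * δ + 2 * β * θ := ⟨_, rfl⟩
  have hk0 : 0 < k := by rw [hk]; positivity
  have hα0 : 0 < α := by rw [hα]; positivity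
  have hγ0 : 0 < γ := by rw [hγ]; positivity
  have hδ0 : 0 < δ := by rw [hδ]; positivity
  have hθ0 : 0 < θ := by rw [hθ]; positivity
  have hlam0 : 0 < lam := by rw [hlam]; positivity
  have hK0 : 0 < K := by rw [hK]; positivity
  refine ⟨k / (8 * (a + β) ^ 3), by positivity, max 1 (16 * K / k), fun y hY => ?_⟩
  have hy1 : 1 ≤ y := (le_max_left _ _).trans hY
  have hyK : 16 * K ≤ y * k := (div_le_iff₀ hk0).1 ((le_max_right _ _).trans hY)
  have hy : 0 ≤ y := by linarith
  have hs := sinh_nonneg_iff.2 hy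
  have hc := cosh_pos y
  have hc1 := one_le_cosh y
  have hD := den_pos ha hβ y
  have hsc := (sinh_lt_cosh y).le
  have hexp1 : exp (-y) ≤ 1 := exp_le_one_iff.2 (by linarith)
  have hexp2 := quadratic_le_exp_of_nonneg hy
  have hs1 : y ^ 2 / 4 ≤ sinh y := by rw [sinh_eq]; nlinarith
  have hs2 : exp y / 4 ≤ sinh y := by rw [sinh_eq]; nlinarith
  have hks : K * (1 + y) ≤ k / 2 * sinh y := by nlinarith
  have hnum : cosh y ^ 3 * (k * sinh y - K * (1 + y)) ≤
      evenNum' a β y * den a β y - 2 * β * sinh y * evenNum a β y := by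
    have hcs := cosh_sq y
    have e : evenNum' a β y * den a β y - 2 * β * sinh y * evenNum a β y =
        k * (sinh y * cosh y ^ 3) - α * (sinh y * (a + β * cosh y)) - 2 * β * δ * sinh y ^ 3
        - 2 * β * θ * (y * sinh y ^ 2) + (k * (sinh y * cosh y) +
        (2 * δ * (sinh y * cosh y) + θ * (sinh y + y * cosh y)) * den a β y +
        lam * (2 * sinh y * cosh y ^ 2 + sinh y ^ 3) * a + 2 * β * sinh y * (α * cosh y + γ)) := by
      rw [evenNum', evenNum, den, ← hα, ← hγ, ← hθ, hk, hδ, hlam]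
      linear_combination (β ^ 4 / 2 * β * sinh y * cosh y) * hcs
    have e1 : sinh y * (a + β * cosh y) ≤ (a + β) * cosh y ^ 3 := by
      have h1 := den_le_mul_cosh (β := β) ha y
      have h3 : cosh y ^ 2 ≤ cosh y ^ 3 := pow_le_pow_right₀ hc1 (by norm_num)
      calc _ ≤ cosh y * ((a + β) * cosh y) := mul_le_mul hsc h1 hD.le hc.le
        _ = (a + β) * cosh y ^ 2 := by ring
        _ ≤ _ := by gcongr
    have e2 : sinh y ^ 3 ≤ cosh y ^ 3 := by gcongr
    have e3 : y * sinh y ^ 2 ≤ y * cosh y ^ 3 := by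
      have h3 : cosh y ^ 2 ≤ cosh y ^ 3 := pow_le_pow_right₀ hc1 (by norm_num)
      have h4 : sinh y ^ 2 ≤ cosh y ^ 2 := by gcongr
      gcongr; exact h4.trans h3
    have e4 : 0 ≤ k * (sinh y * cosh y) +
        (2 * δ * (sinh y * cosh y) + θ * (sinh y + y * cosh y)) * den a β y +
        lam * (2 * sinh y * cosh y ^ 2 + sinh y ^ 3) * a + 2 * β * sinh y * (α * cosh y + γ) := by
      positivity
    have f1 := mul_le_mul_of_nonneg_left e1 hα0.le
    have f2 := mul_le_mul_of_nonneg_left e2 (by positivity : 0 ≤ 2 * β * δ)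
    have f3 := mul_le_mul_of_nonneg_left e3 (by positivity : 0 ≤ 2 * β * θ)
    have f4 : cosh y ^ 3 * (k * sinh y - K * (1 + y)) = k * (sinh y * cosh y ^ 3) -
        α * ((a + β) * cosh y ^ 3) - 2 * β * δ * cosh y ^ 3 - 2 * β * θ * (y * cosh y ^ 3)
        - (2 * β * θ * cosh y ^ 3 + (α * (a + β) + 2 * β * δ) * (y * cosh y ^ 3)) := by
      rw [hK]; ring
    have f5 : 0 ≤ 2 * β * θ * cosh y ^ 3 + (α * (a + β) + 2 * β * δ) * (y * cosh y ^ 3) := by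
      positivity
    rw [e, f4]
    linarith
  rw [evenSol', le_div_iff₀ (by positivity)]
  refine le_trans ?_ hnum
  calc k / (8 * (a + β) ^ 3) * exp y * den a β y ^ 3
      ≤ k / (8 * (a + β) ^ 3) * exp y * ((a + β) * cosh y) ^ 3 := by
        gcongr; exact den_le_mul_cosh ha y
    _ = cosh y ^ 3 * (k / 2 * (exp y / 4)) := by field_simp; norm_num
    _ ≤ _ := by gcongr; nlinarith

lemma abs_pot_sub_one_le {a β : ℝ} (ha : 0 < a) (hβ : 0 < β) (hβa : β < a) (y : ℝ) :
    |pot a β y - 1| ≤ 2 * (12 * a / β) * exp (-y) := by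
  have hD := den_pos ha hβ y
  have hc := cosh_pos y
  refine le_trans ?_ (div_cosh_le_exp (by positivity) y)
  have h1 : 6 * (a ^ 2 - β ^ 2) / den a β y ^ 2 ≤ 6 * a / den a β y := by
    rw [div_le_div_iff₀ (by positivity) hD]
    have : a ≤ den a β y := by unfold den; nlinarith
    nlinarith [mul_le_mul_of_nonneg_left this ha.le, sq_nonneg β, sq_nonneg (den a β y)]
  have h2 : 0 ≤ 6 * (a ^ 2 - β ^ 2) / den a β y ^ 2 := by
    have : 0 ≤ a ^ 2 - β ^ 2 := by nlinarith
    positivity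
  have h3 : 6 * a / den a β y ≤ 6 * a / (β * cosh y) := by
    gcongr; exact mul_cosh_le_den ha y
  have h4 : 12 * a / β / cosh y = 2 * (6 * a / (β * cosh y)) := by field_simp; norm_num
  rw [pot, h4, abs_le]
  constructor <;> linarith

/-- Neumann solution operator of the linearisation about the homoclinic profile. -/
lemma exists_layer_green {a β κ : ℝ} (ha : 0 < a) (hβ : 0 < β) (hκ : 0 < κ) :
    ∃ M > 0, ∃ ℓ₀ : ℝ, ∀ (ℓ : ℝ) (hℓ : 0 < ℓ), ℓ₀ ≤ ℓ →
    ∃ G : C(Icc 0 ℓ, ℝ) →ₗ[ℝ] C(Icc 0 ℓ, ℝ),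
      (∀ f, ∃ g g' : ℝ → ℝ, (∀ x : Icc 0 ℓ, G f x = g x) ∧ (∀ x, HasDerivAt g (g' x) x) ∧
        (∀ x, HasDerivAt g' (κ ^ 2 * pot a β (κ * x) * g x + f.IccExtend hℓ.le x) x) ∧
        g' 0 = 0 ∧ g' ℓ = 0) ∧
      ∀ (f : C(Icc 0 ℓ, ℝ)) (x : Icc 0 ℓ), |G f x| ≤
        M * ((∫ t in (0 : ℝ)..x, exp (-κ * (x - t)) * |f.IccExtend hℓ.le t|) +
          ∫ t in (x : ℝ)..ℓ, exp (-κ * (t - x)) * |f.IccExtend hℓ.le t|) := by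
  obtain ⟨K₁, hK₁, hZ⟩ := abs_evenSol_le ha hβ
  obtain ⟨c, hc, Y, hZ'⟩ := le_evenSol' ha hβ
  have hP := fun y hy => abs_oddSol_le ha hβ (y := y) hy
  have hP' := fun y hy => abs_oddSol'_le ha hβ (y := y) hy
  set K₂ := 2 * (1 / β ^ 2)
  set K₃ := 2 * ((a + 3 * β) / β ^ 3)
  have hK₂ : 0 < K₂ := by positivity
  have hK₃ : 0 < K₃ := by positivity
  have hM : 0 < K₁ * (K₂ + K₃ / c * K₁) / κ := by positivity
  refine ⟨K₁ * (K₂ + K₃ / c * K₁) / κ, hM, Y / κ, fun ℓ hℓ hℓ₀ => ?_⟩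
  have hYℓ : Y ≤ κ * ℓ := by rw [div_le_iff₀ hκ] at hℓ₀; linarith
  have hZℓ : 0 < evenSol' a β (κ * ℓ) := lt_of_lt_of_le (by positivity) (hZ' _ hYℓ)
  set γ := -oddSol' a β (κ * ℓ) / evenSol' a β (κ * ℓ) with hγ
  have hγ_le : |γ| ≤ K₃ / c * exp (-(2 * κ * ℓ)) := by
    rw [hγ, abs_div, abs_neg, abs_of_pos hZℓ]
    calc _ ≤ K₃ * exp (-(κ * ℓ)) / (c * exp (κ * ℓ)) := by
          have := hP' _ (mul_pos hκ hℓ).le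
          have := hZ' _ hYℓ
          gcongr
      _ = K₃ / c * (exp (-(κ * ℓ)) * exp (-(κ * ℓ))) := by rw [exp_neg]; field_simp
      _ = _ := by rw [← exp_add]; ring_nf
  have hlin : ∀ x : ℝ, HasDerivAt (fun x => κ * x) κ x := fun x => by
    simpa using (hasDerivAt_id x).const_mul κ
  have hd : ∀ {f f' : ℝ → ℝ} (_ : ∀ y, HasDerivAt f (f' y) y) (x : ℝ),
      HasDerivAt (fun x => f (κ * x)) (κ * f' (κ * x)) x := fun {f f'} h x => by
    have := (h (κ * x)).comp x (hlin x)
    exact this.congr_deriv (mul_comm _ _)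
  refine exists_green (ω := κ) hℓ (y₁ := fun x => evenSol a β (κ * x))
    (y₁' := fun x => κ * evenSol' a β (κ * x))
    (y₂ := fun x => oddSol a β (κ * x) + γ * evenSol a β (κ * x))
    (y₂' := fun x => κ * oddSol' a β (κ * x) + γ * (κ * evenSol' a β (κ * x)))
    (fun x => hd (hasDerivAt_evenSol ha hβ) x)
    (fun x => ((hd (hasDerivAt_evenSol' ha hβ) x).const_mul κ).congr_deriv (by ring))
    (fun x => (hd (hasDerivAt_oddSol ha hβ) x).add ((hd (hasDerivAt_evenSol ha hβ) x).const_mul γ))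
    (fun x => (((hd (hasDerivAt_oddSol' ha hβ) x).const_mul κ).add
      (((hd (hasDerivAt_evenSol' ha hβ) x).const_mul κ).const_mul γ)).congr_deriv (by ring))
    hκ.ne' (fun x => ?_) (by simp [evenSol'_zero]) (by rw [hγ]; field_simp; ring)
    (fun t x ht htx hxℓ => ?_)
  · linear_combination κ * wronskian ha hβ (κ * x)
  · have hx : 0 ≤ x := ht.trans htx
    have h1 := hZ _ (mul_nonneg hκ.le ht)
    have h2 := hZ _ (mul_nonneg hκ.le hx)
    have h3 := hP _ (mul_nonneg hκ.le hx)
    rw [abs_mul, abs_of_pos hκ]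
    have h4 : |oddSol a β (κ * x) + γ * evenSol a β (κ * x)| ≤
        (K₂ + K₃ / c * K₁) * exp (-(κ * x)) := by
      calc _ ≤ |oddSol a β (κ * x)| + |γ| * |evenSol a β (κ * x)| := by
            rw [← abs_mul]; exact abs_add_le _ _
        _ ≤ K₂ * exp (-(κ * x)) + K₃ / c * exp (-(2 * κ * ℓ)) * (K₁ * exp (κ * x)) := by gcongr
        _ = K₂ * exp (-(κ * x)) + K₃ / c * K₁ * exp (-(2 * κ * ℓ) + κ * x) := by
            rw [exp_add]; ring
        _ ≤ K₂ * exp (-(κ * x)) + K₃ / c * K₁ * exp (-(κ * x)) := by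
            gcongr; nlinarith
        _ = _ := by ring
    calc _ ≤ (K₁ * exp (κ * t)) * ((K₂ + K₃ / c * K₁) * exp (-(κ * x))) := by gcongr
      _ = K₁ * (K₂ + K₃ / c * K₁) * (exp (κ * t) * exp (-(κ * x))) := by ring
      _ = K₁ * (K₂ + K₃ / c * K₁) * exp (-κ * (x - t)) := by rw [← exp_add]; ring_nf
      _ = _ := by field_simp

/-- Neumann solution operator of `g″ = (ε k)² g + f` on an interval of length `L / ε`. -/
lemma exists_slow_green {L k : ℝ} (hL : 0 < L) (hk : 0 < k) :
    ∃ M > 0, ∀ (ε ℓ : ℝ) (_ : 0 < ε) (hℓ : 0 < ℓ), ε * ℓ = L →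
    ∃ G : C(Icc 0 ℓ, ℝ) →ₗ[ℝ] C(Icc 0 ℓ, ℝ),
      (∀ f, ∃ g g' : ℝ → ℝ, (∀ x : Icc 0 ℓ, G f x = g x) ∧ (∀ x, HasDerivAt g (g' x) x) ∧
        (∀ x, HasDerivAt g' ((ε * k) ^ 2 * g x + f.IccExtend hℓ.le x) x) ∧
        g' 0 = 0 ∧ g' ℓ = 0) ∧
      ∀ (f : C(Icc 0 ℓ, ℝ)) (x : Icc 0 ℓ), |G f x| ≤
        M / ε * ∫ t in (0 : ℝ)..ℓ, |f.IccExtend hℓ.le t| := by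
  have hsinh : 0 < sinh (k * L) := sinh_pos_iff.2 (by positivity)
  refine ⟨cosh (k * L) ^ 2 / (k * sinh (k * L)), by have := cosh_pos (k * L); positivity,
    fun ε ℓ hε hℓ hεℓ => ?_⟩
  have hkl : ε * k * ℓ = k * L := by rw [← hεℓ]; ring
  have hr : ∀ {f f' : ℝ → ℝ} (_ : ∀ y, HasDerivAt f (f' y) y) (x : ℝ),
      HasDerivAt (fun x => f (ℓ - x)) (-f' (ℓ - x)) x := fun {f f'} h x =>
    (h (ℓ - x)).comp_const_sub ℓ x
  have hsum : ∀ x, sinh (ε * k * x) * cosh (ε * k * (ℓ - x)) +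
      cosh (ε * k * x) * sinh (ε * k * (ℓ - x)) = sinh (k * L) := fun x => by
    rw [← sinh_add, ← hkl]; ring_nf
  have hmono : ∀ x, 0 ≤ x → x ≤ ℓ → cosh (ε * k * x) ≤ cosh (k * L) := fun x hx hxℓ => by
    rw [cosh_le_cosh, ← hkl, abs_of_nonneg (by positivity), abs_of_nonneg (by positivity)]
    gcongr
  obtain ⟨G, hG, hGb⟩ := exists_green (M := cosh (k * L) ^ 2 / (k * sinh (k * L)) / ε) (κ := 0)
    (ω := ε * k * sinh (k * L)) hℓ
    (y₁ := fun x => cosh (ε * k * x)) (y₁' := fun x => ε * k * sinh (ε * k * x))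
    (y₂ := fun x => cosh (ε * k * (ℓ - x))) (y₂' := fun x => -(ε * k * sinh (ε * k * (ℓ - x))))
    (q := fun _ => (ε * k) ^ 2)
    (hasDerivAt_cosh_mul _)
    (fun x => ((hasDerivAt_sinh_mul _ x).const_mul _).congr_deriv (by ring))
    (hr (hasDerivAt_cosh_mul _))
    (fun x => ((hr (hasDerivAt_sinh_mul (ε * k)) x).const_mul (ε * k)).neg.congr_deriv (by ring))
    (by positivity) (fun x => by linear_combination (ε * k) * hsum x) (by simp) (by simp)
    (fun t x ht htx hxℓ => by
      rw [abs_of_pos (mul_pos (cosh_pos _) (cosh_pos _)), abs_of_pos (by positivity)]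
      calc _ ≤ cosh (k * L) * cosh (k * L) := by
            gcongr
            · exact hmono t ht (htx.trans hxℓ)
            · exact hmono (ℓ - x) (by linarith) (by linarith)
        _ = _ := by simp; field_simp)
  refine ⟨G, hG, fun f x => (hGb f x).trans_eq ?_⟩
  have hc : Continuous fun t => |f.IccExtend hℓ.le t| := (f.IccExtend hℓ.le).continuous.abs
  simp only [neg_zero, zero_mul, exp_zero, one_mul]
  rw [intervalIntegral.integral_add_adjacent_intervals (hc.intervalIntegrable _ _)
    (hc.intervalIntegrable _ _)]

/-- Solution of the linearised equation that corrects the Neumann condition at the right end. -/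
lemma exists_layer_correction {a β κ : ℝ} (ha : 0 < a) (hβ : 0 < β) (hκ : 0 < κ) :
    ∃ M > 0, ∃ ℓ₀ : ℝ, ∀ ℓ : ℝ, 0 < ℓ → ℓ₀ ≤ ℓ → ∀ p : ℝ, ∃ r r' : ℝ → ℝ,
      (∀ x, HasDerivAt r (r' x) x) ∧ (∀ x, HasDerivAt r' (κ ^ 2 * pot a β (κ * x) * r x) x) ∧
      r' 0 = 0 ∧ r' ℓ = p ∧ ∀ x, 0 ≤ x → x ≤ ℓ → |r x| ≤ M * |p| := by
  obtain ⟨K₁, hK₁, hZ⟩ := abs_evenSol_le ha hβ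
  obtain ⟨c, hc, Y, hZ'⟩ := le_evenSol' ha hβ
  refine ⟨K₁ / (κ * c), by positivity, Y / κ, fun ℓ hℓ hℓ₀ p => ?_⟩
  have hYℓ : Y ≤ κ * ℓ := by rw [div_le_iff₀ hκ] at hℓ₀; linarith
  have hZℓ := hZ' _ hYℓ
  have hZpos : 0 < evenSol' a β (κ * ℓ) := lt_of_lt_of_le (by positivity) hZℓ
  have hd : ∀ {f f' : ℝ → ℝ} (_ : ∀ y, HasDerivAt f (f' y) y) (x : ℝ),
      HasDerivAt (fun x => f (κ * x)) (κ * f' (κ * x)) x := fun {f f'} h x =>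
    ((h (κ * x)).comp x ((hasDerivAt_id x).const_mul κ)).congr_deriv (by ring)
  refine ⟨fun x => p / (κ * evenSol' a β (κ * ℓ)) * evenSol a β (κ * x),
    fun x => p / (κ * evenSol' a β (κ * ℓ)) * (κ * evenSol' a β (κ * x)),
    fun x => (hd (hasDerivAt_evenSol ha hβ) x).const_mul _,
    fun x => (((hd (hasDerivAt_evenSol' ha hβ) x).const_mul κ).const_mul _).congr_deriv (by ring),
    by simp [evenSol'_zero], by field_simp, fun x hx hxℓ => ?_⟩
  rw [abs_mul, abs_div, abs_of_pos (mul_pos hκ hZpos)]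
  have hxe : exp (κ * x) ≤ exp (κ * ℓ) := by gcongr
  calc |p| / (κ * evenSol' a β (κ * ℓ)) * |evenSol a β (κ * x)|
      ≤ |p| / (κ * (c * exp (κ * ℓ))) * (K₁ * exp (κ * ℓ)) := by
        gcongr
        exact (hZ _ (by positivity)).trans (by gcongr)
    _ = _ := by field_simp

/-- A fixed point theorem for maps that are small at the origin and nearly quadratic. -/
lemma exists_small_fixedPoint {C : ℝ} (hC : 0 < C) :
    ∃ ε₀ > 0, ∀ ε, 0 < ε → ε < ε₀ → ∀ {Z : Type} [NormedAddCommGroup Z] [CompleteSpace Z]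
      (N : Z → Z), ‖N 0‖ ≤ C * ε →
      (∀ z₁ z₂, ‖z₁‖ ≤ 1 → ‖z₂‖ ≤ 1 →
        ‖N z₁ - N z₂‖ ≤ C * (ε + ‖z₁‖ + ‖z₂‖) * ‖z₁ - z₂‖) →
      ∃ z, N z = z ∧ ‖z‖ ≤ 2 * C * ε := by
  refine ⟨min (1 / (2 * C)) (1 / (2 * C * (1 + 4 * C))), by positivity,
    fun ε hε hε₀ Z _ _ N h0 hN => ?_⟩
  have h1 : 2 * C * ε ≤ 1 := by
    have := (lt_min_iff.1 hε₀).1.le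
    rw [le_div_iff₀ (by positivity)] at this; linarith
  have h2 : C * (ε + 2 * C * ε + 2 * C * ε) ≤ 1 / 2 := by
    have := (lt_min_iff.1 hε₀).2.le
    rw [le_div_iff₀ (by positivity)] at this; linarith
  set S := Metric.closedBall (0 : Z) (2 * C * ε)
  have hS : ∀ {z}, z ∈ S ↔ ‖z‖ ≤ 2 * C * ε := mem_closedBall_zero_iff
  have hlip : ∀ z₁ ∈ S, ∀ z₂ ∈ S, ‖N z₁ - N z₂‖ ≤ 1 / 2 * ‖z₁ - z₂‖ := fun z₁ hz₁ z₂ hz₂ => by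
    rw [hS] at hz₁ hz₂
    refine (hN z₁ z₂ (hz₁.trans h1) (hz₂.trans h1)).trans ?_
    gcongr
    refine le_trans ?_ h2
    gcongr
  have h0S : (0 : Z) ∈ S := hS.2 (by simpa using by positivity)
  have hmaps : MapsTo N S S := fun z hz => by
    rw [hS]
    have h3 := hlip z hz 0 h0S
    rw [sub_zero] at h3
    have h4 := norm_add_le (N z - N 0) (N 0)
    rw [sub_add_cancel] at h4
    have := hS.1 hz
    linarith
  have hcontr : ContractingWith (1 / 2) (hmaps.restrict N S S) := by
    refine ⟨by rw [← NNReal.coe_lt_coe]; norm_num, LipschitzWith.of_dist_le_mul fun x y => ?_⟩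
    have := hlip x x.2 y y.2
    rw [Subtype.dist_eq, Subtype.dist_eq, dist_eq_norm, dist_eq_norm]
    simpa using this
  obtain ⟨z, hzS, hz, -⟩ := hcontr.exists_fixedPoint' Metric.isClosed_closedBall.isComplete
    hmaps h0S (edist_ne_top _ _)
  exact ⟨z, hz, hS.1 hzS⟩

section
variable {X : Type} [NormedCommRing X] [NormedAlgebra ℝ X]

lemma norm_forcing_sub_le {c ε b B s δ : ℝ} {v₁ v₂ φ₁ φ₂ w₁ w₂ p₁ p₂ e d U : X} (hc : 1 ≤ c)
    (hε : 0 < ε) (hε1 : ε ≤ 1) (hb : |b| ≤ c) (hB : |B| ≤ c) (hU : ‖U‖ ≤ c)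
    (hv : ‖v₁ - v₂‖ ≤ c * δ) (hφ : ‖φ₁ - φ₂‖ ≤ c * δ) (hw : ‖w₁ - w₂‖ ≤ c * δ)
    (hp : p₁ - p₂ = φ₁ - φ₂) (hp₁ : ‖p₁‖ ≤ c * s) (hp₂ : ‖p₂‖ ≤ c * s) (hεs : ε ≤ s) (hs : s ≤ 3) :
    ‖((b * ε ^ 2) • (v₁ - e - φ₁) + ε • (B • w₁ + d) + U * p₁ ^ 2 + p₁ ^ 3) -
      ((b * ε ^ 2) • (v₂ - e - φ₂) + ε • (B • w₂ + d) + U * p₂ ^ 2 + p₂ ^ 3)‖ ≤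
      14 * c ^ 3 * s * δ := by
  have hc0 : 0 ≤ c := by linarith
  have hs0 : 0 ≤ s := by linarith
  have hcδ : 0 ≤ c * δ := (norm_nonneg _).trans hv
  have hδ : 0 ≤ δ := nonneg_of_mul_nonneg_right hcδ (by linarith)
  have hc3 : c ≤ c ^ 3 := le_self_pow₀ hc (by norm_num)
  have hc23 : c ^ 2 ≤ c ^ 3 := pow_le_pow_right₀ hc (by norm_num)
  have e1 : ((b * ε ^ 2) • (v₁ - e - φ₁) + ε • (B • w₁ + d) + U * p₁ ^ 2 + p₁ ^ 3) -
      ((b * ε ^ 2) • (v₂ - e - φ₂) + ε • (B • w₂ + d) + U * p₂ ^ 2 + p₂ ^ 3) =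
      (b * ε ^ 2) • ((v₁ - v₂) - (φ₁ - φ₂)) + (ε * B) • (w₁ - w₂) + (p₁ - p₂) * (U * (p₁ + p₂)) +
      (p₁ - p₂) * (p₁ * p₁ + p₁ * p₂ + p₂ * p₂) := by
    simp only [smul_sub, smul_add, mul_smul]; ring
  have t1 : ‖(b * ε ^ 2) • ((v₁ - v₂) - (φ₁ - φ₂))‖ ≤ 2 * c ^ 3 * s * δ := by
    rw [norm_smul, Real.norm_eq_abs, abs_mul, abs_of_nonneg (sq_nonneg ε)]
    have h2 : ε ^ 2 ≤ s := by nlinarith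
    calc _ ≤ c * s * (c * δ + c * δ) := by
          gcongr
          exact (norm_sub_le _ _).trans (by gcongr)
      _ = 2 * c ^ 2 * s * δ := by ring
      _ ≤ _ := by gcongr
  have t2 : ‖(ε * B) • (w₁ - w₂)‖ ≤ c ^ 3 * s * δ := by
    rw [norm_smul, Real.norm_eq_abs, abs_mul, abs_of_pos hε]
    calc _ ≤ s * c * (c * δ) := by gcongr
      _ = c ^ 2 * s * δ := by ring
      _ ≤ _ := by gcongr
  rw [hp] at e1
  have t3 : ‖(φ₁ - φ₂) * (U * (p₁ + p₂))‖ ≤ 2 * c ^ 3 * s * δ := by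
    calc _ ≤ (c * δ) * (c * (c * s + c * s)) := by
          refine (norm_mul_le _ _).trans ?_
          gcongr
          refine (norm_mul_le _ _).trans ?_
          gcongr
          exact (norm_add_le _ _).trans (by gcongr)
      _ = _ := by ring
  have t4 : ‖(φ₁ - φ₂) * (p₁ * p₁ + p₁ * p₂ + p₂ * p₂)‖ ≤ 9 * c ^ 3 * s * δ := by
    have hm : ∀ {x y : X}, ‖x‖ ≤ c * s → ‖y‖ ≤ c * s → ‖x * y‖ ≤ (c * s) * (c * s) := fun h h' =>
      (norm_mul_le _ _).trans (by gcongr)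
    calc _ ≤ (c * δ) * ((c * s) * (c * s) + (c * s) * (c * s) + (c * s) * (c * s)) := by
          refine (norm_mul_le _ _).trans ?_
          gcongr
          refine norm_add₃_le.trans ?_
          gcongr
          · exact hm hp₁ hp₁
          · exact hm hp₁ hp₂
          · exact hm hp₂ hp₂
      _ = 3 * (c ^ 3 * s * δ) * s := by ring
      _ ≤ 3 * (c ^ 3 * s * δ) * 3 := by gcongr
      _ = _ := by ring
  rw [e1]
  calc _ ≤ 2 * c ^ 3 * s * δ + c ^ 3 * s * δ + 2 * c ^ 3 * s * δ + 9 * c ^ 3 * s * δ :=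
        (norm_add_le _ _).trans (add_le_add (norm_add₃_le.trans
          (add_le_add (add_le_add t1 t2) t3)) t4)
    _ = _ := by ring

lemma norm_forcing_le {c ε b B : ℝ} {v φ w p e d U : X} (hc : 1 ≤ c)
    (hε : 0 < ε) (hε1 : ε ≤ 1) (hb : |b| ≤ c) (hB : |B| ≤ c) (hU : ‖U‖ ≤ c)
    (hv : ‖v‖ ≤ c * ε) (hφ : ‖φ‖ ≤ c * ε) (hw : ‖w‖ ≤ c * ε) (hp : ‖p‖ ≤ c * ε)
    (he : ‖e‖ ≤ c) (hd : ‖d‖ ≤ c) :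
    ‖(b * ε ^ 2) • (v - e - φ) + ε • (B • w + d) + U * p ^ 2 + p ^ 3‖ ≤ 7 * c ^ 3 * ε := by
  have hc0 : 0 ≤ c := by linarith
  have hc3 : c ≤ c ^ 3 := le_self_pow₀ hc (by norm_num)
  have hc23 : c ^ 2 ≤ c ^ 3 := pow_le_pow_right₀ hc (by norm_num)
  have hcε : c * ε ≤ c := by nlinarith
  have hε2 : ε ^ 2 ≤ ε := by nlinarith
  have hε3 : ε ^ 3 ≤ ε := by nlinarith
  have t1 : ‖(b * ε ^ 2) • (v - e - φ)‖ ≤ 3 * c ^ 3 * ε := by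
    rw [norm_smul, Real.norm_eq_abs, abs_mul, abs_of_nonneg (sq_nonneg ε)]
    calc _ ≤ c * ε * (c + c + c) := by
          gcongr
          refine (norm_sub_le _ _).trans ?_
          exact add_le_add ((norm_sub_le _ _).trans (add_le_add (hv.trans hcε) he)) (hφ.trans hcε)
      _ = 3 * c ^ 2 * ε := by ring
      _ ≤ _ := by gcongr
  have t2 : ‖ε • (B • w + d)‖ ≤ 2 * c ^ 3 * ε := by
    rw [norm_smul, Real.norm_eq_abs, abs_of_pos hε]
    calc _ ≤ ε * (c * c + c) := by
          gcongr
          refine (norm_add_le _ _).trans (add_le_add ?_ hd)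
          rw [norm_smul, Real.norm_eq_abs]
          have := hw.trans hcε
          gcongr
      _ = (c ^ 2 + c) * ε := by ring
      _ ≤ (c ^ 3 + c ^ 3) * ε := by gcongr
      _ = _ := by ring
  have t3 : ‖U * p ^ 2‖ ≤ c ^ 3 * ε := by
    rw [pow_two]
    calc _ ≤ c * (c * ε * (c * ε)) := by
          refine (norm_mul_le _ _).trans ?_
          gcongr
          exact (norm_mul_le _ _).trans (by gcongr)
      _ = c ^ 3 * ε ^ 2 := by ring
      _ ≤ _ := by gcongr
  have t4 : ‖p ^ 3‖ ≤ c ^ 3 * ε := by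
    calc _ ≤ (c * ε) ^ 3 := (norm_pow_le' _ (by norm_num)).trans (by gcongr)
      _ = c ^ 3 * ε ^ 3 := by ring
      _ ≤ _ := by gcongr
  calc _ ≤ 3 * c ^ 3 * ε + 2 * c ^ 3 * ε + c ^ 3 * ε + c ^ 3 * ε :=
        (norm_add_le _ _).trans (add_le_add (norm_add₃_le.trans
          (add_le_add (add_le_add t1 t2) t3)) t4)
    _ = _ := by ring

/-- The fixed point problem for the correction, with abstract bounds for the solution operators. -/
lemma exists_forcing_fixedPoint {c : ℝ} (hc : 1 ≤ c) :
    ∃ ε₀ > 0, ∃ K > 0, ∀ ε, 0 < ε → ε < ε₀ →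
      ∀ {X : Type} [NormedCommRing X] [NormedAlgebra ℝ X] [CompleteSpace X]
      (v φ w Y : X × X → X) (e ρ U d : X) (b B : ℝ),
      (∀ z, ‖v z‖ ≤ c * (ε + ‖z‖)) → (∀ z, ‖φ z‖ ≤ c * (ε + ‖z‖)) → (∀ z, ‖w z‖ ≤ c * (ε + ‖z‖)) →
      (∀ z, ‖φ z + ρ‖ ≤ c * (ε + ‖z‖)) →
      (∀ z z', ‖v z - v z'‖ ≤ c * ‖z - z'‖) → (∀ z z', ‖φ z - φ z'‖ ≤ c * ‖z - z'‖) →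
      (∀ z z', ‖w z - w z'‖ ≤ c * ‖z - z'‖) → (∀ z z', ‖Y z - Y z'‖ ≤ c * ε * ‖z - z'‖) →
      ‖Y 0‖ ≤ c * ε → ‖e‖ ≤ c → ‖U‖ ≤ c → ‖d‖ ≤ c → |b| ≤ c → |B| ≤ c →
      ∃ z, ((b * ε ^ 2) • (v z - e - φ z) + ε • (B • w z + d) + U * (φ z + ρ) ^ 2 + (φ z + ρ) ^ 3,
        Y z) = z ∧ ‖z‖ ≤ K * ε := by
  have hc3 : c ≤ c ^ 3 := le_self_pow₀ hc (by norm_num)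
  have hc0 : 0 < c := by linarith
  obtain ⟨ε₀, hε₀, H⟩ := exists_small_fixedPoint (C := 14 * c ^ 3) (by positivity)
  refine ⟨min ε₀ 1, by positivity, 2 * (14 * c ^ 3), by positivity, fun ε hε hlt X _ _ _
    v φ w Y e ρ U d b B hv hφ hw hp hv' hφ' hw' hY hY0 he hU hd hb hB => ?_⟩
  have hε1 : ε ≤ 1 := (lt_min_iff.1 hlt).2.le
  refine H ε hε (lt_min_iff.1 hlt).1 _ ?_ fun z₁ z₂ hz₁ hz₂ => ?_
  · have h1 := hv 0
    have h2 := hφ 0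
    have h3 := hw 0
    have h4 := hp 0
    rw [norm_zero, add_zero] at h1 h2 h3 h4
    refine norm_prod_le_iff.2 ⟨?_, ?_⟩
    · refine (norm_forcing_le hc hε hε1 hb hB hU h1 h2 h3 h4 he hd).trans ?_
      gcongr; norm_num
    · refine hY0.trans ?_
      gcongr; nlinarith
  · have hn₁ := norm_nonneg z₁
    have hn₂ := norm_nonneg z₂
    refine norm_prod_le_iff.2 ⟨?_, ?_⟩
    · exact norm_forcing_sub_le (s := ε + ‖z₁‖ + ‖z₂‖) hc hε hε1 hb hB hU (hv' _ _) (hφ' _ _) (hw' _ _)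
        (by abel) ((hp z₁).trans (mul_le_mul_of_nonneg_left (by linarith) hc0.le)) ((hp z₂).trans (mul_le_mul_of_nonneg_left (by linarith) hc0.le))
        (by linarith) (by linarith)
    · refine (hY z₁ z₂).trans ?_
      refine mul_le_mul_of_nonneg_right ?_ (norm_nonneg _)
      exact mul_le_mul (by linarith) (by linarith) hε.le (by positivity)
end

/-- The fixed point problem for the correction of the periodic profile. -/
lemma exists_correction {C : ℝ} (hC : 1 ≤ C) :
    ∃ ε₀ > 0, ∃ K > 0, ∀ ε, 0 < ε → ε < ε₀ →
      ∀ {X : Type} [NormedCommRing X] [NormedAlgebra ℝ X] [CompleteSpace X]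
      (G J T₁ T₂ : X →ₗ[ℝ] X) (e ρ U d : X) (b B : ℝ),
      (∀ g, ‖G g‖ ≤ C * ‖g‖) → (∀ g, ‖J g‖ ≤ C * ‖g‖) → (∀ g, ‖T₁ g‖ ≤ C * ‖g‖) →
      (∀ g, ‖T₂ g‖ ≤ C * ‖g‖) → ‖T₁ e‖ ≤ C * ε → ‖T₂ e‖ ≤ C * ε →
      (∀ g, ‖T₁ (J g)‖ ≤ C * ε * ‖g‖) → ‖e‖ ≤ C → ‖ρ‖ ≤ C * ε → ‖U‖ ≤ C → ‖d‖ ≤ C →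
      |b| ≤ C → |B| ≤ C →
      ∃ f v φ w : X, v = T₁ (e + (G f - J v)) ∧ φ = G f - J v - b • v ∧ w = T₂ (e + φ) ∧
        f = (b * ε ^ 2) • (v - e - φ) + ε • (B • w + d) + U * (φ + ρ) ^ 2 + (φ + ρ) ^ 3 ∧
        ‖v‖ ≤ K * ε ∧ ‖φ‖ ≤ K * ε ∧ ‖w‖ ≤ K * ε := by
  obtain ⟨c₁, hc₁⟩ : ∃ c, c = C * C + C := ⟨_, rfl⟩
  obtain ⟨c₂, hc₂⟩ : ∃ c, c = C + C * c₁ + C * c₁ := ⟨_, rfl⟩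
  obtain ⟨c, hc⟩ : ∃ c, c = C * c₂ + C + C * c₁ := ⟨_, rfl⟩
  have hC0 : 0 < C := by linarith
  have hc₁C : C ≤ c₁ := by rw [hc₁]; nlinarith
  have hc₁0 : 0 < c₁ := by linarith
  have hc₁c₂ : C * c₁ ≤ c₂ := by rw [hc₂]; nlinarith
  have hc₂0 : 0 < c₂ := lt_of_lt_of_le (by positivity) hc₁c₂
  have hc₁c : C * c₁ ≤ c := by rw [hc]; nlinarith
  have hc₁c' : c₁ ≤ c := by nlinarith
  have hc₂c : c₂ + C ≤ c := by rw [hc]; nlinarith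
  have hCc : C ≤ c := by linarith
  have hc0 : 0 < c := by linarith
  obtain ⟨ε₀, hε₀, K, hK, H⟩ := exists_forcing_fixedPoint (hC.trans hCc)
  refine ⟨ε₀, hε₀, c * (1 + K), by positivity, fun ε hε hlt X _ _ _ G J T₁ T₂ e ρ U d b B
    hG hJ hT₁ hT₂ hT₁e hT₂e hTJ he hρ hU hd hb hB => ?_⟩
  obtain ⟨v, hv⟩ : ∃ v : X × X → X, ∀ z, v z = T₁ (e + G z.1) + z.2 := ⟨_, fun _ => rfl⟩
  obtain ⟨φ, hφ⟩ : ∃ φ : X × X → X, ∀ z, φ z = G z.1 - J (v z) - b • v z := ⟨_, fun _ => rfl⟩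
  obtain ⟨w, hw⟩ : ∃ w : X × X → X, ∀ z, w z = T₂ (e + φ z) := ⟨_, fun _ => rfl⟩
  have hφ_le : ∀ (g x : X) (s : ℝ), ‖g‖ ≤ s → ‖x‖ ≤ c₁ * s →
      ‖G g - J x - b • x‖ ≤ c₂ * s := fun g x s hg hx => by
    calc _ ≤ ‖G g‖ + ‖J x‖ + ‖b • x‖ := (norm_sub_le _ _).trans (by gcongr; exact norm_sub_le _ _)
      _ ≤ C * s + C * (c₁ * s) + C * (c₁ * s) := by
          refine add_le_add (add_le_add ((hG g).trans ?_) ((hJ x).trans ?_)) ?_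
          · gcongr
          · gcongr
          · rw [norm_smul, Real.norm_eq_abs]; gcongr
      _ = _ := by rw [hc₂]; ring
  have hTG : ∀ (g : X) (s : ℝ), ‖g‖ ≤ s → ‖T₁ (G g)‖ ≤ C * (C * s) := fun g s hg =>
    (hT₁ _).trans (by gcongr; exact (hG _).trans (by gcongr))
  have hv_le : ∀ z, ‖v z‖ ≤ c₁ * (ε + ‖z‖) := fun z => by
    rw [hv, map_add]
    calc _ ≤ ‖T₁ e‖ + ‖T₁ (G z.1)‖ + ‖z.2‖ := norm_add₃_le
      _ ≤ C * ε + C * (C * ‖z‖) + ‖z‖ :=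
          add_le_add (add_le_add hT₁e (hTG _ _ (norm_fst_le z))) (norm_snd_le z)
      _ ≤ _ := by
          rw [hc₁]
          nlinarith [norm_nonneg z, mul_nonneg (mul_nonneg hC0.le hC0.le) hε.le]
  have hv_sub : ∀ z z', ‖v z - v z'‖ ≤ c₁ * ‖z - z'‖ := fun z z' => by
    have : v z - v z' = T₁ (G (z - z').1) + (z - z').2 := by
      simp only [hv, Prod.fst_sub, Prod.snd_sub, map_add, map_sub]; abel
    rw [this]
    calc _ ≤ C * (C * ‖z - z'‖) + ‖z - z'‖ :=
          (norm_add_le _ _).trans (add_le_add (hTG _ _ (norm_fst_le _)) (norm_snd_le _))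
      _ ≤ _ := by rw [hc₁]; nlinarith [norm_nonneg (z - z')]
  have hφ_le' : ∀ z, ‖φ z‖ ≤ c₂ * (ε + ‖z‖) := fun z => by
    rw [hφ]
    exact hφ_le _ _ _ ((norm_fst_le z).trans (by linarith)) (hv_le z)
  have hφ_sub : ∀ z z', ‖φ z - φ z'‖ ≤ c₂ * ‖z - z'‖ := fun z z' => by
    have : φ z - φ z' = G (z - z').1 - J (v z - v z') - b • (v z - v z') := by
      simp only [hφ, Prod.fst_sub, map_sub, smul_sub]; abel
    rw [this]
    exact hφ_le _ _ _ (norm_fst_le _) (hv_sub _ _)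
  have hw_le : ∀ z, ‖w z‖ ≤ c * (ε + ‖z‖) := fun z => by
    rw [hw, map_add]
    calc _ ≤ C * ε + C * (c₂ * (ε + ‖z‖)) :=
          (norm_add_le _ _).trans (add_le_add hT₂e ((hT₂ _).trans (by gcongr; exact hφ_le' z)))
      _ = (C * c₂ + C) * ε + C * c₂ * ‖z‖ := by ring
      _ ≤ c * ε + c * ‖z‖ := by
          have : 0 ≤ C * c₁ := by positivity
          gcongr <;> rw [hc] <;> linarith
      _ = _ := by ring
  have hw_sub : ∀ z z', ‖w z - w z'‖ ≤ c * ‖z - z'‖ := fun z z' => by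
    have : w z - w z' = T₂ (φ z - φ z') := by simp only [hw, map_add, map_sub]; abel
    rw [this]
    calc _ ≤ C * (c₂ * ‖z - z'‖) := (hT₂ _).trans (by gcongr; exact hφ_sub z z')
      _ = C * c₂ * ‖z - z'‖ := by ring
      _ ≤ _ := by
          have : 0 ≤ C * c₁ := by positivity
          gcongr; rw [hc]; linarith
  obtain ⟨z, hz, hzε⟩ := H ε hε hlt v φ w (fun z => -T₁ (J (v z))) e ρ U d b B
    (fun z => (hv_le z).trans (by gcongr)) (fun z => (hφ_le' z).trans (by gcongr; linarith)) hw_le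
    (fun z => (norm_add_le _ _).trans (by
      have := hφ_le' z
      calc _ ≤ c₂ * (ε + ‖z‖) + C * (ε + ‖z‖) :=
            add_le_add (hφ_le' z) (hρ.trans (by gcongr; linarith [norm_nonneg z]))
        _ = (c₂ + C) * (ε + ‖z‖) := by ring
        _ ≤ _ := by gcongr))
    (fun z z' => (hv_sub z z').trans (by gcongr))
    (fun z z' => (hφ_sub z z').trans (by gcongr; linarith)) hw_sub
    (fun z z' => by
      rw [← neg_sub', norm_neg, ← map_sub, ← map_sub]
      calc _ ≤ C * ε * (c₁ * ‖z - z'‖) := (hTJ _).trans (by gcongr; exact hv_sub z z')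
        _ = C * c₁ * ε * ‖z - z'‖ := by ring
        _ ≤ _ := by gcongr)
    (by
      have h0 : v 0 = T₁ e := by simp [hv]
      rw [h0, norm_neg]
      calc _ ≤ C * (C * (C * ε)) := (hT₁ _).trans (by
            gcongr; exact (hJ _).trans (by gcongr))
        _ = C * (C * C) * ε := by ring
        _ ≤ C * c₁ * ε := by gcongr; rw [hc₁]; linarith
        _ ≤ _ := by gcongr)
    (he.trans hCc) (hU.trans hCc) (hd.trans hCc) (hb.trans hCc) (hB.trans hCc)
  have hf := congrArg Prod.fst hz
  have hy := congrArg Prod.snd hz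
  simp only at hf hy
  have hzε' : ε + ‖z‖ ≤ (1 + K) * ε := by linarith
  have hK' : c * (ε + ‖z‖) ≤ c * (1 + K) * ε := by rw [mul_assoc]; gcongr
  refine ⟨z.1, v z, φ z, w z, ?_, hφ z, hw z, hf.symm, ((hv_le z).trans ?_).trans hK',
    ((hφ_le' z).trans ?_).trans hK', (hw_le z).trans hK'⟩
  · conv_lhs => rw [hv, ← hy]
    simp only [map_add, map_sub]; abel
  · gcongr
  · gcongr; linarith

section
variable {ℓ : ℝ}

lemma abs_iccExtend_le (hℓ : 0 < ℓ) (f : C(Icc 0 ℓ, ℝ)) (t : ℝ) : |f.IccExtend hℓ.le t| ≤ ‖f‖ :=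
  f.norm_coe_le_norm _

lemma iccExtend_apply (hℓ : 0 < ℓ) (f : C(Icc 0 ℓ, ℝ)) {t : ℝ} (ht : t ∈ Icc 0 ℓ) :
    f.IccExtend hℓ.le t = f ⟨t, ht⟩ := IccExtend_of_mem hℓ.le _ ht

end

/-- Bounded Neumann solution operator of the linearisation about the homoclinic profile. -/
lemma exists_layer_operator {a β κ : ℝ} (ha : 0 < a) (hβ : 0 < β) (hκ : 0 < κ) :
    ∃ M > 0, ∃ ℓ₀ : ℝ, ∀ (ℓ : ℝ) (hℓ : 0 < ℓ), ℓ₀ ≤ ℓ →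
    ∃ G : C(Icc 0 ℓ, ℝ) →ₗ[ℝ] C(Icc 0 ℓ, ℝ),
      (∀ f, ∃ g g' : ℝ → ℝ, (∀ x : Icc 0 ℓ, G f x = g x) ∧ (∀ x, HasDerivAt g (g' x) x) ∧
        (∀ x, HasDerivAt g' (κ ^ 2 * pot a β (κ * x) * g x + f.IccExtend hℓ.le x) x) ∧
        g' 0 = 0 ∧ g' ℓ = 0) ∧
      (∀ f, ‖G f‖ ≤ M * ‖f‖) ∧
      ∀ (f : C(Icc 0 ℓ, ℝ)) (F : ℝ), (∀ x : Icc 0 ℓ, |f x| ≤ F * exp (-(κ / 2) * x)) →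
        ∀ x : Icc 0 ℓ, |G f x| ≤ M * F * exp (-(κ / 2) * x) := by
  obtain ⟨M, hM, ℓ₀, H⟩ := exists_layer_green ha hβ hκ
  refine ⟨M * (4 / κ), by positivity, ℓ₀, fun ℓ hℓ hℓ₀ => ?_⟩
  obtain ⟨G, hG, hGM⟩ := H ℓ hℓ hℓ₀
  refine ⟨G, hG, fun f => ?_, fun f F hF x => ?_⟩
  · rw [ContinuousMap.norm_le _ (by positivity)]
    intro x
    have h := kernel_integral_le (F := ‖f‖) le_rfl hκ x.2.1 x.2.2 (f.IccExtend hℓ.le).continuous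
      fun t _ _ => by simpa using abs_iccExtend_le hℓ f t
    calc _ ≤ M * (2 / (κ - 0) * ‖f‖ * exp (-0 * x)) := (hGM f x).trans (by gcongr)
      _ = M * (2 / κ) * ‖f‖ := by simp; ring
      _ ≤ _ := by gcongr; norm_num
  · have h := kernel_integral_le (F := F) (by positivity : 0 ≤ κ / 2) (half_lt_self hκ)
      x.2.1 x.2.2 (f.IccExtend hℓ.le).continuous
      fun t h0 h1 => by rw [iccExtend_apply hℓ f ⟨h0, h1⟩]; exact hF ⟨t, h0, h1⟩
    calc _ ≤ M * (2 / (κ - κ / 2) * F * exp (-(κ / 2) * x)) := (hGM f x).trans (by gcongr)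
      _ = _ := by rw [sub_half]; field_simp; ring

/-- Bounded Neumann solution operator of `g″ = (ε k)² g - c ε² f` on an interval of length
`L / ε`. -/
lemma exists_slow_operator {L k c : ℝ} (hL : 0 < L) (hk : 0 < k) (hc : 0 < c) :
    ∃ M > 0, ∀ (ε ℓ : ℝ) (_ : 0 < ε) (hℓ : 0 < ℓ), ε * ℓ = L →
    ∃ T : C(Icc 0 ℓ, ℝ) →ₗ[ℝ] C(Icc 0 ℓ, ℝ),
      (∀ f, ∃ g g' : ℝ → ℝ, (∀ x : Icc 0 ℓ, T f x = g x) ∧ (∀ x, HasDerivAt g (g' x) x) ∧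
        (∀ x, HasDerivAt g' ((ε * k) ^ 2 * g x - c * ε ^ 2 * f.IccExtend hℓ.le x) x) ∧
        g' 0 = 0 ∧ g' ℓ = 0) ∧
      (∀ f, ‖T f‖ ≤ M * ‖f‖) ∧
      ∀ (f : C(Icc 0 ℓ, ℝ)) (F μ : ℝ), 0 < μ → (∀ x : Icc 0 ℓ, |f x| ≤ F * exp (-μ * x)) →
        ‖T f‖ ≤ M * ε * (F / μ) := by
  obtain ⟨M, hM, H⟩ := exists_slow_green hL hk
  refine ⟨c * M * L + c * M, by positivity, fun ε ℓ hε hℓ hεℓ => ?_⟩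
  obtain ⟨G, hG, hGM⟩ := H ε ℓ hε hℓ hεℓ
  have hle : ∀ (f : C(Icc 0 ℓ, ℝ)) (s : ℝ), 0 ≤ s → (∫ t in (0 : ℝ)..ℓ, |f.IccExtend hℓ.le t|) ≤ s →
      ‖-(c * ε ^ 2) • G f‖ ≤ c * M * ε * s := fun f s hs h => by
    rw [ContinuousMap.norm_le _ (by positivity)]
    intro x
    simp only [ContinuousMap.smul_apply, smul_eq_mul, Real.norm_eq_abs, abs_mul, abs_neg,
      abs_of_pos hc, abs_of_pos (pow_pos hε 2)]
    calc _ ≤ c * ε ^ 2 * (M / ε * s) := by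
          gcongr
          exact (hGM f x).trans (by gcongr)
      _ = _ := by field_simp
  have hcont : ∀ f : C(Icc 0 ℓ, ℝ), Continuous fun t => |f.IccExtend hℓ.le t| := fun f =>
    (f.IccExtend hℓ.le).continuous.abs
  refine ⟨-(c * ε ^ 2) • G, fun f => ?_, fun f => ?_, fun f F μ hμ hF => ?_⟩
  · obtain ⟨g, g', h1, h2, h3, h4, h5⟩ := hG f
    refine ⟨fun x => -(c * ε ^ 2) * g x, fun x => -(c * ε ^ 2) * g' x, fun x => by simp [h1],
      fun x => (h2 x).const_mul _, fun x => ((h3 x).const_mul _).congr_deriv (by ring),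
      by simp [h4], by simp [h5]⟩
  · refine (hle f (ℓ * ‖f‖) (by positivity) ?_).trans ?_
    · calc _ ≤ ∫ t in (0 : ℝ)..ℓ, ‖f‖ := intervalIntegral.integral_mono_on hℓ.le
            ((hcont f).intervalIntegrable _ _) (by simp) fun t _ => abs_iccExtend_le hℓ f t
        _ = _ := by simp
    · calc _ = c * M * (ε * ℓ) * ‖f‖ := by ring
        _ ≤ _ := by rw [hεℓ]; gcongr; linarith [mul_pos hc hM]
  · have hF0 : 0 ≤ F := by
      have := (abs_nonneg _).trans (hF ⟨0, le_rfl, hℓ.le⟩)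
      simpa using this
    refine (hle f (F / μ) (by positivity) ?_).trans ?_
    · have hd : ∀ t : ℝ, HasDerivAt (fun t => -(F / μ) * exp (-μ * t)) (F * exp (-μ * t)) t :=
        fun t => ((((hasDerivAt_id t).const_mul (-μ)).exp).const_mul (-(F / μ))).congr_deriv (by
          simp; field_simp)
      calc _ ≤ ∫ t in (0 : ℝ)..ℓ, F * exp (-μ * t) := intervalIntegral.integral_mono_on hℓ.le
            ((hcont f).intervalIntegrable _ _) (Continuous.intervalIntegrable (by fun_prop) _ _)
            fun t ht => by rw [iccExtend_apply hℓ f ht]; exact hF ⟨t, ht⟩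
        _ = F / μ - F / μ * exp (-μ * ℓ) := by
            rw [intervalIntegral.integral_eq_sub_of_hasDerivAt (fun t _ => hd t)
              (Continuous.intervalIntegrable (by fun_prop) _ _)]
            simp; ring
        _ ≤ _ := by
            have : 0 ≤ F / μ * exp (-μ * ℓ) := by positivity
            linarith
    · gcongr
      linarith [mul_pos (mul_pos hc hM) hL]

/-- The periodic solution on half a period, in the fast variable. -/
lemma exists_half_period {a β κ D L : ℝ} (ha : 0 < a) (hβ : 0 < β) (hβa : β < a) (hκ : 0 < κ)
    (hab : a ^ 2 + 2 * β ^ 2 = 1) (hm : κ ^ 2 = 2 * (a ^ 2 - β ^ 2)) (hD : 0 < D) (hL : 0 < L)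
    {u u' : ℝ → ℝ} (hu : ∀ x, HasDerivAt u (u' x) x)
    (hu' : ∀ x, HasDerivAt u' (u x ^ 3 - u x + 2 * β ^ 2 * a) x) (hu0 : u' 0 = 0)
    (hη : ∀ x, u x = a - κ ^ 2 / den a β (κ * x)) (B₁ C₁ : ℝ) :
    ∃ ε₀ > 0, ∃ K > 0, ∀ ε, 0 < ε → ε < ε₀ →
      ∃ p p' p'' v v' v'' w w' w'' : ℝ → ℝ,
        ((∀ x, HasDerivAt p (p' x) x) ∧ (∀ x, HasDerivAt p' (p'' x) x) ∧ Continuous p'' ∧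
          p' 0 = 0 ∧ p' (L / ε) = 0) ∧
        ((∀ x, HasDerivAt v (v' x) x) ∧ (∀ x, HasDerivAt v' (v'' x) x) ∧ Continuous v'' ∧
          v' 0 = 0 ∧ v' (L / ε) = 0) ∧
        ((∀ x, HasDerivAt w (w' x) x) ∧ (∀ x, HasDerivAt w' (w'' x) x) ∧ Continuous w'' ∧
          w' 0 = 0 ∧ w' (L / ε) = 0) ∧
        ∀ x ∈ Icc 0 (L / ε),
          p'' x = p x ^ 3 - p x + (2 * β ^ 2 * v x + ε * B₁ * w x + ε * C₁) ∧
          v'' x = ε ^ 2 * (v x - p x) ∧ D ^ 2 * w'' x = ε ^ 2 * (w x - p x) ∧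
          |p x - u x| ≤ K * ε ∧ |v x - a| ≤ K * ε ∧ |w x - a| ≤ K * ε := by
  have hκ0 : 0 < κ ^ 2 := by positivity
  obtain ⟨b, hb⟩ : ∃ b, b = 2 * β ^ 2 / κ ^ 2 := ⟨_, rfl⟩
  have hb0 : 0 < b := by rw [hb]; positivity
  have hbκ : b * κ ^ 2 = 2 * β ^ 2 := by rw [hb]; field_simp
  obtain ⟨MG, hMG, ℓ₁, HG⟩ := exists_layer_operator ha hβ hκ
  obtain ⟨MR, hMR, ℓ₂, HR⟩ := exists_layer_correction ha hβ hκ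
  obtain ⟨M₁, hM₁, H₁⟩ := exists_slow_operator (k := √(1 + b)) (c := 1) hL (by positivity) one_pos
  obtain ⟨M₂, hM₂, H₂⟩ := exists_slow_operator (k := 1 / D) (c := 1 / D ^ 2) hL
    (by positivity) (by positivity)
  -- decay constants of the profile and of the potential
  obtain ⟨F, hF⟩ : ∃ F, F = 2 * (κ ^ 2 / β) := ⟨_, rfl⟩
  obtain ⟨R, hR⟩ : ∃ R, R = MR * (2 * κ ^ 2 / (β * L)) := ⟨_, rfl⟩
  obtain ⟨Q, hQ⟩ : ∃ Q, Q = b * κ ^ 2 * (2 * (12 * a / β)) := ⟨_, rfl⟩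
  have hF0 : 0 < F := by rw [hF]; positivity
  have hR0 : 0 < R := by rw [hR]; positivity
  have hQ0 : 0 < Q := by rw [hQ]; positivity
  have hpot : ∀ x, κ ^ 2 * pot a β (κ * x) = 3 * u x ^ 2 - 1 := fun x => by
    have hden := (den_pos ha hβ (κ * x)).ne'
    rw [hη, pot]
    field_simp
    linear_combination (den a β (κ * x) ^ 2 - 3 * κ ^ 2) * hm - den a β (κ * x) ^ 2 * hab

  have hudecay : ∀ x, |u x - a| ≤ F * exp (-κ * x) := fun x => by
    have hden := den_pos ha hβ (κ * x)
    have h1 := cosh_pos (κ * x)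
    rw [hη, sub_sub_cancel_left, abs_neg, abs_of_pos (by positivity), hF]
    calc _ ≤ κ ^ 2 / (β * cosh (κ * x)) := by gcongr; exact mul_cosh_le_den ha _
      _ = κ ^ 2 / β / cosh (κ * x) := by field_simp
      _ ≤ _ := (div_cosh_le_exp (by positivity) _).trans_eq (by ring_nf)
  have hu'eq : ∀ x, u' x = κ ^ 3 * β * oddSol a β (κ * x) := fun x => by
    have hden := (den_pos ha hβ (κ * x)).ne'
    have h1 : HasDerivAt (fun x => a - κ ^ 2 / den a β (κ * x))
        (κ ^ 3 * β * oddSol a β (κ * x)) x := by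
      have h2 := ((hasDerivAt_den (a := a) (β := β) (κ * x)).comp x
        ((hasDerivAt_id x).const_mul κ)).inv hden
      refine ((h2.const_mul (κ ^ 2)).const_sub a).congr_deriv ?_
      simp only [oddSol, Function.comp]
      field_simp
    exact (hu x).unique (h1.congr_of_eventuallyEq (Eventually.of_forall hη))
  obtain ⟨C, hC1, hCb, hCB, hCG, hCJ, hC₁, hC₂, hCe₁, hCe₂, hCTJ, hCe, hCR, hCU, hCd⟩ :
      ∃ C, 1 ≤ C ∧ b ≤ C ∧ |B₁| ≤ C ∧ MG ≤ C ∧ MG * Q ≤ C ∧ M₁ ≤ C ∧ M₂ ≤ C ∧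
        M₁ * (F / κ) + M₁ * R ≤ C ∧ M₂ * (F / κ) + M₂ * R ≤ C ∧
        M₁ * (MG * Q / (κ / 2)) ≤ C ∧ F + R ≤ C ∧ R ≤ C ∧ 3 * (a + F) ≤ C ∧ |B₁ * a + C₁| ≤ C :=
    ((eventually_ge_atTop _).and <| (eventually_ge_atTop _).and <| (eventually_ge_atTop _).and <|
      (eventually_ge_atTop _).and <| (eventually_ge_atTop _).and <| (eventually_ge_atTop _).and <|
      (eventually_ge_atTop _).and <| (eventually_ge_atTop _).and <| (eventually_ge_atTop _).and <|
      (eventually_ge_atTop _).and <| (eventually_ge_atTop _).and <| (eventually_ge_atTop _).and <|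
      (eventually_ge_atTop _).and (eventually_ge_atTop _)).exists
  obtain ⟨ε₁, hε₁, K, hK, H⟩ := exists_correction hC1
  refine ⟨min (min ε₁ 1) (L / (|ℓ₁| + |ℓ₂| + 1)), by positivity, K + R, by positivity,
    fun ε hε hlt => ?_⟩
  obtain ⟨⟨hlt₁, hlt₂⟩, hlt₃⟩ : (ε < ε₁ ∧ ε < 1) ∧ ε < L / (|ℓ₁| + |ℓ₂| + 1) := by
    simpa only [lt_min_iff] using hlt
  obtain ⟨ℓ, hℓdef⟩ : ∃ ℓ, ℓ = L / ε := ⟨_, rfl⟩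
  have hℓ : 0 < ℓ := by rw [hℓdef]; positivity
  have hεℓ : ε * ℓ = L := by rw [hℓdef]; field_simp
  have hℓ₀ : |ℓ₁| + |ℓ₂| + 1 ≤ ℓ := by
    rw [hℓdef, le_div_iff₀ hε]
    have := (lt_div_iff₀ (by positivity)).1 hlt₃
    linarith
  have hℓ₁ : ℓ₁ ≤ ℓ := by linarith [le_abs_self ℓ₁, abs_nonneg ℓ₂]
  have hℓ₂ : ℓ₂ ≤ ℓ := by linarith [le_abs_self ℓ₂, abs_nonneg ℓ₁]
  rw [← hℓdef]
  obtain ⟨G, hG, hGM, hGd⟩ := HG ℓ hℓ hℓ₁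
  obtain ⟨r, r', hr, hr', hr0, hrℓ, hrM⟩ := HR ℓ hℓ hℓ₂ (-u' ℓ)
  obtain ⟨T₁, hT₁, hT₁M, hT₁d⟩ := H₁ ε ℓ hε hℓ hεℓ
  obtain ⟨T₂, hT₂, hT₂M, hT₂d⟩ := H₂ ε ℓ hε hℓ hεℓ
  have hrR : ∀ x, 0 ≤ x → x ≤ ℓ → |r x| ≤ R * ε := fun x hx hxℓ => by
    refine (hrM x hx hxℓ).trans ?_
    have h1 : |oddSol a β (κ * ℓ)| ≤ 2 * (1 / β ^ 2) * (1 / (κ * ℓ)) := by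
      refine (abs_oddSol_le ha hβ (by positivity)).trans ?_
      rw [exp_neg, ← one_div]
      gcongr
      linarith [add_one_le_exp (κ * ℓ)]
    rw [abs_neg, hu'eq, abs_mul, abs_of_pos (by positivity)]
    calc _ ≤ MR * (κ ^ 3 * β * (2 * (1 / β ^ 2) * (1 / (κ * ℓ)))) := by gcongr
      _ = _ := by rw [hR, ← hεℓ]; field_simp
  have hcu : Continuous u := continuous_iff_continuousAt.2 fun x => (hu x).continuousAt
  have hcr : Continuous r := continuous_iff_continuousAt.2 fun x => (hr x).continuousAt
  obtain ⟨η, hη'⟩ : ∃ η : C(Icc 0 ℓ, ℝ), ∀ x, η x = u x - a := ⟨⟨fun x => u x - a, by fun_prop⟩,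
    fun _ => rfl⟩
  obtain ⟨ρ, hρ⟩ : ∃ ρ : C(Icc 0 ℓ, ℝ), ∀ x, ρ x = r x := ⟨⟨fun x => r x, by fun_prop⟩,
    fun _ => rfl⟩
  obtain ⟨U, hU⟩ : ∃ U : C(Icc 0 ℓ, ℝ), ∀ x, U x = 3 * u x := ⟨⟨fun x => 3 * u x, by fun_prop⟩,
    fun _ => rfl⟩
  obtain ⟨q, hq⟩ : ∃ q : C(Icc 0 ℓ, ℝ), ∀ x, q x = b * (3 * u x ^ 2 - 1 - κ ^ 2) :=
    ⟨⟨fun x => b * (3 * u x ^ 2 - 1 - κ ^ 2), by fun_prop⟩, fun _ => rfl⟩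
  have hexp1 : ∀ x : Icc 0 ℓ, exp (-κ * x) ≤ 1 := fun x => exp_le_one_iff.2 (by
    have := mul_nonneg hκ.le x.2.1; linarith)
  have hηd : ∀ x, |η x| ≤ F * exp (-κ * x) := fun x => by rw [hη']; exact hudecay x
  have hη1 : ‖η‖ ≤ F := (ContinuousMap.norm_le _ hF0.le).2 fun x => (hηd x).trans
    (mul_le_of_le_one_right hF0.le (hexp1 x))
  have hρ1 : ‖ρ‖ ≤ R * ε := (ContinuousMap.norm_le _ (by positivity)).2 fun x => by
    rw [hρ]; exact hrR x x.2.1 x.2.2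
  have hqd : ∀ (g : C(Icc 0 ℓ, ℝ)) (x : Icc 0 ℓ), |(q * g) x| ≤ Q * ‖g‖ * exp (-(κ / 2) * x) :=
    fun g x => by
      have h1 : exp (-(κ * x)) ≤ exp (-(κ / 2) * x) := by
        have := mul_nonneg hκ.le x.2.1
        gcongr; linarith
      have h2 : q x = b * κ ^ 2 * (pot a β (κ * x) - 1) := by rw [hq, ← hpot]; ring
      rw [ContinuousMap.mul_apply, abs_mul, h2, abs_mul, abs_of_pos (by positivity)]
      calc _ ≤ b * κ ^ 2 * (2 * (12 * a / β) * exp (-(κ / 2) * x)) * ‖g‖ := by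
            gcongr
            · exact (abs_pot_sub_one_le ha hβ hβa _).trans (by gcongr)
            · exact g.norm_coe_le_norm x
        _ = _ := by rw [hQ]; ring
  have hJd : ∀ (g : C(Icc 0 ℓ, ℝ)) (x : Icc 0 ℓ),
      |G (q * g) x| ≤ MG * Q * ‖g‖ * exp (-(κ / 2) * x) := fun g x =>
    (hGd _ _ (hqd g) x).trans_eq (by ring)
  obtain ⟨f, v, φ, w, hv, hφ, hw, hf, hvK, hφK, hwK⟩ := H ε hε hlt₁ G (G ∘ₗ LinearMap.mulLeft ℝ q)
    T₁ T₂ (η + ρ) ρ U (ContinuousMap.const _ (B₁ * a + C₁)) b B₁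
    (fun g => (hGM g).trans (by gcongr))
    (fun g => (ContinuousMap.norm_le _ (by positivity)).2 fun x => by
      refine (hJd g x).trans ?_
      calc _ ≤ MG * Q * ‖g‖ * 1 := by
            gcongr
            exact exp_le_one_iff.2 (by have := mul_nonneg hκ.le x.2.1; linarith)
        _ ≤ _ := by rw [mul_one]; gcongr)
    (fun g => (hT₁M g).trans (by gcongr)) (fun g => (hT₂M g).trans (by gcongr))
    (by
      rw [map_add]
      calc _ ≤ M₁ * ε * (F / κ) + M₁ * (R * ε) := (norm_add_le _ _).trans
            (add_le_add (hT₁d η F κ hκ hηd) ((hT₁M ρ).trans (by gcongr)))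
        _ = (M₁ * (F / κ) + M₁ * R) * ε := by ring
        _ ≤ _ := by gcongr)
    (by
      rw [map_add]
      calc _ ≤ M₂ * ε * (F / κ) + M₂ * (R * ε) := (norm_add_le _ _).trans
            (add_le_add (hT₂d η F κ hκ hηd) ((hT₂M ρ).trans (by gcongr)))
        _ = (M₂ * (F / κ) + M₂ * R) * ε := by ring
        _ ≤ _ := by gcongr)
    (fun g => by
      calc _ ≤ M₁ * ε * (MG * Q * ‖g‖ / (κ / 2)) := hT₁d _ _ _ (by positivity) (hJd g)
        _ = M₁ * (MG * Q / (κ / 2)) * ε * ‖g‖ := by ring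
        _ ≤ _ := by gcongr)
    ((norm_add_le _ _).trans ((add_le_add hη1 (hρ1.trans
      (mul_le_of_le_one_right hR0.le hlt₂.le))).trans hCe))
    (hρ1.trans (by gcongr))
    ((ContinuousMap.norm_le _ (by positivity)).2 fun x => by
      have h1 := (hudecay x).trans (mul_le_of_le_one_right hF0.le (hexp1 x))
      rw [hU, Real.norm_eq_abs, abs_mul, abs_of_pos (by norm_num : (0 : ℝ) < 3)]
      have h2 := abs_sub_abs_le_abs_sub (u x) a
      rw [abs_of_pos ha] at h2
      linarith)
    ((ContinuousMap.norm_le _ (by positivity)).2 fun x => by simpa using hCd)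
    (by rwa [abs_of_pos hb0]) hCB
  have hψ : G f - (G ∘ₗ LinearMap.mulLeft ℝ q) v = G (f - q * v) := by simp
  rw [hψ] at hv hφ
  obtain ⟨g₁, g₁', e₁, d₁, d₁', n₁, m₁⟩ := hG (f - q * v)
  obtain ⟨g₂, g₂', e₂, d₂, d₂', n₂, m₂⟩ := hT₁ (η + ρ + G (f - q * v))
  obtain ⟨g₃, g₃', e₃, d₃, d₃', n₃, m₃⟩ := hT₂ (η + ρ + φ)
  rw [← hv] at e₂
  rw [← hw] at e₃
  have c₁ : Continuous g₁ := continuous_iff_continuousAt.2 fun x => (d₁ x).continuousAt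
  have c₂ : Continuous g₂ := continuous_iff_continuousAt.2 fun x => (d₂ x).continuousAt
  have c₃ : Continuous g₃ := continuous_iff_continuousAt.2 fun x => (d₃ x).continuousAt
  simp only [hpot] at d₁' hr'
  refine ⟨_, _, _, _, _, _, _, _, _,
    ⟨fun x => (((hu x).add (d₁ x)).sub ((d₂ x).const_mul b)).add (hr x),
      fun x => (((hu' x).add (d₁' x)).sub ((d₂' x).const_mul b)).add (hr' x),
      by fun_prop, by simp [hu0, n₁, n₂, hr0], by simp [m₁, m₂, hrℓ]⟩,
    ⟨fun x => (d₂ x).const_add a, d₂', by fun_prop, n₂, m₂⟩,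
    ⟨fun x => (d₃ x).const_add a, d₃', by fun_prop, n₃, m₃⟩, fun x hx => ?_⟩
  have hvx : v ⟨x, hx⟩ = g₂ x := e₂ ⟨x, hx⟩
  have hwx : w ⟨x, hx⟩ = g₃ x := e₃ ⟨x, hx⟩
  have hGx : G (f - q * v) ⟨x, hx⟩ = g₁ x := e₁ ⟨x, hx⟩
  have hφx : φ ⟨x, hx⟩ = g₁ x - b * g₂ x := by rw [hφ, ← hGx, ← hvx]; rfl
  have hfx : f ⟨x, hx⟩ = b * ε ^ 2 * (g₂ x - (u x - a + r x) - (g₁ x - b * g₂ x)) +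
      ε * (B₁ * g₃ x + (B₁ * a + C₁)) + 3 * u x * (g₁ x - b * g₂ x + r x) ^ 2 +
      (g₁ x - b * g₂ x + r x) ^ 3 := by
    rw [← hφx, ← hvx, ← hwx, ← hη' ⟨x, hx⟩, ← hρ ⟨x, hx⟩, ← hU ⟨x, hx⟩]
    exact congrArg (fun k : C(Icc 0 ℓ, ℝ) => k ⟨x, hx⟩) hf
  have hvb : |g₂ x| ≤ K * ε := by rw [← hvx]; exact (v.norm_coe_le_norm ⟨x, hx⟩).trans hvK
  have hwb : |g₃ x| ≤ K * ε := by rw [← hwx]; exact (w.norm_coe_le_norm ⟨x, hx⟩).trans hwK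
  have hφb : |g₁ x - b * g₂ x| ≤ K * ε := by
    rw [← hφx]; exact (φ.norm_coe_le_norm ⟨x, hx⟩).trans hφK
  have hrb := hrR x hx.1 hx.2
  have hRε : 0 ≤ R * ε := by positivity
  have hs : √(1 + b) ^ 2 = 1 + b := sq_sqrt (by positivity)
  simp only [iccExtend_apply hℓ _ hx, Pi.add_apply, Pi.sub_apply, ContinuousMap.sub_apply,
    ContinuousMap.add_apply, ContinuousMap.mul_apply, hGx, hφx, hvx, hη', hρ, hq, hfx]
  refine ⟨?_, ?_, ?_, ?_, ?_, ?_⟩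
  · linear_combination (-b * ε ^ 2 * g₂ x) * hs + (g₂ x) * hbκ
  · linear_combination (ε ^ 2 * g₂ x) * hs
  · field_simp; ring
  · have h1 : u x + g₁ x - b * g₂ x + r x - u x = (g₁ x - b * g₂ x) + r x := by ring
    rw [h1]
    exact (abs_add_le _ _).trans (by linarith)
  · rw [add_sub_cancel_left]; linarith
  · rw [add_sub_cancel_left]; linarith

/-- Rescaling of the fast variable: even `2ℓ`-periodic extension composed with `x ↦ x / ε`. -/
lemma comp_fold_div_contDiff {ℓ ε : ℝ} (hℓ : 0 < ℓ) {f f' f'' : ℝ → ℝ}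
    (h : ∀ x, HasDerivAt f (f' x) x) (h' : ∀ x, HasDerivAt f' (f'' x) x) (hc : Continuous f'')
    (h0 : f' 0 = 0) (h1 : f' ℓ = 0) :
    ContDiff ℝ 2 (fun x => f (fold ℓ (ε⁻¹ * x))) ∧
      ∀ x, deriv (deriv fun x => f (fold ℓ (ε⁻¹ * x))) x =
        ε⁻¹ * (ε⁻¹ * f'' (fold ℓ (ε⁻¹ * x))) := by
  obtain ⟨hC, hd⟩ := comp_fold_contDiff hℓ h h' hc h0 h1
  refine ⟨hC.comp (contDiff_const.mul contDiff_id), fun x => ?_⟩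
  have e1 : (deriv fun x => f (fold ℓ (ε⁻¹ * x))) =
      fun x => ε⁻¹ * deriv (fun x => f (fold ℓ x)) (ε⁻¹ * x) :=
    funext fun y => deriv_comp_mul_left ε⁻¹ (fun x => f (fold ℓ x)) y
  rw [e1, deriv_const_mul_field, deriv_comp_mul_left ε⁻¹ (deriv fun x => f (fold ℓ x)) x, hd,
    smul_eq_mul]

lemma comp_fold_div_periodic {L ε : ℝ} (hL : 0 < L) (hε : 0 < ε) (f : ℝ → ℝ) :
    Function.Periodic (fun x => f (fold (L / ε) (ε⁻¹ * x))) (2 * L) := fun x => by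
  have h := fold_periodic (div_pos hL hε) (ε⁻¹ * x)
  have e : ε⁻¹ * (x + 2 * L) = ε⁻¹ * x + 2 * (L / ε) := by field_simp
  simp only [e, h]

lemma exists_periodic_solution {D L A : ℝ} (B₁ C₁ : ℝ) (hD : 0 < D) (hL : 0 < L) (hA0 : 0 < A)
    (hA : A < 2 / 3) {u_h : ℝ → ℝ} (hC2 : ContDiff ℝ 2 u_h)
    (heven : ∀ ξ, u_h (-ξ) = u_h ξ) (hnonconst : ¬ ∃ c, ∀ ξ, u_h ξ = c)
    (hode : ∀ ξ, deriv (deriv u_h) ξ + u_h ξ - (u_h ξ) ^ 3 - A * Real.sqrt (1 - A) = 0)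
    (hlimtop : Tendsto u_h atTop (nhds (Real.sqrt (1 - A))))
    (hlimbot : Tendsto u_h atBot (nhds (Real.sqrt (1 - A))))
    (hlimtop' : Tendsto (deriv u_h) atTop (nhds 0)) :
    ∃ ε₀ > (0 : ℝ), ∃ K > (0 : ℝ), ∀ ε : ℝ, 0 < ε → ε < ε₀ →
      ∃ u v w : ℝ → ℝ,
        IsStatSol ε A (ε * B₁) (ε * C₁) D u v w ∧
        Function.Periodic u (2 * L) ∧ Function.Periodic v (2 * L) ∧
        Function.Periodic w (2 * L) ∧
        (∀ x, |v x - Real.sqrt (1 - A)| ≤ K * ε) ∧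
        (∀ x, |w x - Real.sqrt (1 - A)| ≤ K * ε) ∧
        (∀ ξ, |ξ| ≤ L / ε → |u (ε * ξ) - u_h ξ| ≤ K * ε) := by
  set a := √(1 - A)
  have ha : 0 < a := Real.sqrt_pos.2 (by linarith)
  have ha2 : a ^ 2 = 1 - A := Real.sq_sqrt (by linarith)
  obtain ⟨β, hβ, hβ2⟩ : ∃ β > 0, β ^ 2 = A / 2 :=
    ⟨√(A / 2), Real.sqrt_pos.2 (by linarith), Real.sq_sqrt (by linarith)⟩
  obtain ⟨κ, hκ, hκ2⟩ : ∃ κ > 0, κ ^ 2 = 2 - 3 * A :=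
    ⟨√(2 - 3 * A), Real.sqrt_pos.2 (by linarith), Real.sq_sqrt (by linarith)⟩
  have hβa : β < a := lt_of_pow_lt_pow_left₀ 2 ha.le (by linarith)
  have hm : κ ^ 2 = 2 * (a ^ 2 - β ^ 2) := by linarith
  have hu : ∀ x, HasDerivAt u_h (deriv u_h x) x := fun x =>
    (hC2.differentiable (by norm_num) x).hasDerivAt
  have hu' : ∀ x, HasDerivAt (deriv u_h) (u_h x ^ 3 - u_h x + 2 * β ^ 2 * a) x := fun x => by
    have hd : ContDiff ℝ 1 (deriv u_h) := ((contDiff_succ_iff_deriv (n := 1)).1 hC2).2.2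
    refine (hd.differentiable one_ne_zero x).hasDerivAt.congr_deriv ?_
    linear_combination hode x - 2 * a * hβ2
  have hu0 : deriv u_h 0 = 0 := by
    have h1 : HasDerivAt (fun x => u_h (-x)) (-deriv u_h 0) 0 := by
      have := (hu (-0)).comp (0 : ℝ) (hasDerivAt_neg (0 : ℝ))
      simpa [Function.comp_def] using this
    have h2 : -deriv u_h 0 = deriv u_h 0 := by
      rw [funext heven] at h1
      exact h1.unique (hu 0)
    linarith
  have hη : ∀ x, u_h x = a - κ ^ 2 / den a β (κ * x) := fun x => by
    have := homoclinic_eq (η := fun x => u_h x - a) hβ hβa hκ hm (fun x => (hu x).sub_const a)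
      (fun x => (hu' x).congr_deriv (by
        linear_combination 2 * a * hβ2 + (3 * u_h x - 2 * a) * ha2 + (a - u_h x) * hκ2)) hu0
      (by by_contra! hc; exact hnonconst ⟨a, fun x => by linarith [hc x]⟩)
      (by simpa using hlimtop.sub_const a) (by simpa using hlimbot.sub_const a) hlimtop' x
    rw [den]
    linear_combination this
  obtain ⟨ε₀, hε₀, K, hK, H⟩ := exists_half_period ha hβ hβa hκ (by linarith) hm hD hL hu hu' hu0
    hη B₁ C₁
  refine ⟨ε₀, hε₀, K, hK, fun ε hε hεlt => ?_⟩
  obtain ⟨p, p', p'', v, v', v'', w, w', w'', ⟨hp, hp', hpc, hp0, hp1⟩, ⟨hv, hv', hvc, hv0, hv1⟩,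
    ⟨hw, hw', hwc, hw0, hw1⟩, Hx⟩ := H ε hε hεlt
  have hℓ : 0 < L / ε := div_pos hL hε
  obtain ⟨hpC, hpd⟩ := comp_fold_div_contDiff (ε := ε) hℓ hp hp' hpc hp0 hp1
  obtain ⟨hvC, hvd⟩ := comp_fold_div_contDiff (ε := ε) hℓ hv hv' hvc hv0 hv1
  obtain ⟨hwC, hwd⟩ := comp_fold_div_contDiff (ε := ε) hℓ hw hw' hwc hw0 hw1
  have hscale : ∀ z : ℝ, ε ^ 2 * (ε⁻¹ * (ε⁻¹ * z)) = z := fun z => by field_simp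
  have hscale' : ∀ z : ℝ, ε⁻¹ * (ε⁻¹ * (ε ^ 2 * z)) = z := fun z => by field_simp
  refine ⟨_, _, _, ⟨hpC, hvC, hwC, fun x => ?_, fun x => ?_, fun x => ?_⟩,
    comp_fold_div_periodic hL hε p, comp_fold_div_periodic hL hε v,
    comp_fold_div_periodic hL hε w, fun x => ?_, fun x => ?_, fun ξ hξ => ?_⟩
  · rw [hpd, hscale, (Hx _ (fold_mem hℓ _)).1]
    linear_combination 2 * v (fold (L / ε) (ε⁻¹ * x)) * hβ2
  · rw [hvd, (Hx _ (fold_mem hℓ _)).2.1, hscale']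
    ring
  · have h := (Hx _ (fold_mem hℓ (ε⁻¹ * x))).2.2.1
    rw [hwd]
    have e : D ^ 2 * (ε⁻¹ * (ε⁻¹ * w'' (fold (L / ε) (ε⁻¹ * x)))) =
        ε⁻¹ * (ε⁻¹ * (D ^ 2 * w'' (fold (L / ε) (ε⁻¹ * x)))) := by ring
    rw [e, h, hscale']
    ring
  · exact (Hx _ (fold_mem hℓ _)).2.2.2.2.1
  · exact (Hx _ (fold_mem hℓ _)).2.2.2.2.2
  · have e : ε⁻¹ * (ε * ξ) = ξ := by field_simp
    have h := (Hx _ (fold_mem hℓ ξ)).2.2.2.1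
    simp only [e]
    have e2 : u_h (fold (L / ε) ξ) = u_h ξ := by
      rw [fold_of_abs_le hℓ hξ]
      rcases abs_cases ξ with h | h <;> rw [h.1]
      exact heven ξ
    rwa [e2] at h

lemma IsStatSol.neg {ε A B C D : ℝ} {u v w : ℝ → ℝ} (h : IsStatSol ε A B C D u v w) :
    IsStatSol ε A B (-C) D (-u) (-v) (-w) := by
  obtain ⟨hu, hv, hw, h1, h2, h3⟩ := h
  have hd : ∀ f : ℝ → ℝ, ∀ x, deriv (deriv (-f)) x = -deriv (deriv f) x := fun f x => by
    rw [deriv.neg', deriv.fun_neg]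
  refine ⟨hu.neg, hv.neg, hw.neg, fun x => ?_, fun x => ?_, fun x => ?_⟩ <;>
    simp only [hd, Pi.neg_apply]
  · linear_combination -h1 x
  · linear_combination -h2 x
  · linear_combination -h3 x

/-- Theorem 1 of the paper: existence of a `2L`-periodic solution with one fast transition,
for `A ∈ (0, 2/3)` and `B = εB₁`, `C = εC₁`, together with the analogous statement with
`√(1−A)` and `u_h` replaced by their negatives. -/
theorem one_fast_transition_periodic_solution
    (D L A B₁ C₁ : ℝ) (hD : 0 < D) (hL : 0 < L) (hA0 : 0 < A) (hA : A < 2 / 3)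
    (u_h : ℝ → ℝ) (hC2 : ContDiff ℝ 2 u_h)
    (heven : ∀ ξ, u_h (-ξ) = u_h ξ)
    (hnonconst : ¬ ∃ c, ∀ ξ, u_h ξ = c)
    (hode : ∀ ξ, deriv (deriv u_h) ξ + u_h ξ - (u_h ξ) ^ 3 - A * Real.sqrt (1 - A) = 0)
    (hlimtop : Tendsto u_h atTop (nhds (Real.sqrt (1 - A))))
    (hlimbot : Tendsto u_h atBot (nhds (Real.sqrt (1 - A))))
    (hlimtop' : Tendsto (deriv u_h) atTop (nhds 0))
    (hlimbot' : Tendsto (deriv u_h) atBot (nhds 0)) :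
    ∃ ε₀ > (0 : ℝ), ∃ K > (0 : ℝ), ∀ ε : ℝ, 0 < ε → ε < ε₀ →
      ((∃ u v w : ℝ → ℝ,
          IsStatSol ε A (ε * B₁) (ε * C₁) D u v w ∧
          Function.Periodic u (2 * L) ∧ Function.Periodic v (2 * L) ∧
          Function.Periodic w (2 * L) ∧
          (∀ x, |v x - Real.sqrt (1 - A)| ≤ K * ε) ∧
          (∀ x, |w x - Real.sqrt (1 - A)| ≤ K * ε) ∧
          (∀ ξ, |ξ| ≤ L / ε → |u (ε * ξ) - u_h ξ| ≤ K * ε)) ∧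
       (∃ u v w : ℝ → ℝ,
          IsStatSol ε A (ε * B₁) (ε * C₁) D u v w ∧
          Function.Periodic u (2 * L) ∧ Function.Periodic v (2 * L) ∧
          Function.Periodic w (2 * L) ∧
          (∀ x, |v x - (-Real.sqrt (1 - A))| ≤ K * ε) ∧
          (∀ x, |w x - (-Real.sqrt (1 - A))| ≤ K * ε) ∧
          (∀ ξ, |ξ| ≤ L / ε → |u (ε * ξ) - (-u_h ξ)| ≤ K * ε))) := by
  obtain ⟨ε₁, hε₁, K₁, hK₁, H₁⟩ := exists_periodic_solution B₁ C₁ hD hL hA0 hA hC2 heven hnonconst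
    hode hlimtop hlimbot hlimtop'
  obtain ⟨ε₂, hε₂, K₂, hK₂, H₂⟩ := exists_periodic_solution B₁ (-C₁) hD hL hA0 hA hC2 heven
    hnonconst hode hlimtop hlimbot hlimtop'
  refine ⟨min ε₁ ε₂, lt_min hε₁ hε₂, max K₁ K₂, lt_max_of_lt_left hK₁, fun ε hε hlt => ⟨?_, ?_⟩⟩
  · obtain ⟨u, v, w, hs, hu, hv, hw, bv, bw, bu⟩ := H₁ ε hε (hlt.trans_le (min_le_left _ _))
    have hK : K₁ * ε ≤ max K₁ K₂ * ε := by gcongr; exact le_max_left _ _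
    exact ⟨u, v, w, hs, hu, hv, hw, fun x => (bv x).trans hK, fun x => (bw x).trans hK,
      fun ξ hξ => (bu ξ hξ).trans hK⟩
  · obtain ⟨u, v, w, hs, hu, hv, hw, bv, bw, bu⟩ := H₂ ε hε (hlt.trans_le (min_le_right _ _))
    have hK : K₂ * ε ≤ max K₁ K₂ * ε := by gcongr; exact le_max_right _ _
    have habs : ∀ y z : ℝ, |-y - -z| = |y - z| := fun y z => by
      rw [← neg_sub', abs_neg]
    refine ⟨-u, -v, -w, ?_, fun x => congrArg Neg.neg (hu x), fun x => congrArg Neg.neg (hv x),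
      fun x => congrArg Neg.neg (hw x), fun x => ?_, fun x => ?_, fun ξ hξ => ?_⟩
    · simpa using hs.neg
    · exact (habs _ _).trans_le ((bv x).trans hK)
    · exact (habs _ _).trans_le ((bw x).trans hK)
    · exact (habs _ _).trans_le ((bu ξ hξ).trans hK)
end

section
/- Let ε, A, B, C ∈ ℝ and D ≠ 0. If (u, p, v, q, w, r) : ℝ → ℝ⁶ is differentiable and satisfies u' = p, p' = −u + u³ + Av + Bw + C, v' = εq, q' = ε(v − u), w' = εr/D, r' = (ε/D)(w − u) on ℝ, then the Hamiltonian H = p²/2 − u⁴/4 + u²/2 − (Aq²/2 + Br²/2 − Av²/2 − Bw²/2 + (Av + Bw + C)u) is constant along the solution, i.e. ξ ↦ H(u(ξ), p(ξ), v(ξ), q(ξ), w(ξ), r(ξ)) is a constant function. -/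
open Real

/-- The Hamiltonian
`H = p²/2 − u⁴/4 + u²/2 − (Aq²/2 + Br²/2 − Av²/2 − Bw²/2 + (Av + Bw + C)u)`
is constant along solutions of the fast first-order system
`u' = p, p' = −u + u³ + Av + Bw + C, v' = εq, q' = ε(v − u), w' = εr/D, r' = (ε/D)(w − u)`. -/
theorem hamiltonian_conserved (ε A B C D : ℝ) (hD : D ≠ 0) (u p v q w r : ℝ → ℝ)
    (hu : Differentiable ℝ u) (hp : Differentiable ℝ p) (hv : Differentiable ℝ v)
    (hq : Differentiable ℝ q) (hw : Differentiable ℝ w) (hr : Differentiable ℝ r)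
    (h1 : ∀ ξ, deriv u ξ = p ξ)
    (h2 : ∀ ξ, deriv p ξ = -u ξ + (u ξ) ^ 3 + A * v ξ + B * w ξ + C)
    (h3 : ∀ ξ, deriv v ξ = ε * q ξ)
    (h4 : ∀ ξ, deriv q ξ = ε * (v ξ - u ξ))
    (h5 : ∀ ξ, deriv w ξ = ε * r ξ / D)
    (h6 : ∀ ξ, deriv r ξ = ε / D * (w ξ - u ξ)) :
    ∃ c : ℝ, ∀ ξ,
      (p ξ) ^ 2 / 2 - (u ξ) ^ 4 / 4 + (u ξ) ^ 2 / 2 -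
        (A * (q ξ) ^ 2 / 2 + B * (r ξ) ^ 2 / 2 - A * (v ξ) ^ 2 / 2 - B * (w ξ) ^ 2 / 2 +
          (A * v ξ + B * w ξ + C) * u ξ) = c := by
  have hH (ξ : ℝ) := ((((((hp ξ).hasDerivAt.pow 2).div_const 2).sub
    (((hu ξ).hasDerivAt.pow 4).div_const 4)).add (((hu ξ).hasDerivAt.pow 2).div_const 2)).sub
    (((((((hq ξ).hasDerivAt.pow 2).const_mul A).div_const 2).add
      ((((hr ξ).hasDerivAt.pow 2).const_mul B).div_const 2)).sub
      ((((hv ξ).hasDerivAt.pow 2).const_mul A).div_const 2)).sub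
      ((((hw ξ).hasDerivAt.pow 2).const_mul B).div_const 2) |>.add
      (((((hv ξ).hasDerivAt.const_mul A).add ((hw ξ).hasDerivAt.const_mul B)).add_const C).mul
        (hu ξ).hasDerivAt)))
  refine ⟨_, fun ξ => is_const_of_deriv_eq_zero (fun x => (hH x).differentiableAt)
    (fun x => (hH x).deriv.trans ?_) ξ 0⟩
  simp only [h1, h2, h3, h4, h5, h6, Pi.add_apply]
  field_simp
  ring
end

section
/- Let 0 < A₀ < 2/3, set K = A₀√(1 − A₀) and define the fast potential V_f(u) = −u⁴/4 + u²/2 − Ku. Then the value u_ext = √(2A₀) − √(1 − A₀) satisfies −1 < u_ext < 1/√3 and V_f(u_ext) = V_f(√(1 − A₀)). Moreover u_ext → −1 as A₀ → 0⁺ and u_ext → 1/√3 as A₀ → (2/3)⁻. -/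
open Real Filter Set

/-- The value at `a = 2/3` of the extremal point `√(2a) − √(1−a)`. -/
lemma sqrt_two_mul_sub_sqrt_one_sub_two_thirds :
    Real.sqrt (2 * (2 / 3)) - Real.sqrt (1 - 2 / 3) = 1 / Real.sqrt 3 := by
  have h4 : Real.sqrt 4 = 2 := by
    rw [show (4 : ℝ) = 2 ^ 2 by norm_num, Real.sqrt_sq (by norm_num)]
  rw [show (2 * (2 / 3) : ℝ) = 4 / 3 by norm_num, show (1 - 2 / 3 : ℝ) = 1 / 3 by norm_num,
    Real.sqrt_div' _ (by norm_num), Real.sqrt_div' _ (by norm_num), h4, Real.sqrt_one]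
  ring

/-- For `0 < A₀ < 2/3` and `K = A₀√(1−A₀)`, the extremal point
`u_ext = √(2A₀) − √(1−A₀)` of the fast homoclinic orbit satisfies `−1 < u_ext < 1/√3` and
`V_f(u_ext) = V_f(√(1−A₀))` where `V_f(u) = −u⁴/4 + u²/2 − Ku`; moreover `u_ext → −1` as
`A₀ → 0⁺` and `u_ext → 1/√3` as `A₀ → (2/3)⁻`. -/
theorem extremal_point_of_fast_homoclinic (A₀ : ℝ) (h1 : 0 < A₀) (h2 : A₀ < 2 / 3) :
    (-1 < Real.sqrt (2 * A₀) - Real.sqrt (1 - A₀)) ∧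
    (Real.sqrt (2 * A₀) - Real.sqrt (1 - A₀) < 1 / Real.sqrt 3) ∧
    (-(Real.sqrt (2 * A₀) - Real.sqrt (1 - A₀)) ^ 4 / 4
        + (Real.sqrt (2 * A₀) - Real.sqrt (1 - A₀)) ^ 2 / 2
        - A₀ * Real.sqrt (1 - A₀) * (Real.sqrt (2 * A₀) - Real.sqrt (1 - A₀))
      = -(Real.sqrt (1 - A₀)) ^ 4 / 4 + (Real.sqrt (1 - A₀)) ^ 2 / 2
        - A₀ * Real.sqrt (1 - A₀) * Real.sqrt (1 - A₀)) ∧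
    Tendsto (fun a : ℝ => Real.sqrt (2 * a) - Real.sqrt (1 - a))
      (nhdsWithin 0 (Set.Ioi 0)) (nhds (-1)) ∧
    Tendsto (fun a : ℝ => Real.sqrt (2 * a) - Real.sqrt (1 - a))
      (nhdsWithin (2 / 3) (Set.Iio (2 / 3))) (nhds (1 / Real.sqrt 3)) := by
  have hcont : Continuous fun a : ℝ => Real.sqrt (2 * a) - Real.sqrt (1 - a) := by fun_prop
  refine ⟨?_, ?_, ?_, ?_, ?_⟩
  · have hs : 0 < Real.sqrt (2 * A₀) := Real.sqrt_pos.2 (by linarith)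
    have hc : Real.sqrt (1 - A₀) ≤ 1 := Real.sqrt_le_one.2 (by linarith)
    linarith
  · rw [← sqrt_two_mul_sub_sqrt_one_sub_two_thirds]
    exact sub_lt_sub (Real.sqrt_lt_sqrt (by linarith) (by linarith))
      (Real.sqrt_lt_sqrt (by norm_num) (by linarith))
  · have hs : Real.sqrt (2 * A₀) ^ 2 = 2 * A₀ := Real.sq_sqrt (by linarith)
    have hc : Real.sqrt (1 - A₀) ^ 2 = 1 - A₀ := Real.sq_sqrt (by linarith)
    generalize Real.sqrt (2 * A₀) = s at *
    generalize Real.sqrt (1 - A₀) = c at *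
    linear_combination (-(s - 2 * c) ^ 2 / 4) * hs
      + (-(s - 2 * c) ^ 2 / 2 - c * (s - 2 * c)) * hc
  · exact (hcont.tendsto' 0 (-1) (by simp)).mono_left nhdsWithin_le_nhds
  · exact (hcont.tendsto' (2 / 3) _ sqrt_two_mul_sub_sqrt_one_sub_two_thirds).mono_left
      nhdsWithin_le_nhds
end

section
/- Let 0 < A₀ < 2/3 and set K = A₀√(1 − A₀). Then there exists a nonconstant even twice continuously differentiable function u_h : ℝ → ℝ satisfying u_h''(ξ) = −u_h(ξ) + u_h(ξ)³ + K for all ξ ∈ ℝ, with u_h(ξ) → √(1 − A₀) and u_h'(ξ) → 0 as ξ → ±∞, and u_h(0) = √(2A₀) − √(1 − A₀). That is, the reduced fast system u' = p, p' = −u + u³ + K has an orbit homoclinic to the equilibrium (√(1 − A₀), 0). -/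
open Real Filter

/-- The explicit homoclinic profile `s - c² / (s + b cosh (c ξ))`. -/
noncomputable def homoclinicProfile (s b c ξ : ℝ) : ℝ :=
  s - c ^ 2 / (s + b * cosh (c * ξ))

section HomoclinicProfile

variable {s b c : ℝ}

lemma homoclinicProfile_denom_pos (hs : 0 < s) (hb : 0 < b) (ξ : ℝ) :
    0 < s + b * cosh (c * ξ) := by
  have := cosh_pos (c * ξ)
  positivity

lemma hasDerivAt_homoclinicProfile_denom (ξ : ℝ) :
    HasDerivAt (fun x => s + b * cosh (c * x)) (b * (sinh (c * ξ) * c)) ξ := by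
  have h : HasDerivAt (fun x => c * x) c ξ := by simpa using (hasDerivAt_id ξ).const_mul c
  exact (h.cosh.const_mul b).const_add s

lemma hasDerivAt_homoclinicProfile (hs : 0 < s) (hb : 0 < b) (ξ : ℝ) :
    HasDerivAt (homoclinicProfile s b c)
      (c ^ 3 * b * sinh (c * ξ) / (s + b * cosh (c * ξ)) ^ 2) ξ := by
  have hD := (homoclinicProfile_denom_pos (c := c) hs hb ξ).ne'
  have h := (((hasDerivAt_homoclinicProfile_denom (s := s) (b := b) (c := c) ξ).inv hD).const_mul
    (c ^ 2)).const_sub s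
  simp only [Pi.inv_apply, ← div_eq_mul_inv] at h
  refine h.congr_deriv ?_
  field_simp

lemma deriv_homoclinicProfile (hs : 0 < s) (hb : 0 < b) :
    deriv (homoclinicProfile s b c) =
      fun ξ => c ^ 3 * b * sinh (c * ξ) / (s + b * cosh (c * ξ)) ^ 2 :=
  funext fun ξ => (hasDerivAt_homoclinicProfile hs hb ξ).deriv

lemma contDiff_homoclinicProfile (hs : 0 < s) (hb : 0 < b) {n : WithTop ℕ∞} :
    ContDiff ℝ n (homoclinicProfile s b c) := by
  have h : ContDiff ℝ n fun ξ => s + b * cosh (c * ξ) :=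
    contDiff_const.add (contDiff_const.mul (contDiff_cosh.comp (contDiff_const.mul contDiff_id)))
  exact contDiff_const.sub
    (contDiff_const.div h fun ξ => (homoclinicProfile_denom_pos hs hb ξ).ne')

lemma homoclinicProfile_neg (ξ : ℝ) :
    homoclinicProfile s b c (-ξ) = homoclinicProfile s b c ξ := by
  simp [homoclinicProfile]

lemma deriv_deriv_homoclinicProfile (hs : 0 < s) (hb : 0 < b)
    (hc : c ^ 2 = 2 * (s ^ 2 - b ^ 2)) (ξ : ℝ) :
    deriv (deriv (homoclinicProfile s b c)) ξ =
      c ^ 2 * (homoclinicProfile s b c ξ - s) + 3 * s * (homoclinicProfile s b c ξ - s) ^ 2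
        + (homoclinicProfile s b c ξ - s) ^ 3 := by
  have hD := (homoclinicProfile_denom_pos (c := c) hs hb ξ).ne'
  have hlin : HasDerivAt (fun x => c * x) c ξ := by simpa using (hasDerivAt_id ξ).const_mul c
  have h := (hlin.sinh.const_mul (c ^ 3 * b)).fun_div
    ((hasDerivAt_homoclinicProfile_denom (s := s) (b := b) (c := c) ξ).fun_pow 2) (pow_ne_zero 2 hD)
  rw [deriv_homoclinicProfile hs hb, h.deriv]
  have hsq := cosh_sq (c * ξ)
  unfold homoclinicProfile
  generalize cosh (c * ξ) = C at *
  generalize sinh (c * ξ) = S at *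
  have hS : S ^ 2 = C ^ 2 - 1 := by linarith
  have key : b * C * (s + b * C) - 2 * b ^ 2 * S ^ 2 =
      -(s + b * C) ^ 2 + 3 * s * (s + b * C) - c ^ 2 := by
    linear_combination hc - 2 * b ^ 2 * hS
  generalize s + b * C = D at *
  trans c ^ 4 * (b * C * D - 2 * b ^ 2 * S ^ 2) / D ^ 3
  · field_simp
    push_cast
    ring
  · rw [key]
    field_simp
    ring

lemma tendsto_homoclinicProfile_denom (hb : 0 < b) (hc : 0 < c) :
    Tendsto (fun ξ => s + b * cosh (c * ξ)) atTop atTop := by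
  have hcosh : Tendsto cosh atTop atTop := by
    refine tendsto_atTop_mono (fun x => ?_) (tendsto_exp_atTop.atTop_div_const two_pos)
    rw [cosh_eq]
    have := exp_pos (-x)
    linarith
  exact tendsto_atTop_add_const_left _ _
    ((hcosh.comp (tendsto_id.const_mul_atTop hc)).const_mul_atTop hb)

lemma tendsto_homoclinicProfile_atTop (hb : 0 < b) (hc : 0 < c) :
    Tendsto (homoclinicProfile s b c) atTop (nhds s) := by
  unfold homoclinicProfile
  simpa using
    ((tendsto_homoclinicProfile_denom hb hc).const_div_atTop (c ^ 2)).const_sub s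

lemma tendsto_deriv_homoclinicProfile_atTop (hs : 0 < s) (hb : 0 < b) (hc : 0 < c) :
    Tendsto (deriv (homoclinicProfile s b c)) atTop (nhds 0) := by
  rw [deriv_homoclinicProfile hs hb]
  refine squeeze_zero_norm (fun ξ => ?_)
    ((tendsto_homoclinicProfile_denom (s := s) hb hc).const_div_atTop (c ^ 3))
  have hD := homoclinicProfile_denom_pos (c := c) hs hb ξ
  have hS : |sinh (c * ξ)| ≤ cosh (c * ξ) :=
    abs_le_of_sq_le_sq (by rw [cosh_sq]; linarith) (cosh_pos _).le
  rw [norm_eq_abs, abs_div, abs_mul, abs_of_pos (pow_pos hD 2),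
    abs_of_pos (by positivity : 0 < c ^ 3 * b), div_le_div_iff₀ (pow_pos hD 2) hD]
  have hbS : b * |sinh (c * ξ)| ≤ s + b * cosh (c * ξ) := by nlinarith
  calc c ^ 3 * b * |sinh (c * ξ)| * (s + b * cosh (c * ξ))
      = c ^ 3 * (b * |sinh (c * ξ)| * (s + b * cosh (c * ξ))) := by ring
    _ ≤ c ^ 3 * ((s + b * cosh (c * ξ)) * (s + b * cosh (c * ξ))) := by gcongr
    _ = c ^ 3 * (s + b * cosh (c * ξ)) ^ 2 := by ring

lemma tendsto_homoclinicProfile_atBot (hb : 0 < b) (hc : 0 < c) :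
    Tendsto (homoclinicProfile s b c) atBot (nhds s) :=
  ((tendsto_homoclinicProfile_atTop hb hc).comp tendsto_neg_atBot_atTop).congr
    homoclinicProfile_neg

lemma tendsto_deriv_homoclinicProfile_atBot (hs : 0 < s) (hb : 0 < b) (hc : 0 < c) :
    Tendsto (deriv (homoclinicProfile s b c)) atBot (nhds 0) := by
  have h := ((tendsto_deriv_homoclinicProfile_atTop hs hb hc).comp tendsto_neg_atBot_atTop).neg
  rw [neg_zero] at h
  refine h.congr fun ξ => ?_
  simp [deriv_homoclinicProfile hs hb, neg_div]

lemma homoclinicProfile_zero (hs : 0 < s) (hb : 0 < b) (hc : c ^ 2 = 2 * (s ^ 2 - b ^ 2)) :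
    homoclinicProfile s b c 0 = 2 * b - s := by
  have : s + b ≠ 0 := by positivity
  simp only [homoclinicProfile, mul_zero, cosh_zero, mul_one, hc]
  field_simp
  ring

end HomoclinicProfile

/-- For `0 < A₀ < 2/3` and `K = A₀√(1−A₀)`, the reduced fast system `u' = p, p' = −u + u³ + K`
has an orbit homoclinic to the equilibrium `(√(1−A₀), 0)`: there is a nonconstant even `C²`
solution `u_h` of `u_h″ = −u_h + u_h³ + K` with `u_h → √(1−A₀)`, `u_h' → 0` at `±∞` and
`u_h(0) = √(2A₀) − √(1−A₀)`. -/
theorem fast_homoclinic_exists (A₀ : ℝ) (h1 : 0 < A₀) (h2 : A₀ < 2 / 3) :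
    ∃ u_h : ℝ → ℝ, ContDiff ℝ 2 u_h ∧
      (¬ ∃ c, ∀ ξ, u_h ξ = c) ∧
      (∀ ξ, u_h (-ξ) = u_h ξ) ∧
      (∀ ξ, deriv (deriv u_h) ξ = -u_h ξ + (u_h ξ) ^ 3 + A₀ * Real.sqrt (1 - A₀)) ∧
      Tendsto u_h atTop (nhds (Real.sqrt (1 - A₀))) ∧
      Tendsto u_h atBot (nhds (Real.sqrt (1 - A₀))) ∧
      Tendsto (deriv u_h) atTop (nhds 0) ∧
      Tendsto (deriv u_h) atBot (nhds 0) ∧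
      u_h 0 = Real.sqrt (2 * A₀) - Real.sqrt (1 - A₀) := by
  have hs : 0 < √(1 - A₀) := sqrt_pos.2 (by linarith)
  have hb : 0 < √(A₀ / 2) := sqrt_pos.2 (by linarith)
  have hc : 0 < √(2 - 3 * A₀) := sqrt_pos.2 (by linarith)
  have hs2 : √(1 - A₀) ^ 2 = 1 - A₀ := sq_sqrt (by linarith)
  have hc2 : √(2 - 3 * A₀) ^ 2 = 2 - 3 * A₀ := sq_sqrt (by linarith)
  have hb2 : √(A₀ / 2) ^ 2 = A₀ / 2 := sq_sqrt (by linarith)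
  have hrel : √(2 - 3 * A₀) ^ 2 = 2 * (√(1 - A₀) ^ 2 - √(A₀ / 2) ^ 2) := by
    rw [hs2, hc2, hb2]; ring
  have hb' : √(2 * A₀) = 2 * √(A₀ / 2) := by
    rw [sqrt_eq_iff_mul_self_eq (by linarith) (by positivity)]
    linarith
  have htop := tendsto_homoclinicProfile_atTop (s := √(1 - A₀)) hb hc
  refine ⟨homoclinicProfile √(1 - A₀) √(A₀ / 2) √(2 - 3 * A₀), contDiff_homoclinicProfile hs hb,
    ?_, homoclinicProfile_neg, fun ξ => ?_, htop, tendsto_homoclinicProfile_atBot hb hc,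
    tendsto_deriv_homoclinicProfile_atTop hs hb hc,
    tendsto_deriv_homoclinicProfile_atBot hs hb hc, ?_⟩
  · rintro ⟨k, hk⟩
    have hlim : k = √(1 - A₀) :=
      tendsto_nhds_unique (tendsto_const_nhds.congr fun ξ => (hk ξ).symm) htop
    have h0 := hk 0
    rw [homoclinicProfile_zero hs hb hrel] at h0
    nlinarith
  · rw [deriv_deriv_homoclinicProfile hs hb hrel, hc2]
    generalize homoclinicProfile √(1 - A₀) √(A₀ / 2) √(2 - 3 * A₀) ξ = u
    linear_combination (-3 * u + 2 * √(1 - A₀)) * hs2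
  · rw [homoclinicProfile_zero hs hb hrel, hb']
end

section
/- Let D > 1, L > 0 and A₁, B₁ ∈ ℝ with (A₁, B₁) ≠ (0, 0), and let M(z) = A₁ sinh(z)/sinh(L) + B₁ sinh(z/D)/sinh(L/D). Then M is odd with M(L) = −M(−L) = A₁ + B₁, and the derivative M' has a zero in [−L, L] if and only if min(−D̃A₁, −D̂A₁) ≤ B₁ ≤ max(−D̃A₁, −D̂A₁). In that case the set of zeros of M' in [−L, L] is exactly {−z₀, z₀} for a unique z₀ ∈ [0, L], with z₀ = 0 if and only if B₁ = −D̃A₁ and z₀ = L if and only if B₁ = −D̂A₁; otherwise M' has no zero in [−L, L] and M is strictly monotone on [−L, L]. -/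
open Real Set

/-- The Melnikov function `M(z) = A₁ sinh(z)/sinh(L) + B₁ sinh(z/D)/sinh(L/D)`. -/
noncomputable def Mel (A₁ B₁ D L z : ℝ) : ℝ :=
  A₁ * Real.sinh z / Real.sinh L + B₁ * Real.sinh (z / D) / Real.sinh (L / D)

/-- `D̃ = D sinh(L/D)/sinh(L)`. -/
noncomputable def Dtil (D L : ℝ) : ℝ := D * Real.sinh (L / D) / Real.sinh L

/-- `D̂ = D tanh(L/D)/tanh(L)`. -/
noncomputable def Dhat (D L : ℝ) : ℝ := D * Real.tanh (L / D) / Real.tanh L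

/-- The quotient of hyperbolic cosines that governs the zeros of the derivative of `Mel`. -/
noncomputable def coshRatio (D z : ℝ) : ℝ := Real.cosh z / Real.cosh (z / D)

theorem coshRatio_neg (D z : ℝ) : coshRatio D (-z) = coshRatio D z := by
  simp [coshRatio, neg_div]

theorem coshRatio_abs (D z : ℝ) : coshRatio D |z| = coshRatio D z := by
  rcases abs_choice z with h | h <;> rw [h]
  exact coshRatio_neg D z

theorem coshRatio_zero (D : ℝ) : coshRatio D 0 = 1 := by
  simp [coshRatio]

theorem continuous_coshRatio (D : ℝ) : Continuous (coshRatio D) := by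
  unfold coshRatio
  exact Real.continuous_cosh.div (Real.continuous_cosh.comp (continuous_id.div_const D))
    fun z => (Real.cosh_pos _).ne'

theorem strictMonoOn_coshRatio {D : ℝ} (hD : 1 < D) : StrictMonoOn (coshRatio D) (Set.Ici 0) := by
  intro x hx y _ hxy
  have hx0 : 0 ≤ x := hx
  have hD1 : D⁻¹ < 1 := inv_lt_one_of_one_lt₀ hD
  have hD0 : 0 < D⁻¹ := by positivity
  unfold coshRatio
  rw [div_lt_div_iff₀ (Real.cosh_pos _) (Real.cosh_pos _)]
  have h1 : Real.cosh (x + y / D) < Real.cosh (y + x / D) := by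
    have h : x + y / D < y + x / D := by
      simp only [div_eq_mul_inv]
      nlinarith
    have h' : 0 ≤ x + y / D := by
      have : 0 ≤ y / D := by
        rw [div_eq_mul_inv]
        nlinarith
      linarith
    rwa [Real.cosh_lt_cosh, abs_of_nonneg h', abs_of_pos (h'.trans_lt h)]
  have h2 : Real.cosh (x - y / D) < Real.cosh (y - x / D) := by
    rw [Real.cosh_lt_cosh]
    refine lt_of_lt_of_le ?_ (le_abs_self _)
    rw [abs_lt]
    simp only [div_eq_mul_inv]
    constructor <;> nlinarith
  rw [Real.cosh_add, Real.cosh_add] at h1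
  rw [Real.cosh_sub, Real.cosh_sub] at h2
  linarith

theorem Dhat_eq_Dtil_mul_coshRatio (D L : ℝ) : Dhat D L = Dtil D L * coshRatio D L := by
  unfold Dhat Dtil coshRatio
  rw [Real.tanh_eq_sinh_div_cosh, Real.tanh_eq_sinh_div_cosh]
  simp only [div_eq_mul_inv, mul_inv, inv_inv]
  ring

theorem hasDerivAt_Mel {D L : ℝ} (hD : 0 < D) (hL : 0 < L) (A B z : ℝ) :
    HasDerivAt (Mel A B D L)
      (Real.cosh (z / D) / (D * Real.sinh (L / D)) *
        (B - -(Dtil D L) * A * coshRatio D z)) z := by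
  have hs : Real.sinh L ≠ 0 := (Real.sinh_pos_iff.2 hL).ne'
  have hsD : Real.sinh (L / D) ≠ 0 := (Real.sinh_pos_iff.2 (div_pos hL hD)).ne'
  have hc : Real.cosh (z / D) ≠ 0 := (Real.cosh_pos _).ne'
  have h1 := ((Real.hasDerivAt_sinh z).const_mul A).div_const (Real.sinh L)
  have h2 := ((((hasDerivAt_id z).div_const D).sinh).const_mul B).div_const (Real.sinh (L / D))
  refine (h1.add h2).congr_deriv ?_
  simp only [id, Dtil, coshRatio]
  field_simp
  ring

/-- The scaled ratio attains exactly the values between its values at the endpoints. -/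
theorem mem_uIcc_iff_exists_mul_coshRatio {D L : ℝ} (hD : 1 < D) (hL : 0 ≤ L) (a b : ℝ) :
    b ∈ Set.uIcc a (a * coshRatio D L) ↔ ∃ z ∈ Set.Icc 0 L, b = a * coshRatio D z := by
  constructor
  · intro hb
    have h := intermediate_value_uIcc (a := 0) (b := L) (f := fun z => a * coshRatio D z)
      (continuous_const.mul (continuous_coshRatio D)).continuousOn
    simp only [coshRatio_zero, mul_one] at h
    obtain ⟨z, hz, rfl⟩ := h hb
    rw [Set.uIcc_of_le hL] at hz
    exact ⟨z, hz, rfl⟩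
  · rintro ⟨z, hz, rfl⟩
    have hmono := (strictMonoOn_coshRatio hD).monotoneOn
    have h1 : 1 ≤ coshRatio D z := by
      simpa [coshRatio_zero] using hmono (Set.mem_Ici.2 le_rfl) hz.1 hz.1
    have h2 : coshRatio D z ≤ coshRatio D L := hmono hz.1 hL hz.2
    rcases le_total 0 a with ha | ha
    · exact Set.mem_uIcc_of_le (by nlinarith) (by nlinarith)
    · exact Set.mem_uIcc_of_ge (by nlinarith) (by nlinarith)

/-- Lemma C.1, items (1)-(2): `M` is odd with `M(±L) = ±(A₁+B₁)`; `M'` has a zero in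
`[−L,L]` iff `min(−D̃A₁, −D̂A₁) ≤ B₁ ≤ max(−D̃A₁, −D̂A₁)`, in which case the zeros of `M'` in
`[−L,L]` are exactly `{−z₀, z₀}` for a unique `z₀ ∈ [0,L]` (with `z₀ = 0` iff `B₁ = −D̃A₁`
and `z₀ = L` iff `B₁ = −D̂A₁`); otherwise `M'` has no zero in `[−L,L]` and `M` is strictly
monotone there. -/
theorem melnikov_monotonicity (D L A₁ B₁ : ℝ) (hD : 1 < D) (hL : 0 < L)
    (hAB : (A₁, B₁) ≠ (0, 0)) :
    (∀ z, Mel A₁ B₁ D L (-z) = -Mel A₁ B₁ D L z) ∧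
    Mel A₁ B₁ D L L = A₁ + B₁ ∧
    Mel A₁ B₁ D L (-L) = -(A₁ + B₁) ∧
    ((∃ z ∈ Set.Icc (-L) L, deriv (Mel A₁ B₁ D L) z = 0) ↔
      (min (-(Dtil D L) * A₁) (-(Dhat D L) * A₁) ≤ B₁ ∧
        B₁ ≤ max (-(Dtil D L) * A₁) (-(Dhat D L) * A₁))) ∧
    ((min (-(Dtil D L) * A₁) (-(Dhat D L) * A₁) ≤ B₁ ∧
        B₁ ≤ max (-(Dtil D L) * A₁) (-(Dhat D L) * A₁)) →
      ∃! z₀ : ℝ, z₀ ∈ Set.Icc 0 L ∧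
        {z | z ∈ Set.Icc (-L) L ∧ deriv (Mel A₁ B₁ D L) z = 0} = {-z₀, z₀} ∧
        (z₀ = 0 ↔ B₁ = -(Dtil D L) * A₁) ∧
        (z₀ = L ↔ B₁ = -(Dhat D L) * A₁)) ∧
    (¬ (min (-(Dtil D L) * A₁) (-(Dhat D L) * A₁) ≤ B₁ ∧
        B₁ ≤ max (-(Dtil D L) * A₁) (-(Dhat D L) * A₁)) →
      (∀ z ∈ Set.Icc (-L) L, deriv (Mel A₁ B₁ D L) z ≠ 0) ∧
      (StrictMonoOn (Mel A₁ B₁ D L) (Set.Icc (-L) L) ∨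
        StrictAntiOn (Mel A₁ B₁ D L) (Set.Icc (-L) L))) := by
  have hD0 : 0 < D := by linarith
  have hs : 0 < Real.sinh L := Real.sinh_pos_iff.2 hL
  have hsD : 0 < Real.sinh (L / D) := Real.sinh_pos_iff.2 (div_pos hL hD0)
  have hk : Dtil D L ≠ 0 := by
    unfold Dtil
    positivity
  have hodd : ∀ z, Mel A₁ B₁ D L (-z) = -Mel A₁ B₁ D L z := by
    intro z
    simp only [Mel, neg_div, Real.sinh_neg]
    ring
  have hend : Mel A₁ B₁ D L L = A₁ + B₁ := by
    unfold Mel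
    field_simp
  have hder : ∀ z, deriv (Mel A₁ B₁ D L) z = _ := fun z => (hasDerivAt_Mel hD0 hL A₁ B₁ z).deriv
  have hcont : Continuous (Mel A₁ B₁ D L) :=
    continuous_iff_continuousAt.2 fun z => (hasDerivAt_Mel hD0 hL A₁ B₁ z).continuousAt
  have hDhat : -(Dhat D L) * A₁ = -(Dtil D L) * A₁ * coshRatio D L := by
    rw [Dhat_eq_Dtil_mul_coshRatio]
    ring
  rw [hDhat]
  have ha : -(Dtil D L) * A₁ = 0 → B₁ ≠ 0 := by
    intro h hB
    exact hAB (Prod.ext ((mul_eq_zero.1 h).resolve_left (neg_ne_zero.2 hk)) hB)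
  set a := -(Dtil D L) * A₁
  have hcoef : ∀ z, 0 < Real.cosh (z / D) / (D * Real.sinh (L / D)) := fun z =>
    div_pos (Real.cosh_pos _) (mul_pos hD0 hsD)
  have hzero : ∀ z, deriv (Mel A₁ B₁ D L) z = 0 ↔ B₁ = a * coshRatio D z := by
    intro z
    rw [hder, mul_eq_zero, or_iff_right (hcoef z).ne', sub_eq_zero]
  have habs : ∀ {z}, z ∈ Set.Icc (-L) L → |z| ∈ Set.Icc 0 L := fun hz =>
    ⟨abs_nonneg _, abs_le.2 hz⟩
  have hrange := mem_uIcc_iff_exists_mul_coshRatio hD hL.le a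
  have hmem : ∀ z ∈ Set.Icc (-L) L, a * coshRatio D z ∈ Set.uIcc a (a * coshRatio D L) :=
    fun z hz => (hrange _).2 ⟨|z|, habs hz, by rw [coshRatio_abs]⟩
  change _ ∧ _ ∧ _ ∧ (_ ↔ B₁ ∈ Set.uIcc a (a * coshRatio D L)) ∧
    (B₁ ∈ Set.uIcc a (a * coshRatio D L) → _) ∧ _
  refine ⟨hodd, hend, by rw [hodd, hend], ⟨?_, ?_⟩, ?_, ?_⟩
  · rintro ⟨z, hz, h⟩
    rw [(hzero z).1 h]
    exact hmem z hz
  · intro h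
    obtain ⟨z, hz, h⟩ := (hrange _).1 h
    exact ⟨z, ⟨by linarith [hz.1], hz.2⟩, (hzero z).2 h⟩
  · intro h
    obtain ⟨z, hz, h⟩ := (hrange _).1 h
    have ha0 : a ≠ 0 := by
      intro h0
      exact ha h0 (by rw [h, h0, zero_mul])
    have hinj : ∀ w, 0 ≤ w → (w = z ↔ B₁ = a * coshRatio D w) := by
      intro w hw
      constructor
      · rintro rfl
        exact h
      · intro hB
        exact (strictMonoOn_coshRatio hD).injOn hw hz.1 (mul_left_cancel₀ ha0 (hB.symm.trans h))
    refine ⟨z, ⟨hz, ?_, ?_, ?_⟩, ?_⟩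
    · ext w
      simp only [Set.mem_ofPred_eq, Set.mem_insert_iff, Set.mem_singleton_iff, hzero]
      constructor
      · rintro ⟨_, hB⟩
        rw [← coshRatio_abs] at hB
        exact (eq_or_eq_neg_of_abs_eq ((hinj _ (abs_nonneg w)).2 hB)).symm
      · rintro (rfl | rfl)
        · exact ⟨⟨by linarith [hz.2], by linarith [hz.1]⟩, by rwa [coshRatio_neg]⟩
        · exact ⟨⟨by linarith [hz.1], hz.2⟩, h⟩
    · rw [eq_comm, hinj 0 le_rfl, coshRatio_zero, mul_one]
    · rw [eq_comm, hinj L hL.le]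
    · rintro w ⟨hw, hset, -, -⟩
      have hwmem : w ∈ ({-w, w} : Set ℝ) := by simp
      rw [← hset] at hwmem
      exact (hinj w hw.1).2 ((hzero w).1 hwmem.2)
  · intro h
    refine ⟨fun z hz h0 => h ?_, ?_⟩
    · change B₁ ∈ Set.uIcc a (a * coshRatio D L)
      rw [(hzero z).1 h0]
      exact hmem z hz
    · rcases not_and_or.1 h with hlt | hgt
      · right
        refine strictAntiOn_of_deriv_neg (convex_Icc _ _) hcont.continuousOn fun z hz => ?_
        rw [hder]
        refine mul_neg_of_pos_of_neg (hcoef z) (sub_neg.2 ?_)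
        exact (not_le.1 hlt).trans_le (hmem z (interior_subset hz)).1
      · left
        refine strictMonoOn_of_deriv_pos (convex_Icc _ _) hcont.continuousOn fun z hz => ?_
        rw [hder]
        refine mul_pos (hcoef z) (sub_pos.2 ?_)
        exact (hmem z (interior_subset hz)).2.trans_lt (not_le.1 hgt)
end

section
/- Let D > 1, L > 0 and C₁ ≠ 0. For z ∈ [−L, 0) ∪ (0, L], the quantity D tanh(z/D) − tanh(z) is nonzero, so one may define A₁*(z) = C₁ sinh(L)/(cosh(z)(D tanh(z/D) − tanh(z))) and B₁*(z) = −C₁ D sinh(L/D)/(cosh(z/D)(D tanh(z/D) − tanh(z))). Then with the parameter choice (A₁, B₁) = (A₁*(z), B₁*(z)) the Melnikov function satisfies M(z) = −C₁ and M'(z) = 0, so the Melnikov equation M(·) + C₁ = 0 has a double root at z. Moreover B₁*(z)/A₁*(z) = −D̃ cosh(z)/cosh(z/D), which is an even function of z and strictly decreasing on (0, L]; the endpoint values are A₁*(±L) = ±C₁/(D̂ − 1) and B₁*(±L) = ∓C₁ D̂/(D̂ − 1) = ∓C₁ − A₁*(±L); and as z → 0, A₁*(z) = C₁ · 3D² sinh(L)/(z³(D²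 − 1)) · (1 + O(z²)) and B₁*(z) = −D̃ A₁*(z)(1 + O(z²)). -/
open Real Set Filter Asymptotics

/-- `A₁*(z) = C₁ sinh(L)/(cosh(z)(D tanh(z/D) − tanh(z)))`. -/
noncomputable def Astar (C₁ D L z : ℝ) : ℝ :=
  C₁ * Real.sinh L / (Real.cosh z * (D * Real.tanh (z / D) - Real.tanh z))

/-- `B₁*(z) = −C₁ D sinh(L/D)/(cosh(z/D)(D tanh(z/D) − tanh(z)))`. -/
noncomputable def Bstar (C₁ D L z : ℝ) : ℝ :=
  -(C₁ * D * Real.sinh (L / D)) / (Real.cosh (z / D) * (D * Real.tanh (z / D) - Real.tanh z))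

/-- The denominator of `Astar` and `Bstar` after clearing the hyperbolic cosines. -/
noncomputable def saddleDenom (D z : ℝ) : ℝ :=
  D * (Real.cosh z * Real.sinh (z / D)) - Real.sinh z * Real.cosh (z / D)

lemma cosh_mul_cosh_mul_tanh_sub (D z : ℝ) :
    Real.cosh z * Real.cosh (z / D) * (D * Real.tanh (z / D) - Real.tanh z) =
      saddleDenom D z := by
  have h1 := (Real.cosh_pos z).ne'
  have h2 := (Real.cosh_pos (z / D)).ne'
  rw [saddleDenom, Real.tanh_eq_sinh_div_cosh, Real.tanh_eq_sinh_div_cosh]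
  field_simp

lemma saddleDenom_neg (D z : ℝ) : saddleDenom D (-z) = -saddleDenom D z := by
  simp only [saddleDenom, neg_div, Real.cosh_neg, Real.sinh_neg]
  ring

lemma hasDerivAt_saddleDenom {D : ℝ} (hD : D ≠ 0) (z : ℝ) :
    HasDerivAt (saddleDenom D) ((D - 1 / D) * (Real.sinh z * Real.sinh (z / D))) z := by
  have hw : HasDerivAt (fun z : ℝ => z / D) (1 / D) z := (hasDerivAt_id z).div_const D
  have h := (((Real.hasDerivAt_cosh z).mul hw.sinh).const_mul D).sub
    ((Real.hasDerivAt_sinh z).mul hw.cosh)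
  refine h.congr_deriv ?_
  field_simp
  ring

lemma saddleDenom_pos {D z : ℝ} (hD : 1 < D) (hz : 0 < z) : 0 < saddleDenom D z := by
  have hD0 : 0 < D := by linarith
  have hmono : StrictMonoOn (saddleDenom D) (Set.Ici 0) := by
    refine strictMonoOn_of_deriv_pos (convex_Ici 0)
      (fun x _ => (hasDerivAt_saddleDenom hD0.ne' x).continuousAt.continuousWithinAt) ?_
    intro x hx
    rw [interior_Ici] at hx
    rw [(hasDerivAt_saddleDenom hD0.ne' x).deriv]
    have h1 : 0 < Real.sinh x := Real.sinh_pos_iff.2 hx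
    have h2 : 0 < Real.sinh (x / D) := Real.sinh_pos_iff.2 (div_pos hx hD0)
    have h3 : 1 / D < 1 := (div_lt_one hD0).2 hD
    have h4 : 0 < D - 1 / D := by linarith
    positivity
  have h := hmono (Set.mem_Ici.2 le_rfl) (Set.mem_Ici.2 hz.le) hz
  simpa [saddleDenom] using h

lemma saddleDenom_ne_zero {D z : ℝ} (hD : 1 < D) (hz : z ≠ 0) : saddleDenom D z ≠ 0 := by
  rcases lt_or_gt_of_ne hz with h | h
  · have := saddleDenom_pos hD (neg_pos.2 h)
    rw [saddleDenom_neg] at this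
    linarith
  · exact (saddleDenom_pos hD h).ne'

lemma mul_tanh_div_sub_tanh_ne_zero {D z : ℝ} (hD : 1 < D) (hz : z ≠ 0) :
    D * Real.tanh (z / D) - Real.tanh z ≠ 0 := by
  intro h
  apply saddleDenom_ne_zero hD hz
  rw [← cosh_mul_cosh_mul_tanh_sub, h, mul_zero]

lemma Astar_eq_div_saddleDenom (C₁ D L z : ℝ) :
    Astar C₁ D L z = C₁ * Real.sinh L * Real.cosh (z / D) / saddleDenom D z := by
  have h2 := (Real.cosh_pos (z / D)).ne'
  rw [Astar, ← cosh_mul_cosh_mul_tanh_sub, mul_right_comm (Real.cosh z),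
    mul_div_mul_right _ _ h2]

lemma Bstar_eq_div_saddleDenom (C₁ D L z : ℝ) :
    Bstar C₁ D L z = -(C₁ * D * Real.sinh (L / D)) * Real.cosh z / saddleDenom D z := by
  have h1 := (Real.cosh_pos z).ne'
  rw [Bstar, ← cosh_mul_cosh_mul_tanh_sub, mul_comm (-_) (Real.cosh z),
    mul_assoc (Real.cosh z), mul_div_mul_left _ _ h1]

lemma Astar_neg (C₁ D L z : ℝ) : Astar C₁ D L (-z) = -Astar C₁ D L z := by
  simp only [Astar_eq_div_saddleDenom, saddleDenom_neg, neg_div, Real.cosh_neg, div_neg]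

lemma Bstar_neg (C₁ D L z : ℝ) : Bstar C₁ D L (-z) = -Bstar C₁ D L z := by
  simp only [Bstar_eq_div_saddleDenom, saddleDenom_neg, Real.cosh_neg, div_neg]

lemma Bstar_eq_mul_Astar {D L : ℝ} (C₁ z : ℝ) (hL : L ≠ 0) :
    Bstar C₁ D L z =
      -(Dtil D L) * Astar C₁ D L z * (Real.cosh z / Real.cosh (z / D)) := by
  have h2 := (Real.cosh_pos (z / D)).ne'
  have h3 : Real.sinh L ≠ 0 := Real.sinh_ne_zero.2 hL
  rw [Astar_eq_div_saddleDenom, Bstar_eq_div_saddleDenom, Dtil]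
  field_simp

lemma Mel_Astar_Bstar {D L z : ℝ} (C₁ : ℝ) (hD : 1 < D) (hL : 0 < L) (hz : z ≠ 0) :
    Mel (Astar C₁ D L z) (Bstar C₁ D L z) D L z = -C₁ := by
  have hs : Real.sinh L ≠ 0 := Real.sinh_ne_zero.2 hL.ne'
  have hs' : Real.sinh (L / D) ≠ 0 := Real.sinh_ne_zero.2 (by positivity)
  have hP := saddleDenom_ne_zero hD hz
  rw [Mel, Astar_eq_div_saddleDenom, Bstar_eq_div_saddleDenom]
  field_simp
  rw [saddleDenom]
  ring

lemma hasDerivAt_Mel_s12 (A₁ B₁ D L z : ℝ) :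
    HasDerivAt (Mel A₁ B₁ D L)
      (A₁ * Real.cosh z / Real.sinh L +
        B₁ * (Real.cosh (z / D) * (1 / D)) / Real.sinh (L / D)) z := by
  have hw : HasDerivAt (fun z : ℝ => z / D) (1 / D) z := (hasDerivAt_id z).div_const D
  exact (((Real.hasDerivAt_sinh z).const_mul A₁).div_const _).add
    ((hw.sinh.const_mul B₁).div_const _)

lemma deriv_Mel_Astar_Bstar {D L z : ℝ} (C₁ : ℝ) (hD : 1 < D) (hL : 0 < L) (hz : z ≠ 0) :
    deriv (Mel (Astar C₁ D L z) (Bstar C₁ D L z) D L) z = 0 := by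
  have hD0 : D ≠ 0 := by linarith
  have hs : Real.sinh L ≠ 0 := Real.sinh_ne_zero.2 hL.ne'
  have hs' : Real.sinh (L / D) ≠ 0 := Real.sinh_ne_zero.2 (by positivity)
  have hP := saddleDenom_ne_zero hD hz
  rw [(hasDerivAt_Mel_s12 _ _ _ _ _).deriv, Astar_eq_div_saddleDenom, Bstar_eq_div_saddleDenom]
  field_simp
  ring

lemma strictMonoOn_cosh_div_cosh_div {D : ℝ} (hD : 1 < D) :
    StrictMonoOn (fun z : ℝ => Real.cosh z / Real.cosh (z / D)) (Set.Ici 0) := by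
  intro x hx y hy hxy
  have hx0 : 0 ≤ x := hx
  have hD0 : 0 < D := by linarith
  have hc : D⁻¹ < 1 := inv_lt_one_of_one_lt₀ hD
  have hc0 : 0 < D⁻¹ := inv_pos.2 hD0
  change Real.cosh x / Real.cosh (x / D) < Real.cosh y / Real.cosh (y / D)
  rw [div_lt_div_iff₀ (Real.cosh_pos _) (Real.cosh_pos _), div_eq_mul_inv, div_eq_mul_inv]
  have h1 : Real.cosh (x + y * D⁻¹) < Real.cosh (y + x * D⁻¹) := by
    rw [Real.cosh_lt_cosh, abs_of_nonneg (by nlinarith), abs_of_nonneg (by nlinarith)]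
    nlinarith
  have h2 : Real.cosh (x - y * D⁻¹) < Real.cosh (y - x * D⁻¹) := by
    rw [Real.cosh_lt_cosh, abs_of_nonneg (a := y - x * D⁻¹) (by nlinarith), abs_lt]
    constructor <;> nlinarith
  rw [Real.cosh_add, Real.cosh_add] at h1
  rw [Real.cosh_sub, Real.cosh_sub] at h2
  linarith

lemma Dtil_pos {D L : ℝ} (hD : 0 < D) (hL : 0 < L) : 0 < Dtil D L := by
  have h1 : 0 < Real.sinh L := Real.sinh_pos_iff.2 hL
  have h2 : 0 < Real.sinh (L / D) := Real.sinh_pos_iff.2 (by positivity)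
  unfold Dtil
  positivity

lemma Dhat_sub_one_ne_zero {D L : ℝ} (hD : 1 < D) (hL : 0 < L) : Dhat D L - 1 ≠ 0 := by
  have ht : Real.tanh L ≠ 0 := by
    rw [Real.tanh_eq_sinh_div_cosh]
    exact div_ne_zero (Real.sinh_ne_zero.2 hL.ne') (Real.cosh_pos L).ne'
  rw [Dhat, div_sub_one ht]
  exact div_ne_zero (mul_tanh_div_sub_tanh_ne_zero hD hL.ne') ht

lemma Dhat_sub_one_eq {D L : ℝ} (hL : 0 < L) :
    Dhat D L - 1 = saddleDenom D L / (Real.sinh L * Real.cosh (L / D)) := by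
  have hs : Real.sinh L ≠ 0 := Real.sinh_ne_zero.2 hL.ne'
  have h1 := (Real.cosh_pos L).ne'
  have h2 := (Real.cosh_pos (L / D)).ne'
  rw [Dhat, saddleDenom, Real.tanh_eq_sinh_div_cosh, Real.tanh_eq_sinh_div_cosh]
  field_simp

lemma Astar_right_endpoint {D L : ℝ} (C₁ : ℝ) (hL : 0 < L) :
    Astar C₁ D L L = C₁ / (Dhat D L - 1) := by
  rw [Dhat_sub_one_eq hL, Astar_eq_div_saddleDenom, div_div_eq_mul_div, mul_assoc]

lemma Bstar_right_endpoint {D L : ℝ} (C₁ : ℝ) (hD : 1 < D) (hL : 0 < L) :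
    Bstar C₁ D L L = -C₁ - Astar C₁ D L L := by
  have hP := saddleDenom_ne_zero hD hL.ne'
  rw [Astar_eq_div_saddleDenom, Bstar_eq_div_saddleDenom]
  field_simp
  rw [saddleDenom]
  ring

lemma abs_sinh_sub_taylor_le {x : ℝ} (hx : |x| ≤ 1) :
    |Real.sinh x - (x + x ^ 3 / 6)| ≤ |x| ^ 5 := by
  have h1 := Real.exp_bound hx (n := 5) (by norm_num)
  have h2 := Real.exp_bound (x := -x) (by rwa [abs_neg]) (n := 5) (by norm_num)
  rw [abs_neg] at h2
  have h5 : 0 ≤ |x| ^ 5 := by positivity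
  simp only [Finset.sum_range_succ, Finset.sum_range_zero, Nat.factorial] at h1 h2
  norm_num at h1 h2
  rw [abs_le] at h1 h2 ⊢
  rw [Real.sinh_eq]
  constructor <;> nlinarith [h1.1, h1.2, h2.1, h2.2]

lemma sinh_sub_taylor_isBigO :
    (fun x : ℝ => Real.sinh x - (x + x ^ 3 / 6)) =O[nhds 0] fun x => x ^ 5 := by
  refine IsBigO.of_bound 1 ?_
  filter_upwards [Metric.closedBall_mem_nhds (0 : ℝ) one_pos] with x hx
  rw [mem_closedBall_zero_iff, Real.norm_eq_abs] at hx
  simpa using abs_sinh_sub_taylor_le hx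

lemma cosh_sub_one_isBigO :
    (fun x : ℝ => Real.cosh x - 1) =O[nhds 0] fun x => x ^ 2 := by
  refine IsBigO.of_bound 1 ?_
  filter_upwards [Metric.closedBall_mem_nhds (0 : ℝ) one_pos] with x hx
  rw [mem_closedBall_zero_iff, Real.norm_eq_abs] at hx
  have h1 := Real.abs_exp_sub_one_sub_id_le hx
  have h2 := Real.abs_exp_sub_one_sub_id_le (x := -x) (by rwa [abs_neg])
  rw [abs_le] at h1 h2
  rw [Real.norm_eq_abs, Real.norm_eq_abs, abs_of_nonneg (sq_nonneg x), abs_le, Real.cosh_eq]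
  constructor <;> nlinarith [h1.1, h1.2, h2.1, h2.2]

lemma IsBigO.comp_const_mul_pow {f : ℝ → ℝ} {n : ℕ} (hf : f =O[nhds 0] fun x => x ^ n)
    (c : ℝ) : (fun x => f (c * x)) =O[nhds 0] fun x => x ^ n := by
  have ht : Tendsto (fun x : ℝ => c * x) (nhds 0) (nhds 0) := by
    simpa using (continuous_const_mul c).tendsto 0
  refine (hf.comp_tendsto ht).trans ?_
  simp only [Function.comp_def, mul_pow]
  exact (isBigO_refl _ _).const_mul_left _

lemma saddleDenom_eq_sinh_sub_sinh (D z : ℝ) :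
    saddleDenom D z = (D - 1) / 2 * Real.sinh ((1 + D⁻¹) * z) -
      (D + 1) / 2 * Real.sinh ((1 - D⁻¹) * z) := by
  have h1 : (1 + D⁻¹) * z = z + z / D := by ring
  have h2 : (1 - D⁻¹) * z = z - z / D := by ring
  rw [h1, h2, Real.sinh_add, Real.sinh_sub, saddleDenom]
  ring

lemma saddleDenom_sub_cubic_isBigO {D : ℝ} (hD : D ≠ 0) :
    (fun z => saddleDenom D z - (D ^ 2 - 1) / (3 * D ^ 2) * z ^ 3) =O[nhds 0]
      fun z => z ^ 5 := by
  have h := ((IsBigO.comp_const_mul_pow sinh_sub_taylor_isBigO (1 + D⁻¹)).const_mul_left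
    ((D - 1) / 2)).sub ((IsBigO.comp_const_mul_pow sinh_sub_taylor_isBigO
      (1 - D⁻¹)).const_mul_left ((D + 1) / 2))
  refine h.congr_left fun z => ?_
  rw [saddleDenom_eq_sinh_sub_sinh]
  field_simp
  ring

lemma pow_three_isBigO_saddleDenom {D : ℝ} (hD : 1 < D) :
    (fun z : ℝ => z ^ 3) =O[nhds 0] saddleDenom D := by
  have hD0 : 0 < D := by linarith
  have hK : (D ^ 2 - 1) / (3 * D ^ 2) ≠ 0 := by
    have : 0 < D ^ 2 - 1 := by nlinarith
    positivity
  have h : IsEquivalent (nhds 0) (saddleDenom D)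
      (fun z => (D ^ 2 - 1) / (3 * D ^ 2) * z ^ 3) := by
    refine IsLittleO.const_mul_right hK ?_
    exact (saddleDenom_sub_cubic_isBigO hD0.ne').trans_isLittleO
      (isLittleO_pow_pow (by norm_num))
  exact ((isBigO_refl _ _).const_mul_right hK).trans h.isBigO_symm

lemma cosh_mul_cubic_div_saddleDenom_sub_one_isBigO {D : ℝ} (hD : 1 < D) :
    (fun z => Real.cosh (z / D) * ((D ^ 2 - 1) / (3 * D ^ 2) * z ^ 3) / saddleDenom D z - 1)
      =O[nhdsWithin 0 {(0 : ℝ)}ᶜ] fun z => z ^ 2 := by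
  have hD0 : D ≠ 0 := by linarith
  have hcosh : (fun z => (Real.cosh (D⁻¹ * z) - 1) * ((D ^ 2 - 1) / (3 * D ^ 2) * z ^ 3))
      =O[nhds 0] fun z => z ^ 2 * z ^ 3 :=
    (IsBigO.comp_const_mul_pow cosh_sub_one_isBigO D⁻¹).mul
      ((isBigO_refl _ _).const_mul_left _)
  have hnum := (hcosh.trans (isBigO_of_le _ fun z => by rw [← pow_add])).sub
    (saddleDenom_sub_cubic_isBigO hD0)
  have hinv : (fun z => (saddleDenom D z)⁻¹) =O[nhdsWithin 0 {(0 : ℝ)}ᶜ]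
      fun z => (z ^ 3)⁻¹ := by
    refine ((pow_three_isBigO_saddleDenom hD).mono nhdsWithin_le_nhds).inv_rev ?_
    filter_upwards [self_mem_nhdsWithin] with z hz h0
    exact absurd h0 (pow_ne_zero 3 hz)
  refine ((hnum.mono nhdsWithin_le_nhds).mul hinv).congr' ?_ ?_
  · filter_upwards [self_mem_nhdsWithin] with z hz
    have hP := saddleDenom_ne_zero hD hz
    rw [div_eq_inv_mul z D]
    field_simp
    ring
  · filter_upwards [self_mem_nhdsWithin] with z hz
    have hz0 : z ≠ 0 := hz
    field_simp

lemma cosh_div_cosh_div_sub_one_isBigO (D : ℝ) :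
    (fun z => Real.cosh z / Real.cosh (z / D) - 1) =O[nhds 0] fun z => z ^ 2 := by
  have hnum := cosh_sub_one_isBigO.sub (IsBigO.comp_const_mul_pow cosh_sub_one_isBigO D⁻¹)
  refine IsBigO.trans (isBigO_of_le _ fun z => ?_) hnum
  have hc := Real.cosh_pos (z / D)
  rw [← div_eq_inv_mul z D, div_sub_one hc.ne', norm_div, sub_sub_sub_cancel_right]
  refine div_le_self (norm_nonneg _) ?_
  rw [Real.norm_eq_abs, abs_of_pos hc]
  exact Real.one_le_cosh _

/-- Lemma C.1, item (3): the saddle-node curve `(A₁*(z), B₁*(z))` of double roots of the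
Melnikov equation `M(·) + C₁ = 0`, its ratio `B₁*/A₁* = −D̃ cosh(z)/cosh(z/D)` (even and
strictly decreasing on `(0,L]`), its endpoint values at `z = ±L`, and its asymptotics as
`z → 0`. -/
theorem melnikov_saddle_node_curve (D L C₁ : ℝ) (hD : 1 < D) (hL : 0 < L) (hC : C₁ ≠ 0) :
    (∀ z ∈ Set.Icc (-L) L, z ≠ 0 → D * Real.tanh (z / D) - Real.tanh z ≠ 0) ∧
    (∀ z ∈ Set.Icc (-L) L, z ≠ 0 →
      Mel (Astar C₁ D L z) (Bstar C₁ D L z) D L z = -C₁ ∧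
      deriv (Mel (Astar C₁ D L z) (Bstar C₁ D L z) D L) z = 0) ∧
    (∀ z ∈ Set.Icc (-L) L, z ≠ 0 →
      Bstar C₁ D L z / Astar C₁ D L z = -(Dtil D L) * Real.cosh z / Real.cosh (z / D)) ∧
    (∀ z : ℝ, -(Dtil D L) * Real.cosh (-z) / Real.cosh (-z / D) =
      -(Dtil D L) * Real.cosh z / Real.cosh (z / D)) ∧
    StrictAntiOn (fun z : ℝ => -(Dtil D L) * Real.cosh z / Real.cosh (z / D))
      (Set.Ioc 0 L) ∧
    (Astar C₁ D L L = C₁ / (Dhat D L - 1) ∧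
      Astar C₁ D L (-L) = -(C₁ / (Dhat D L - 1)) ∧
      Bstar C₁ D L L = -(C₁ * Dhat D L / (Dhat D L - 1)) ∧
      Bstar C₁ D L L = -C₁ - Astar C₁ D L L ∧
      Bstar C₁ D L (-L) = C₁ * Dhat D L / (Dhat D L - 1) ∧
      Bstar C₁ D L (-L) = C₁ - Astar C₁ D L (-L)) ∧
    (∃ g₁ g₂ : ℝ → ℝ,
      (∀ᶠ z in nhdsWithin 0 {(0 : ℝ)}ᶜ,
        Astar C₁ D L z =
          C₁ * (3 * D ^ 2 * Real.sinh L) / (z ^ 3 * (D ^ 2 - 1)) * (1 + g₁ z)) ∧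
      (∀ᶠ z in nhdsWithin 0 {(0 : ℝ)}ᶜ,
        Bstar C₁ D L z = -(Dtil D L) * Astar C₁ D L z * (1 + g₂ z)) ∧
      g₁ =O[nhdsWithin 0 {(0 : ℝ)}ᶜ] (fun z => z ^ 2) ∧
      g₂ =O[nhdsWithin 0 {(0 : ℝ)}ᶜ] (fun z => z ^ 2)) := by
  have hD0 : 0 < D := by linarith
  have hK : D ^ 2 - 1 ≠ 0 := by nlinarith
  have hB : Bstar C₁ D L L = -(C₁ * Dhat D L / (Dhat D L - 1)) := by
    have h := Dhat_sub_one_ne_zero hD hL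
    rw [Bstar_right_endpoint C₁ hD hL, Astar_right_endpoint C₁ hL]
    field_simp
    ring
  refine ⟨fun z _ hz => mul_tanh_div_sub_tanh_ne_zero hD hz,
    fun z _ hz => ⟨Mel_Astar_Bstar C₁ hD hL hz, deriv_Mel_Astar_Bstar C₁ hD hL hz⟩,
    fun z _ hz => ?_, fun z => by rw [neg_div, Real.cosh_neg, Real.cosh_neg], ?_,
    ⟨Astar_right_endpoint C₁ hL, ?_, hB, Bstar_right_endpoint C₁ hD hL, ?_, ?_⟩, ?_⟩
  · have hA : Astar C₁ D L z ≠ 0 := by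
      rw [Astar_eq_div_saddleDenom]
      exact div_ne_zero (mul_ne_zero (mul_ne_zero hC (Real.sinh_ne_zero.2 hL.ne'))
        (Real.cosh_pos _).ne') (saddleDenom_ne_zero hD hz)
    rw [Bstar_eq_mul_Astar C₁ z hL.ne']
    field_simp
  · intro x hx y hy hxy
    have h := strictMonoOn_cosh_div_cosh_div hD (Set.mem_Ici.2 hx.1.le)
      (Set.mem_Ici.2 hy.1.le) hxy
    simp only [neg_mul, neg_div, mul_div_assoc]
    exact neg_lt_neg (mul_lt_mul_of_pos_left h (Dtil_pos hD0 hL))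
  · rw [Astar_neg, Astar_right_endpoint C₁ hL]
  · rw [Bstar_neg, hB, neg_neg]
  · rw [Bstar_neg, Astar_neg, Bstar_right_endpoint C₁ hD hL]
    ring
  · refine ⟨_, _, ?_, ?_, cosh_mul_cubic_div_saddleDenom_sub_one_isBigO hD,
      (cosh_div_cosh_div_sub_one_isBigO D).mono nhdsWithin_le_nhds⟩
    · filter_upwards [self_mem_nhdsWithin] with z hz
      have hz0 : z ≠ 0 := hz
      have hP := saddleDenom_ne_zero hD hz0
      rw [Astar_eq_div_saddleDenom]
      field_simp
      ring
    · filter_upwards with z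
      rw [Bstar_eq_mul_Astar C₁ z hL.ne', add_sub_cancel]
end
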